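/- Let ℒ = ∂_i(A_{ij}∂_j·) in ℝⁿ₊ satisfy the hypotheses of the extended-range Dirichlet theorem with smooth coefficients: A₀₀ = 1, Im A_{0j} = 0 for 1 ≤ j ≤ n−1, dμ = sup_{B_{δ(x)/2}(x)}|∇A|² δ(x) dx Carleson with sufficiently small norm, p₀ = inf{p > 1 : A is p-elliptic}, and p_max = ∞ if p₀′ ≥ n−1, p_max = p₀′(n−1)/(n−1−p₀′) otherwise. Then for each p with 2 < p < p_max there exist constants β > 1, m > 1 and C > 0 such that for every boundary ball Δ ⊂ ℝ^{n−1} and every energy solution u of ℒu = 0 whose boundary datum f = u|_{∂ℝⁿ₊} vanishes on 4βmΔ, the reverse Hölder inequality holds: (⨍_Δ [Ñ_{2,a}(u)]^p dx')^{1/p} ≤ C (⨍_{3βmΔ} [Ñ_{2,a}(u)]² dx')^{1/2}. -/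

import Mathlib

open MeasureTheory Metric Set Filter
open scoped ENNReal NNReal Topology

noncomputable section

namespace DP

/-- Points of the upper half space model: `ℝ^{n+1}` with the Euclidean metric.
(The boundary dimension is `n`; the paper's dimension is `n+1`.) -/
abbrev Pt (n : ℕ) := EuclideanSpace ℝ (Fin (n + 1))

/-- Boundary points `ℝ^n`. -/
abbrev BPt (n : ℕ) := EuclideanSpace ℝ (Fin n)

variable {n : ℕ}

/-- Assemble a point from its height `x0` and horizontal coordinates `x'`. -/
def pt (x0 : ℝ) (x' : BPt n) : Pt n :=
  (EuclideanSpace.equiv (Fin (n + 1)) ℝ).symm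
    (Fin.cons x0 (EuclideanSpace.equiv (Fin n) ℝ x'))

/-- The height `x₀ = δ(x)` of a point (distance to the boundary). -/
def dd (x : Pt n) : ℝ := x 0

/-- Horizontal coordinates of a point. -/
def bdry (x : Pt n) : BPt n :=
  (EuclideanSpace.equiv (Fin n) ℝ).symm (fun i => x i.succ)

/-- The upper half space `Ω = ℝ^{n+1}_+`. -/
def upperHalf (n : ℕ) : Set (Pt n) := {x | 0 < dd x}

/-- The nontangential cone `Γ_a(Q) = {(y₀,y') ∈ Ω : a|q₀ − y₀| > |q' − y'|}`. -/
def cone (a : ℝ) (Q : Pt n) : Set (Pt n) :=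
  {y | 0 < dd y ∧ dist (bdry Q) (bdry y) < a * |dd Q - dd y|}

/-- Truncated cone `Γ_a^h(Q)`. -/
def tcone (a h : ℝ) (Q : Pt n) : Set (Pt n) := cone a Q ∩ {y | dd y ≤ h}

/-- `L^p` average of `w` over the Whitney ball `B_{δ(x)/2}(x)`. -/
def avg (p : ℝ) {E : Type*} [NormedAddCommGroup E] (w : Pt n → E) (x : Pt n) : ℝ≥0∞ :=
  ((volume (ball x (dd x / 2)))⁻¹ *
    ∫⁻ z in ball x (dd x / 2), (‖w z‖₊ : ℝ≥0∞) ^ p) ^ (1 / p)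

/-- Averaged nontangential maximal function `Ñ_{p,a}(w)` at `x' ∈ ∂Ω`. -/
def ntMax (p a : ℝ) {E : Type*} [NormedAddCommGroup E] (w : Pt n → E) (x' : BPt n) : ℝ≥0∞ :=
  ⨆ x ∈ cone a (pt 0 x'), avg p w x

/-- Truncated averaged nontangential maximal function `Ñ^h_{p,a}(w)`. -/
def ntMaxT (p a h : ℝ) {E : Type*} [NormedAddCommGroup E] (w : Pt n → E) (x' : BPt n) : ℝ≥0∞ :=
  ⨆ x ∈ tcone a h (pt 0 x'), avg p w x

/-- Partial derivative `∂_k u`. -/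
def pdG {N : ℕ} (u : EuclideanSpace ℝ (Fin N) → ℂ) (k : Fin N)
    (x : EuclideanSpace ℝ (Fin N)) : ℂ :=
  fderiv ℝ u x (EuclideanSpace.single k (1 : ℝ))

/-- Partial derivative `∂_k u` in the half-space model. -/
def pd (u : Pt n → ℂ) (k : Fin (n + 1)) (x : Pt n) : ℂ := pdG u k x

/-- The `p`-adapted square function of a scalar function `w`, aperture `a`:
`S_{p,a}(w)(x') = (∫_{Γ_a(x')} |∇w|² |w|^{p−2} δ(x)^{2−(n+1)} dx)^{1/2}`. -/
def sqF (p a : ℝ) (w : Pt n → ℂ) (x' : BPt n) : ℝ≥0∞ :=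
  (∫⁻ x in cone a (pt 0 x'),
      (‖fderiv ℝ w x‖₊ : ℝ≥0∞) ^ (2 : ℝ) * (‖w x‖₊ : ℝ≥0∞) ^ (p - 2) *
        ENNReal.ofReal (dd x ^ ((2 : ℝ) - (n + 1)))) ^ (1 / (2 : ℝ))

/-- Truncated `p`-adapted square function `S^h_{p,a}`. -/
def sqFT (p a h : ℝ) (w : Pt n → ℂ) (x' : BPt n) : ℝ≥0∞ :=
  (∫⁻ x in tcone a h (pt 0 x'),
      (‖fderiv ℝ w x‖₊ : ℝ≥0∞) ^ (2 : ℝ) * (‖w x‖₊ : ℝ≥0∞) ^ (p - 2) *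
        ENNReal.ofReal (dd x ^ ((2 : ℝ) - (n + 1)))) ^ (1 / (2 : ℝ))

/-- `S_{p,a}(∇_T u)`: sum of square functions of the tangential derivatives. -/
def sqTan (p a : ℝ) (u : Pt n → ℂ) (x' : BPt n) : ℝ≥0∞ :=
  ∑ k : Fin n, sqF p a (pd u k.succ) x'

/-- Truncated `S^h_{p,a}(∇_T u)`. -/
def sqTanT (p a h : ℝ) (u : Pt n → ℂ) (x' : BPt n) : ℝ≥0∞ :=
  ∑ k : Fin n, sqFT p a h (pd u k.succ) x'

/-- `S_{p,a}(∇u)`: sum of square functions of all partial derivatives. -/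
def sqGrad (p a : ℝ) (u : Pt n → ℂ) (x' : BPt n) : ℝ≥0∞ :=
  ∑ k : Fin (n + 1), sqF p a (pd u k) x'

/-- Truncated `S^h_{p,a}(∇u)`. -/
def sqGradT (p a h : ℝ) (u : Pt n → ℂ) (x' : BPt n) : ℝ≥0∞ :=
  ∑ k : Fin (n + 1), sqFT p a h (pd u k) x'

/-- The ℝ-linear map `J_p(α+iβ) = α/p + iβ/p'`. -/
def Jp (p : ℝ) {N : ℕ} (ξ : Fin N → ℂ) : Fin N → ℂ := fun i =>
  (((ξ i).re / p : ℝ) : ℂ) + Complex.I * (((ξ i).im * (1 - 1 / p) : ℝ) : ℂ)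

/-- `A` is `p`-elliptic on `Ω` with constants `lam` (lower) and `Lam` (upper):
`Re⟨A(x)ξ, J_p ξ⟩ ≥ λ_p |ξ|²` and `|⟨A(x)ξ, η⟩| ≤ Λ|ξ||η|` for a.e. `x ∈ Ω`. -/
def IsPElliptic (p lam Lam : ℝ) {N : ℕ} (Ω : Set (EuclideanSpace ℝ (Fin N)))
    (A : EuclideanSpace ℝ (Fin N) → Fin N → Fin N → ℂ) : Prop :=
  (∀ᵐ x ∂(volume.restrict Ω), ∀ ξ : EuclideanSpace ℂ (Fin N),
      lam * ‖ξ‖ ^ 2 ≤ (∑ i, (∑ j, A x i j * ξ j) * (starRingEnd ℂ) (Jp p ξ i)).re) ∧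
  (∀ᵐ x ∂(volume.restrict Ω), ∀ ξ η : EuclideanSpace ℂ (Fin N),
      ‖∑ i, (∑ j, A x i j * ξ j) * (starRingEnd ℂ) (η i)‖ ≤ Lam * ‖ξ‖ * ‖η‖)

/-- `p₀ = inf{p > 1 : A is p-elliptic}` (for some lower constant, with upper constant `Lam`). -/
def pZero {N : ℕ} (Ω : Set (EuclideanSpace ℝ (Fin N)))
    (A : EuclideanSpace ℝ (Fin N) → Fin N → Fin N → ℂ) (Lam : ℝ) : ℝ :=
  sInf {q : ℝ | 1 < q ∧ ∃ l : ℝ, 0 < l ∧ IsPElliptic q l Lam Ω A}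

/-- The Carleson norm of a measure on the upper half space:
`‖μ‖_C = sup_{Q,r} μ(T(Δ_r(Q))) / σ(Δ_r(Q))`. -/
def carlesonNorm (μ : Measure (Pt n)) : ℝ≥0∞ :=
  ⨆ (Q : BPt n) (r : ℝ) (_ : 0 < r),
    μ (upperHalf n ∩ ball (pt 0 Q) r) / volume (ball (0 : BPt n) r)

/-- The density `sup_{B_{δ(x)/2}(x)} (|∇A|² + |B|²) · δ(x)`. -/
def coefDensity (A : Pt n → Fin (n + 1) → Fin (n + 1) → ℂ)
    (B : Pt n → EuclideanSpace ℂ (Fin (n + 1))) (x : Pt n) : ℝ≥0∞ :=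
  (⨆ y ∈ ball x (dd x / 2),
      ((‖fderiv ℝ A y‖₊ : ℝ≥0∞) ^ (2 : ℝ) + (‖B y‖₊ : ℝ≥0∞) ^ (2 : ℝ))) *
    ENNReal.ofReal (dd x)

/-- The measure `dμ(x) = sup_{B_{δ(x)/2}(x)}(|∇A|² + |B|²) δ(x) dx` on `Ω`. -/
def coefMeasure (A : Pt n → Fin (n + 1) → Fin (n + 1) → ℂ)
    (B : Pt n → EuclideanSpace ℂ (Fin (n + 1))) : Measure (Pt n) :=
  (volume.restrict (upperHalf n)).withDensity (coefDensity A B)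

/-- The density `sup_{B_{δ(x)/2}(x)} |∇A|² · δ(x)` (no drift term). -/
def coefDensityA (A : Pt n → Fin (n + 1) → Fin (n + 1) → ℂ) (x : Pt n) : ℝ≥0∞ :=
  (⨆ y ∈ ball x (dd x / 2), (‖fderiv ℝ A y‖₊ : ℝ≥0∞) ^ (2 : ℝ)) * ENNReal.ofReal (dd x)

/-- The measure `dμ(x) = sup_{B_{δ(x)/2}(x)} |∇A|² δ(x) dx` on `Ω`. -/
def coefMeasureA (A : Pt n → Fin (n + 1) → Fin (n + 1) → ℂ) : Measure (Pt n) :=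
  (volume.restrict (upperHalf n)).withDensity (coefDensityA A)

/-- Weak solution of `∂_i(A_{ij}∂_j u) + B_i ∂_i u = 0` in the upper half space:
`∫ A_{ij} ∂_j u ∂_i φ dx = ∫ B_i ∂_i u φ dx` for all test functions `φ`. -/
def WeakSol (A : Pt n → Fin (n + 1) → Fin (n + 1) → ℂ)
    (B : Pt n → EuclideanSpace ℂ (Fin (n + 1))) (u : Pt n → ℂ) : Prop :=
  ∀ φ : Pt n → ℂ, ContDiff ℝ (⊤ : ℕ∞) φ → HasCompactSupport φ → tsupport φ ⊆ upperHalf n →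
    ∫ x in upperHalf n, ∑ i, ∑ j, A x i j * pd u j x * pd φ i x =
      ∫ x in upperHalf n, (∑ i, B x i * pd u i x) * φ x

/-- Weak solution of `∂_i(A_{ij}∂_j u) = 0` in the upper half space. -/
def WeakSol0 (A : Pt n → Fin (n + 1) → Fin (n + 1) → ℂ) (u : Pt n → ℂ) : Prop :=
  ∀ φ : Pt n → ℂ, ContDiff ℝ (⊤ : ℕ∞) φ → HasCompactSupport φ → tsupport φ ⊆ upperHalf n →
    ∫ x in upperHalf n, ∑ i, ∑ j, A x i j * pd u j x * pd φ i x = 0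

/-- Weak solution of `div(A∇u) = 0` on a general open set `Ω`. -/
def WeakSolOn {N : ℕ} (Ω : Set (EuclideanSpace ℝ (Fin N)))
    (A : EuclideanSpace ℝ (Fin N) → Fin N → Fin N → ℂ)
    (u : EuclideanSpace ℝ (Fin N) → ℂ) : Prop :=
  ∀ φ : EuclideanSpace ℝ (Fin N) → ℂ,
    ContDiff ℝ (⊤ : ℕ∞) φ → HasCompactSupport φ → tsupport φ ⊆ Ω →
      ∫ x in Ω, ∑ i, ∑ j, A x i j * pdG u j x * pdG φ i x = 0

/-- `u` has finite energy: `∇u ∈ L²(Ω)`. -/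
def Energy (u : Pt n → ℂ) : Prop :=
  (∫⁻ x in upperHalf n, (‖fderiv ℝ u x‖₊ : ℝ≥0∞) ^ (2 : ℝ)) < ∞

/-- `u` attains `f` as its boundary datum (a.e. vertical convergence to the trace). -/
def HasTrace (u : Pt n → ℂ) (f : BPt n → ℂ) : Prop :=
  ∀ᵐ x' : BPt n ∂volume, Tendsto (fun t : ℝ => u (pt t x')) (𝓝[>] (0 : ℝ)) (𝓝 (f x'))

/-- The homogeneous Besov `Ḃ^{2,2}_{1/2}(∂Ω)` seminorm (squared). -/
def besovSq (f : BPt n → ℂ) : ℝ≥0∞ :=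
  ∫⁻ x' : BPt n, ∫⁻ y' : BPt n,
    (‖f x' - f y'‖₊ : ℝ≥0∞) ^ (2 : ℝ) * ENNReal.ofReal (dist x' y' ^ (-((n : ℝ) + 1)))

/-- `L^e` "norm" over a boundary set. -/
def lpS (e : ℝ) (s : Set (BPt n)) (g : BPt n → ℝ≥0∞) : ℝ≥0∞ :=
  (∫⁻ x' in s, g x' ^ e) ^ (1 / e)

/-- `L^e` "norm" over the whole boundary. -/
def lpAll (e : ℝ) (g : BPt n → ℝ≥0∞) : ℝ≥0∞ :=
  (∫⁻ x' : BPt n, g x' ^ e) ^ (1 / e)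

/-- Average of an `ℝ≥0∞`-valued function over a set. -/
def avgI {α : Type*} [MeasureSpace α] (s : Set α) (g : α → ℝ≥0∞) : ℝ≥0∞ :=
  (volume s)⁻¹ * ∫⁻ y in s, g y

/-- `h_{ν,a}(W)(x') = inf{t > 0 : sup_{Γ_a((t,x'))} W < ν}` for `ℝ≥0∞`-valued `W`. -/
def hfunE (a ν : ℝ) (W : Pt n → ℝ≥0∞) (x' : BPt n) : ℝ :=
  sInf {t : ℝ | 0 < t ∧ (⨆ z ∈ cone a (pt t x'), W z) < ENNReal.ofReal ν}

/-- `h_{ν,a}(w)` for a nonnegative real-valued `w`. -/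
def hfunR (a ν : ℝ) (w : Pt n → ℝ) (x' : BPt n) : ℝ :=
  hfunE a ν (fun z => ENNReal.ofReal (w z)) x'

/-- Hardy–Littlewood maximal function on the graph `Λ_h`, parametrised by `ℝ^n`. -/
def graphMax (h : BPt n → ℝ) (W : Pt n → ℝ≥0∞) (q' : BPt n) : ℝ≥0∞ :=
  ⨆ (r : ℝ) (_ : 0 < r),
    (volume {z' : BPt n | pt (h z') z' ∈ ball (pt (h q') q') r})⁻¹ *
      ∫⁻ z' in {z' : BPt n | pt (h z') z' ∈ ball (pt (h q') q') r}, W (pt (h z') z')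

/-- Hardy–Littlewood maximal operator restricted to balls contained in `S`. -/
def maxRestr (S : Set (BPt n)) (g : BPt n → ℝ≥0∞) (x' : BPt n) : ℝ≥0∞ :=
  ⨆ (c : BPt n) (ρ : ℝ) (_ : 0 < ρ) (_ : x' ∈ ball c ρ) (_ : ball c ρ ⊆ S),
    (volume (ball c ρ))⁻¹ * ∫⁻ y in ball c ρ, g y

/-- Test functions. -/
def Tst (φ : Pt n → ℂ) : Prop :=
  ContDiff ℝ (⊤ : ℕ∞) φ ∧ HasCompactSupport φ ∧ tsupport φ ⊆ upperHalf n

/-- squared `L²` norm -/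
def nsq (f : Pt n → ℂ) : ℝ := ∫ x, ‖f x‖ ^ 2

/-- The unit vector in direction `k`. -/
abbrev ee (k : Fin (n + 1)) : Pt n := EuclideanSpace.single k (1 : ℝ)

lemma nsq_nonneg (f : Pt n → ℂ) : 0 ≤ nsq f := integral_nonneg fun _ => by positivity

lemma isOpen_upperHalf : IsOpen (upperHalf n) := by
  have : Continuous (fun x : Pt n => x 0) := by fun_prop
  exact isOpen_lt continuous_const this

lemma contDiff_dd : ContDiff ℝ (⊤ : ℕ∞) (dd : Pt n → ℝ) := by
  unfold dd; fun_prop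

lemma Tst.contDiff {φ : Pt n → ℂ} (h : Tst φ) : ContDiff ℝ (⊤ : ℕ∞) φ := h.1
lemma Tst.cont {φ : Pt n → ℂ} (h : Tst φ) : Continuous φ := h.1.continuous
lemma Tst.cpt {φ : Pt n → ℂ} (h : Tst φ) : HasCompactSupport φ := h.2.1
lemma Tst.supp {φ : Pt n → ℂ} (h : Tst φ) : tsupport φ ⊆ upperHalf n := h.2.2
lemma Tst.diff {φ : Pt n → ℂ} (h : Tst φ) : Differentiable ℝ φ :=
  h.1.differentiable (by simp)

lemma Tst.zero_of_notMem {φ : Pt n → ℂ} (h : Tst φ) {x : Pt n} (hx : x ∉ upperHalf n) :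
    φ x = 0 := image_eq_zero_of_notMem_tsupport fun h' => hx (h.supp h')

lemma Tst.memLp {φ : Pt n → ℂ} (h : Tst φ) (p : ℝ≥0∞) : MemLp φ p volume :=
  h.cont.memLp_of_hasCompactSupport h.cpt

lemma contDiff_pd {φ : Pt n → ℂ} (h : ContDiff ℝ (⊤ : ℕ∞) φ) (k : Fin (n + 1)) :
    ContDiff ℝ (⊤ : ℕ∞) (pd φ k) := by
  unfold pd pdG
  exact (h.fderiv_right (by exact_mod_cast le_top)).clm_apply contDiff_const

lemma tsupport_pd_subset (φ : Pt n → ℂ) (k : Fin (n + 1)) :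
    tsupport (pd φ k) ⊆ tsupport φ := by
  refine (closure_mono ?_).trans (tsupport_fderiv_subset ℝ (f := φ))
  intro x hx
  simp only [Function.mem_support, pd, pdG] at hx ⊢
  intro h; simp [h] at hx

lemma Tst.pd {φ : Pt n → ℂ} (h : Tst φ) (k : Fin (n + 1)) : Tst (pd φ k) :=
  ⟨contDiff_pd h.1 k, h.cpt.of_isClosed_subset (isClosed_tsupport _) (tsupport_pd_subset φ k),
    (tsupport_pd_subset φ k).trans h.supp⟩

lemma Tst.of_tsupport_subset {φ ψ : Pt n → ℂ} (h : Tst φ) (hs : tsupport ψ ⊆ tsupport φ)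
    (hc : ∀ x ∈ tsupport φ, ContDiffAt ℝ (⊤ : ℕ∞) ψ x) : Tst ψ :=
  ⟨contDiff_iff_contDiffAt.2 fun x => by
    by_cases hx : x ∈ tsupport ψ
    · exact hc x (hs hx)
    · exact contDiffAt_const.congr_of_eventuallyEq (notMem_tsupport_iff_eventuallyEq.1 hx),
    h.cpt.of_isClosed_subset (isClosed_tsupport _) hs, hs.trans h.supp⟩

lemma tsupport_mul_right_sub (a φ : Pt n → ℂ) : tsupport (fun x => a x * φ x) ⊆ tsupport φ :=
  closure_mono fun x hx => by
    simp only [Function.mem_support] at hx ⊢; exact right_ne_zero_of_mul hx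

lemma Tst.mul {φ a : Pt n → ℂ} (h : Tst φ) (ha : ContDiffOn ℝ (⊤ : ℕ∞) a (upperHalf n)) :
    Tst (fun x => a x * φ x) :=
  h.of_tsupport_subset (tsupport_mul_right_sub a φ) fun x hx =>
    ((ha x (h.supp hx)).contDiffAt (isOpen_upperHalf.mem_nhds (h.supp hx))).mul h.1.contDiffAt

lemma contDiff_conj {φ : Pt n → ℂ} (h : ContDiff ℝ (⊤ : ℕ∞) φ) :
    ContDiff ℝ (⊤ : ℕ∞) (fun x => (starRingEnd ℂ) (φ x)) :=
  Complex.conjCLE.contDiff.comp h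

lemma Tst.conj {φ : Pt n → ℂ} (h : Tst φ) : Tst (fun x => (starRingEnd ℂ) (φ x)) := by
  refine h.of_tsupport_subset (closure_mono fun x hx => ?_) fun x _ => (contDiff_conj h.1).contDiffAt
  simpa [Function.mem_support] using hx

lemma Tst.sub {φ ψ : Pt n → ℂ} (h : Tst φ) (h' : Tst ψ) : Tst (fun x => φ x - ψ x) := by
  refine ⟨h.1.sub h'.1, h.cpt.sub h'.cpt, ?_⟩
  exact (tsupport_sub φ ψ).trans (union_subset h.supp h'.supp)

lemma pd_mul {f g : Pt n → ℂ} {x : Pt n} (hf : DifferentiableAt ℝ f x)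
    (hg : DifferentiableAt ℝ g x) (k : Fin (n + 1)) :
    pd (fun y => f y * g y) k x = pd f k x * g x + f x * pd g k x := by
  simp only [pd, pdG]
  rw [fderiv_fun_mul hf hg]
  simp; ring

lemma pd_sub {f g : Pt n → ℂ} {x : Pt n} (hf : DifferentiableAt ℝ f x)
    (hg : DifferentiableAt ℝ g x) (k : Fin (n + 1)) :
    pd (fun y => f y - g y) k x = pd f k x - pd g k x := by
  simp only [pd, pdG]
  rw [fderiv_fun_sub hf hg]
  simp

lemma pd_conj {f : Pt n → ℂ} {x : Pt n} (hf : DifferentiableAt ℝ f x) (k : Fin (n + 1)) :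
    pd (fun y => (starRingEnd ℂ) (f y)) k x = (starRingEnd ℂ) (pd f k x) := by
  simp only [pd, pdG]
  have h : HasFDerivAt (fun y => (starRingEnd ℂ) (f y))
      ((Complex.conjCLE : ℂ →L[ℝ] ℂ).comp (fderiv ℝ f x)) x :=
    (Complex.conjCLE : ℂ →L[ℝ] ℂ).hasFDerivAt.comp x hf.hasFDerivAt
  rw [h.fderiv]; simp

/-- Product rule for a test function times a function smooth on the half space only. -/
lemma Tst.pd_mul {φ a : Pt n → ℂ} (h : Tst φ) (ha : ContDiffOn ℝ (⊤ : ℕ∞) a (upperHalf n))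
    (k : Fin (n + 1)) (x : Pt n) :
    DP.pd (fun y => a y * φ y) k x = DP.pd a k x * φ x + a x * DP.pd φ k x := by
  by_cases hx : x ∈ upperHalf n
  · exact DP.pd_mul (((ha x hx).contDiffAt (isOpen_upperHalf.mem_nhds hx)).differentiableAt (by simp))
      (h.diff x) k
  · rw [h.zero_of_notMem hx, (h.pd k).zero_of_notMem hx, (h.mul ha).pd k |>.zero_of_notMem hx]
    simp

lemma int_fderiv_zero {f : Pt n → ℝ} (hf : ContDiff ℝ 1 f) (hc : HasCompactSupport f) (v : Pt n) :
    ∫ x, fderiv ℝ f x v = 0 := by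
  have h1 : Continuous (fun x => fderiv ℝ f x v) :=
    (hf.continuous_fderiv (by simp)).clm_apply continuous_const
  have h2 : HasCompactSupport (fun x => fderiv ℝ f x v) := hc.fderiv_apply ℝ v
  have := integral_mul_fderiv_eq_neg_fderiv_mul_of_integrable (μ := (volume : Measure (Pt n)))
    (f := f) (g := fun _ => (1 : ℝ)) (v := v)
    (by simpa using h1.integrable_of_hasCompactSupport h2) (by simp)
    (by simpa using hf.continuous.integrable_of_hasCompactSupport hc)
    (fun x _ => hf.differentiable (by simp) x) (fun x _ => by fun_prop)
  simp at this; linarith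

lemma int_pd_zero {f : Pt n → ℂ} (hf : ContDiff ℝ 1 f) (hc : HasCompactSupport f)
    (k : Fin (n + 1)) : ∫ x, pd f k x = 0 := by
  have h1 : Continuous (fun x => fderiv ℝ f x (ee k)) :=
    (hf.continuous_fderiv (by simp)).clm_apply continuous_const
  have h2 : HasCompactSupport (fun x => fderiv ℝ f x (ee k)) := hc.fderiv_apply ℝ _
  have := integral_mul_fderiv_eq_neg_fderiv_mul_of_integrable (μ := (volume : Measure (Pt n)))
    (f := f) (g := fun _ => (1 : ℂ)) (v := ee k)
    (by simpa using h1.integrable_of_hasCompactSupport h2) (by simp)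
    (by simpa using hf.continuous.integrable_of_hasCompactSupport hc)
    (fun x _ => hf.differentiable (by simp) x) (fun x _ => by fun_prop)
  simp at this
  simpa [pd, pdG] using this

lemma cs {α : Type*} [MeasurableSpace α] {μ : Measure α} {f g : α → ℂ}
    (hf : MemLp f 2 μ) (hg : MemLp g 2 μ) :
    ∫ x, ‖f x‖ * ‖g x‖ ∂μ ≤ √(∫ x, ‖f x‖ ^ 2 ∂μ) * √(∫ x, ‖g x‖ ^ 2 ∂μ) := by
  have h := integral_mul_norm_le_Lp_mul_Lq (μ := μ) (f := f) (g := g) (p := 2) (q := 2)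
    (by constructor <;> norm_num) (by simpa using hf) (by simpa using hg)
  simpa [Real.sqrt_eq_rpow] using h

lemma cs' {α : Type*} [MeasurableSpace α] {μ : Measure α} {f g : α → ℂ}
    (hf : MemLp f 2 μ) (hg : MemLp g 2 μ) :
    ‖∫ x, f x * g x ∂μ‖ ≤ √(∫ x, ‖f x‖ ^ 2 ∂μ) * √(∫ x, ‖g x‖ ^ 2 ∂μ) := by
  refine (norm_integral_le_integral_norm _).trans ?_
  simpa using cs hf hg

lemma Tst.int_sq {φ : Pt n → ℂ} (h : Tst φ) : Integrable (fun x => ‖φ x‖ ^ 2) :=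
  (h.memLp 2).integrable_norm_pow (by norm_num)

/-- weighted Hardy inequality -/
lemma hardy {G : Pt n → ℂ} (hG : Tst G) {W : Pt n → ℝ} (hW : ContDiff ℝ (⊤ : ℕ∞) W)
    (hW0 : ∀ x, 0 ≤ W x) (hW1 : ∀ x, fderiv ℝ W x (ee 0) = 0) :
    ∫ x, W x * ‖((dd x : ℂ))⁻¹ * G x‖ ^ 2 ≤ 4 * ∫ x, W x * ‖pd G 0 x‖ ^ 2 := by
  have hinv : ContDiffOn ℝ (⊤ : ℕ∞) (fun x : Pt n => ((dd x : ℂ))⁻¹) (upperHalf n) := by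
    refine ContDiffOn.inv ?_ ?_
    · exact (Complex.ofRealCLM.contDiff.comp contDiff_dd).contDiffOn
    · intro x hx; exact_mod_cast (ne_of_gt hx)
  have hH : Tst (fun x => ((dd x : ℂ))⁻¹ * G x) := hG.mul hinv
  set H : Pt n → ℂ := fun x => ((dd x : ℂ))⁻¹ * G x with hHd
  set F : Pt n → ℝ := fun x => W x * inner ℝ (G x) (H x) with hF
  have hFc : ContDiff ℝ 1 F := by
    have : ContDiff ℝ (⊤ : ℕ∞) F := hW.mul (hG.1.inner ℝ hH.1)
    exact this.of_le (by simp)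
  have hFs : HasCompactSupport F := by
    refine hG.cpt.mono fun x hx => ?_
    simp only [Function.mem_support, hF] at hx ⊢
    intro h; simp [h] at hx
  have h0 := int_fderiv_zero hFc hFs (ee 0)
  have hpdinv : ∀ x ∈ upperHalf n, pd (fun x : Pt n => ((dd x : ℂ))⁻¹) 0 x
      = -((dd x : ℂ) ^ 2)⁻¹ := by
    intro x hx
    have hx' : (dd x) ≠ 0 := ne_of_gt hx
    have h1 : HasFDerivAt (dd : Pt n → ℝ) (EuclideanSpace.proj (0 : Fin (n+1)) : Pt n →L[ℝ] ℝ) x :=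
      (EuclideanSpace.proj (0 : Fin (n+1)) : Pt n →L[ℝ] ℝ).hasFDerivAt
    have h2 : HasFDerivAt (fun x : Pt n => ((dd x)⁻¹ : ℝ))
      (-((dd x) ^ 2)⁻¹ • (EuclideanSpace.proj (0 : Fin (n+1)) : Pt n →L[ℝ] ℝ)) x := by
      have := (hasDerivAt_inv hx').comp_hasFDerivAt x h1
      exact this
    have h3 := Complex.ofRealCLM.hasFDerivAt.comp x h2
    have h4 : (fun x : Pt n => ((dd x : ℂ))⁻¹) = Complex.ofRealCLM ∘ (fun x : Pt n => ((dd x)⁻¹ : ℝ)) := by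
      ext y; simp
    simp only [pd, pdG, h4]
    rw [h3.fderiv]
    simp
  have hpt : ∀ x, W x * ‖H x‖ ^ 2 ≤ -2 * fderiv ℝ F x (ee 0) + 4 * (W x * ‖pd G 0 x‖ ^ 2) := by
    intro x
    have hd : fderiv ℝ F x (ee 0) = W x * (inner ℝ (G x) (pd H 0 x) + inner ℝ (pd G 0 x) (H x)) := by
      have hi : DifferentiableAt ℝ (fun y => (inner ℝ (G y) (H y) : ℝ)) x :=
        (hG.diff x).inner ℝ (hH.diff x)
      have hw : DifferentiableAt ℝ W x := hW.differentiable (by simp) x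
      simp only [hF]
      rw [fderiv_fun_mul hw hi]
      simp only [add_apply, smul_apply, hW1,
        smul_eq_mul, mul_zero, add_zero]
      rw [fderiv_inner_apply ℝ (hG.diff x) (hH.diff x)]
      rfl
    by_cases hx : x ∈ upperHalf n
    · have hx' : 0 < dd x := hx
      have e1 : pd H 0 x = -((dd x : ℂ) ^ 2)⁻¹ * G x + ((dd x : ℂ))⁻¹ * pd G 0 x := by
        rw [hHd, hG.pd_mul hinv, hpdinv x hx]
      have e2 : G x = (dd x) • H x := by
        simp only [hHd, Complex.real_smul]
        rw [mul_inv_cancel_left₀]; exact_mod_cast hx'.ne'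
      have e3 : pd H 0 x = (dd x)⁻¹ • (pd G 0 x - H x) := by
        rw [e1]; simp only [hHd, Complex.real_smul, Complex.ofReal_inv]; ring
      have hcs := real_inner_le_norm (-(pd G 0 x)) (H x)
      have hd' : fderiv ℝ F x (ee 0) = W x * (2 * inner ℝ (pd G 0 x) (H x) - ‖H x‖ ^ 2) := by
        rw [hd, e3]
        nth_rewrite 1 [e2]
        rw [inner_smul_left, inner_smul_right, inner_sub_right, real_inner_self_eq_norm_sq,
          real_inner_comm]
        simp only [conj_trivial]
        field_simp; ring
      rw [hd']
      simp only [inner_neg_left, norm_neg] at hcs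
      have hcs2 := real_inner_le_norm (pd G 0 x) (H x)
      have : 0 ≤ -2 * (2 * inner ℝ (pd G 0 x) (H x) - ‖H x‖ ^ 2) + 4 * ‖pd G 0 x‖ ^ 2 - ‖H x‖ ^ 2 := by
        nlinarith [sq_nonneg (‖H x‖ - 2 * ‖pd G 0 x‖)]
      nlinarith [mul_nonneg (hW0 x) this]
    · rw [hd, hH.zero_of_notMem hx, hG.zero_of_notMem hx]
      simp
      exact mul_nonneg (hW0 x) (by positivity)
  have hcW : Continuous W := hW.continuous
  have i1 : Integrable (fun x => W x * ‖H x‖ ^ 2) :=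
    (hcW.mul (hH.cont.norm.pow 2)).integrable_of_hasCompactSupport
      (hH.cpt.mono fun x hx => by
        simp only [Function.mem_support] at hx ⊢; intro h; simp [h] at hx)
  have i2 : Integrable (fun x => fderiv ℝ F x (ee 0)) :=
    ((hFc.continuous_fderiv (by simp)).clm_apply continuous_const).integrable_of_hasCompactSupport
      (hFs.fderiv_apply ℝ _)
  have i3 : Integrable (fun x => W x * ‖pd G 0 x‖ ^ 2) :=
    (hcW.mul ((hG.pd 0).cont.norm.pow 2)).integrable_of_hasCompactSupport
      ((hG.pd 0).cpt.mono fun x hx => by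
        simp only [Function.mem_support] at hx ⊢; intro h; simp [h] at hx)
  calc _ ≤ ∫ x, (-2 * fderiv ℝ F x (ee 0) + 4 * (W x * ‖pd G 0 x‖ ^ 2)) :=
        integral_mono i1 ((i2.const_mul _).add (i3.const_mul _)) hpt
    _ = _ := by
        rw [integral_add (i2.const_mul _) (i3.const_mul _), integral_const_mul, integral_const_mul,
          h0]; ring

/-- The bilinear form. -/
def BF (A : Pt n → Fin (n + 1) → Fin (n + 1) → ℂ) (v ψ : Pt n → ℂ) : ℂ :=
  ∫ x in upperHalf n, ∑ i, ∑ j, A x i j * pd v j x * pd ψ i x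

/-- squared `L²` norm of the gradient -/
def gsq (v : Pt n → ℂ) : ℝ := ∑ i, nsq (pd v i)

lemma gsq_nonneg (v : Pt n → ℂ) : 0 ≤ gsq v := Finset.sum_nonneg fun _ _ => nsq_nonneg _

/-- pointwise coefficient hypotheses -/
structure Coef (lam Lam : ℝ) (A : Pt n → Fin (n + 1) → Fin (n + 1) → ℂ) : Prop where
  smooth : ContDiffOn ℝ (⊤ : ℕ∞) A (upperHalf n)
  ell : ∀ x ∈ upperHalf n, ∀ ξ : Fin (n + 1) → ℂ,
    lam * ∑ i, ‖ξ i‖ ^ 2 ≤ (∑ i, (∑ j, A x i j * ξ j) * (starRingEnd ℂ) (ξ i)).re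
  bdd : ∀ x ∈ upperHalf n, ∀ ξ η : Fin (n + 1) → ℂ,
    ‖∑ i, (∑ j, A x i j * ξ j) * η i‖ ≤ Lam * √(∑ i, ‖ξ i‖ ^ 2) * √(∑ i, ‖η i‖ ^ 2)

lemma Coef.entry {lam Lam : ℝ} {A : Pt n → Fin (n + 1) → Fin (n + 1) → ℂ} (h : Coef lam Lam A)
    (i j : Fin (n + 1)) : ContDiffOn ℝ (⊤ : ℕ∞) (fun x => A x i j) (upperHalf n) := by
  have h1 := contDiffOn_pi.1 h.smooth i
  exact contDiffOn_pi.1 h1 j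

lemma Coef.norm_entry {lam Lam : ℝ} {A : Pt n → Fin (n + 1) → Fin (n + 1) → ℂ}
    (h : Coef lam Lam A) {x : Pt n} (hx : x ∈ upperHalf n) (i j : Fin (n + 1)) :
    ‖A x i j‖ ≤ Lam := by
  have := h.bdd x hx (Pi.single j 1) (Pi.single i 1)
  have e : ∀ k : Fin (n + 1), ∑ i, ‖(Pi.single k 1 : Fin (n + 1) → ℂ) i‖ ^ 2 = 1 := by
    intro k
    rw [Finset.sum_eq_single k] <;> simp +contextual
  rw [e, e] at this
  simpa [Pi.single_apply] using this

/-- The cut-off test function `η² V̄`. -/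
def cutc (η : Pt n → ℝ) (V : Pt n → ℂ) : Pt n → ℂ :=
  fun x => (((η x) ^ 2 : ℝ) : ℂ) * (starRingEnd ℂ) (V x)

lemma contDiff_ofReal {f : Pt n → ℝ} (hf : ContDiff ℝ (⊤ : ℕ∞) f) :
    ContDiff ℝ (⊤ : ℕ∞) (fun x => (f x : ℂ)) := Complex.ofRealCLM.contDiff.comp hf

lemma pd_ofReal {f : Pt n → ℝ} (hf : ContDiff ℝ (⊤ : ℕ∞) f) (k : Fin (n + 1)) (x : Pt n) :
    pd (fun x => (f x : ℂ)) k x = ((fderiv ℝ f x (ee k) : ℝ) : ℂ) := by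
  have h := Complex.ofRealCLM.hasFDerivAt.comp x (hf.differentiable (by simp) x).hasFDerivAt
  have h4 : (fun x : Pt n => (f x : ℂ)) = Complex.ofRealCLM ∘ f := by ext y; simp
  simp only [pd, pdG, h4]
  rw [h.fderiv]; simp

lemma Tst.cutc {η : Pt n → ℝ} (hη : ContDiff ℝ (⊤ : ℕ∞) η) {V : Pt n → ℂ} (hV : Tst V) :
    Tst (cutc η V) := hV.conj.mul (contDiff_ofReal (hη.pow 2)).contDiffOn

lemma pd_cutc {η : Pt n → ℝ} (hη : ContDiff ℝ (⊤ : ℕ∞) η) {V : Pt n → ℂ} (hV : Tst V)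
    (k : Fin (n + 1)) (x : Pt n) :
    pd (cutc η V) k x = ((2 * η x * fderiv ℝ η x (ee k) : ℝ) : ℂ) * (starRingEnd ℂ) (V x)
      + (((η x) ^ 2 : ℝ) : ℂ) * (starRingEnd ℂ) (pd V k x) := by
  unfold cutc
  rw [pd_mul ((contDiff_ofReal (hη.pow 2)).differentiable (by simp) x)
    ((contDiff_conj hV.1).differentiable (by simp) x), pd_conj (hV.diff x), pd_ofReal (hη.pow 2)]
  congr 3
  rw [fderiv_fun_pow 2 (hη.differentiable (by simp) x)]
  simp

lemma BF_integrand_integrable {lam Lam : ℝ} {A : Pt n → Fin (n + 1) → Fin (n + 1) → ℂ}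
    (hA : Coef lam Lam A) {v ψ : Pt n → ℂ} (hv : Tst v) (hψ : Tst ψ) :
    Integrable (fun x => ∑ i, ∑ j, A x i j * pd v j x * pd ψ i x) := by
  refine integrable_finsetSum _ fun i _ => integrable_finsetSum _ fun j _ => ?_
  have h : Tst (fun x => A x i j * pd v j x) := (hv.pd j).mul (hA.entry i j)
  exact (h.cont.mul (hψ.pd i).cont).integrable_of_hasCompactSupport
    (h.cpt.mul_right)

lemma BF_eq {A : Pt n → Fin (n + 1) → Fin (n + 1) → ℂ} {v ψ : Pt n → ℂ} (hv : Tst v) :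
    BF A v ψ = ∫ x, ∑ i, ∑ j, A x i j * pd v j x * pd ψ i x := by
  unfold BF
  refine setIntegral_eq_integral_of_forall_compl_eq_zero fun x hx => ?_
  simp [(hv.pd _).zero_of_notMem hx]

lemma sqrt_le_of_young {a b c X Y l L : ℝ} (hl : 0 < l) (ha : a = √X) (hb : b = √Y)
    (hX : 0 ≤ X) (hY : 0 ≤ Y) (hc : c ≤ L * a * b) :
    2 * c ≤ l * X + L ^ 2 / l * Y := by
  have h1 : a ^ 2 = X := by rw [ha, Real.sq_sqrt hX]
  have h2 : b ^ 2 = Y := by rw [hb, Real.sq_sqrt hY]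
  rw [← h1, ← h2]
  have : 0 ≤ (l * a - L * b) ^ 2 / l := by positivity
  have e : (l * a - L * b) ^ 2 / l = l * a ^ 2 - 2 * (L * a * b) + L ^ 2 / l * b ^ 2 := by
    field_simp; ring
  linarith

/-- Caccioppoli inequality. -/
lemma cacc {lam Lam : ℝ} (hlam : 0 < lam) {A : Pt n → Fin (n + 1) → Fin (n + 1) → ℂ}
    (hA : Coef lam Lam A) {V : Pt n → ℂ} (hV : Tst V) {η : Pt n → ℝ}
    (hη : ContDiff ℝ (⊤ : ℕ∞) η) (h0 : ∀ x, 0 ≤ η x) (h1 : ∀ x, η x ≤ 1) {M : ℝ}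
    (hM : ‖BF A V (cutc η V)‖ ≤ M * √(gsq (cutc η V))) :
    ∫ x, (η x) ^ 2 * ∑ i, ‖pd V i x‖ ^ 2 ≤
      2 / lam * (4 / lam + 2 * lam + (2 * Lam) ^ 2 / lam) *
        (M ^ 2 + ∫ x, (∑ i, (fderiv ℝ η x (ee i)) ^ 2) * ‖V x‖ ^ 2) := by
  set X : ℝ := ∫ x, (η x) ^ 2 * ∑ i, ‖pd V i x‖ ^ 2 with hX
  set Y : ℝ := ∫ x, (∑ i, (fderiv ℝ η x (ee i)) ^ 2) * ‖V x‖ ^ 2 with hY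
  have hT := hV.cutc hη
  have cη : Continuous η := hη.continuous
  have cdη : ∀ i, Continuous (fun x => fderiv ℝ η x (ee i)) := fun i =>
    (hη.continuous_fderiv (by simp)).clm_apply continuous_const
  have cV : ∀ i, Continuous (pd V i) := fun i => (hV.pd i).cont
  have cV0 := hV.cont
  have iX : Integrable (fun x => (η x) ^ 2 * ∑ i, ‖pd V i x‖ ^ 2) := by
    refine Continuous.integrable_of_hasCompactSupport (by fun_prop) (hV.cpt.mono' ?_)
    intro x hx
    by_contra hx'
    apply hx
    have : ∀ i, pd V i x = 0 := fun i =>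
      image_eq_zero_of_notMem_tsupport fun h => hx' (tsupport_pd_subset V i h)
    simp [this]
  have iY : Integrable (fun x => (∑ i, (fderiv ℝ η x (ee i)) ^ 2) * ‖V x‖ ^ 2) := by
    refine Continuous.integrable_of_hasCompactSupport (by fun_prop) (hV.cpt.mono ?_)
    intro x hx
    simp only [Function.mem_support] at hx ⊢; intro h; simp [h] at hx
  have hX0 : 0 ≤ X := integral_nonneg fun x => by positivity
  have hY0 : 0 ≤ Y := integral_nonneg fun x => by positivity
  -- pointwise lower bound
  have hpt : ∀ x, lam * ((η x) ^ 2 * ∑ i, ‖pd V i x‖ ^ 2) ≤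
      2 * ((∑ i, ∑ j, A x i j * pd V j x * pd (cutc η V) i x).re)
        + (2 * Lam) ^ 2 / lam * ((∑ i, (fderiv ℝ η x (ee i)) ^ 2) * ‖V x‖ ^ 2) := by
    intro x
    by_cases hx : x ∈ upperHalf n
    · have e1 := hA.ell x hx (fun j => (η x : ℂ) * pd V j x)
      have e2 := hA.bdd x hx (fun j => (η x : ℂ) * pd V j x)
        (fun i => ((fderiv ℝ η x (ee i) : ℝ) : ℂ) * (starRingEnd ℂ) (V x))
      set P := ∑ i, (∑ j, A x i j * ((η x : ℂ) * pd V j x)) * (starRingEnd ℂ) ((η x : ℂ) * pd V i x) with hP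
      set R := ∑ i, (∑ j, A x i j * ((η x : ℂ) * pd V j x)) *
        (((fderiv ℝ η x (ee i) : ℝ) : ℂ) * (starRingEnd ℂ) (V x)) with hR
      have hs : ∑ i, ∑ j, A x i j * pd V j x * pd (cutc η V) i x = P + 2 * R := by
        rw [hP, hR, Finset.mul_sum, ← Finset.sum_add_distrib]
        refine Finset.sum_congr rfl fun i _ => ?_
        rw [← Finset.sum_mul, pd_cutc hη hV]
        simp only [map_mul, Complex.conj_ofReal]
        have : ∑ j, A x i j * ((η x : ℂ) * pd V j x) = η x * ∑ j, A x i j * pd V j x := by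
          rw [Finset.mul_sum]; exact Finset.sum_congr rfl fun j _ => by ring
        rw [this]; push_cast; ring
      have s1 : ∑ i, ‖(η x : ℂ) * pd V i x‖ ^ 2 = (η x) ^ 2 * ∑ i, ‖pd V i x‖ ^ 2 := by
        rw [Finset.mul_sum]; exact Finset.sum_congr rfl fun j _ => by
          rw [norm_mul, mul_pow]; simp
      have s2 : ∑ i, ‖((fderiv ℝ η x (ee i) : ℝ) : ℂ) * (starRingEnd ℂ) (V x)‖ ^ 2
          = (∑ i, (fderiv ℝ η x (ee i)) ^ 2) * ‖V x‖ ^ 2 := by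
        rw [Finset.sum_mul]; exact Finset.sum_congr rfl fun j _ => by
          rw [norm_mul, mul_pow]; simp
      rw [s1] at e1 e2
      rw [s2] at e2
      have y := sqrt_le_of_young (c := 2 * ‖R‖) (L := 2 * Lam) hlam rfl rfl
        (by positivity : 0 ≤ (η x) ^ 2 * ∑ i, ‖pd V i x‖ ^ 2)
        (by positivity : 0 ≤ (∑ i, (fderiv ℝ η x (ee i)) ^ 2) * ‖V x‖ ^ 2) (by linarith)
      have hre : -‖R‖ ≤ R.re := (abs_le.1 (Complex.abs_re_le_norm R)).1
      rw [hs]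
      have : (P + 2 * R).re = P.re + 2 * R.re := by simp
      rw [this]; linarith
    · have : ∀ i, pd V i x = 0 := fun i => (hV.pd i).zero_of_notMem hx
      simp [this, hV.zero_of_notMem hx]
  have iB := BF_integrand_integrable hA hV hT
  have hBre : ∫ x, (∑ i, ∑ j, A x i j * pd V j x * pd (cutc η V) i x).re = (BF A V (cutc η V)).re := by
    rw [BF_eq hV]; exact (integral_re iB)
  have hintg : lam * X ≤ 2 * (BF A V (cutc η V)).re + (2 * Lam) ^ 2 / lam * Y := by
    have iR : Integrable (fun x => (∑ i, ∑ j, A x i j * pd V j x * pd (cutc η V) i x).re) := iB.re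
    rw [← hBre, hX, hY, ← integral_const_mul, ← integral_const_mul, ← integral_const_mul,
      ← integral_add (iR.const_mul _) (iY.const_mul _)]
    exact integral_mono (iX.const_mul _) ((iR.const_mul _).add (iY.const_mul _)) hpt
  -- gradient of the test function
  have hG : gsq (cutc η V) ≤ 2 * X + 8 * Y := by
    have e : gsq (cutc η V) = ∫ x, ∑ i, ‖pd (cutc η V) i x‖ ^ 2 := by
      unfold gsq nsq
      rw [integral_finsetSum _ fun i _ => (hT.pd i).int_sq]
    rw [e, hX, hY, ← integral_const_mul, ← integral_const_mul, ← integral_add (iX.const_mul _) (iY.const_mul _)]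
    refine integral_mono (integrable_finsetSum _ fun i _ => (hT.pd i).int_sq)
      ((iX.const_mul _).add (iY.const_mul _)) fun x => ?_
    simp only
    rw [Finset.mul_sum, Finset.sum_mul, Finset.mul_sum, Finset.mul_sum, ← Finset.sum_add_distrib]
    refine Finset.sum_le_sum fun i _ => ?_
    rw [pd_cutc hη hV]
    set d := fderiv ℝ η x (ee i)
    have t1 : ‖((2 * η x * d : ℝ) : ℂ) * (starRingEnd ℂ) (V x)
      + (((η x) ^ 2 : ℝ) : ℂ) * (starRingEnd ℂ) (pd V i x)‖ ≤ 2 * |d| * ‖V x‖ + η x * ‖pd V i x‖ := by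
      refine (norm_add_le _ _).trans ?_
      rw [norm_mul, norm_mul, RCLike.norm_conj, RCLike.norm_conj, Complex.norm_real, Complex.norm_real]
      simp only [norm_mul, Real.norm_eq_abs, norm_pow]
      rw [abs_of_nonneg (h0 x)]
      have a1 := h0 x
      have a2 := h1 x
      gcongr
      · simp; nlinarith [abs_nonneg d]
      · nlinarith
    have t2 : (2 * |d| * ‖V x‖ + η x * ‖pd V i x‖) ^ 2 ≤ 2 * (η x ^ 2 * ‖pd V i x‖ ^ 2) + 8 * (d ^ 2 * ‖V x‖ ^ 2) := by
      have := sq_abs d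
      nlinarith [sq_nonneg (2 * |d| * ‖V x‖ - η x * ‖pd V i x‖)]
    exact (pow_le_pow_left₀ (norm_nonneg _) t1 2).trans t2
  have hB2 : 2 * (BF A V (cutc η V)).re ≤ lam / 2 * X + 2 * lam * Y + 4 * M ^ 2 / lam := by
    have a1 : (BF A V (cutc η V)).re ≤ M * √(gsq (cutc η V)) := (Complex.re_le_norm _).trans hM
    have a2 : (√(gsq (cutc η V))) ^ 2 ≤ 2 * X + 8 * Y := by
      rw [Real.sq_sqrt (gsq_nonneg _)]; exact hG
    set g := √(gsq (cutc η V))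
    have a3 : 2 * (M * g) ≤ lam / 4 * g ^ 2 + 4 * M ^ 2 / lam := by
      have : 0 ≤ (lam * g - 4 * M) ^ 2 / (4 * lam) := by positivity
      have e : (lam * g - 4 * M) ^ 2 / (4 * lam) = lam / 4 * g ^ 2 - 2 * (M * g) + 4 * M ^ 2 / lam := by
        field_simp; ring
      linarith
    nlinarith
  have fin : lam / 2 * X ≤ 4 * M ^ 2 / lam + (2 * lam + (2 * Lam) ^ 2 / lam) * Y := by linarith
  have f2 : lam / 2 * X ≤ (4 / lam + 2 * lam + (2 * Lam) ^ 2 / lam) * (M ^ 2 + Y) := by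
    have : (4 / lam + 2 * lam + (2 * Lam) ^ 2 / lam) * (M ^ 2 + Y) =
      4 * M ^ 2 / lam + (2 * lam + (2 * Lam) ^ 2 / lam) * Y +
        (4 / lam * Y + (2 * lam + (2 * Lam) ^ 2 / lam) * M ^ 2) := by ring
    rw [this]
    have : 0 ≤ 4 / lam * Y + (2 * lam + (2 * Lam) ^ 2 / lam) * M ^ 2 := by positivity
    linarith
  calc X = 2 / lam * (lam / 2 * X) := by field_simp
    _ ≤ 2 / lam * ((4 / lam + 2 * lam + (2 * Lam) ^ 2 / lam) * (M ^ 2 + Y)) := by gcongr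
    _ = _ := by ring

/-! ### Tangential smoothing -/

/-- The embedding of the boundary. -/
def iotaL (n : ℕ) : BPt n →ₗ[ℝ] Pt n where
  toFun y := pt 0 y
  map_add' x y := by
    ext i; refine Fin.cases ?_ (fun j => ?_) i <;> simp [pt]
  map_smul' c y := by
    ext i; refine Fin.cases ?_ (fun j => ?_) i <;> simp [pt]

lemma pt_zero (t : ℝ) (y : BPt n) : pt t y 0 = t := by simp [pt]
lemma pt_succ (t : ℝ) (y : BPt n) (j : Fin n) : pt t y j.succ = y j := by simp [pt]
lemma dd_pt (t : ℝ) (y : BPt n) : dd (pt t y) = t := by simp [pt, dd]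
lemma bdry_pt (t : ℝ) (y : BPt n) : bdry (pt t y) = y := by ext; simp [pt, bdry]

lemma norm_pt_sq (t : ℝ) (y : BPt n) : ‖pt t y‖ ^ 2 = t ^ 2 + ‖y‖ ^ 2 := by
  rw [EuclideanSpace.norm_sq_eq, EuclideanSpace.norm_sq_eq, Fin.sum_univ_succ]
  simp [pt_zero, pt_succ]

/-- The isometric embedding of the boundary. -/
def iota (n : ℕ) : BPt n →ₗᵢ[ℝ] Pt n where
  toLinearMap := iotaL n
  norm_map' y := by
    have := norm_pt_sq 0 y
    have h : ‖pt 0 y‖ ^ 2 = ‖y‖ ^ 2 := by simpa using this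
    exact (sq_eq_sq₀ (norm_nonneg _) (norm_nonneg _)).1 h

lemma iota_apply (y : BPt n) : iota n y = pt 0 y := rfl
lemma dd_iota (y : BPt n) : dd (iota n y) = 0 := dd_pt 0 y
lemma dd_add (x y : Pt n) : dd (x + y) = dd x + dd y := by simp [dd]
lemma dd_sub (x y : Pt n) : dd (x - y) = dd x - dd y := by simp [dd]
lemma iota_single (j : Fin n) : iota n (EuclideanSpace.single j 1) = ee j.succ := by
  rw [iota_apply]; ext i
  refine Fin.cases ?_ (fun k => ?_) i
  · simp [pt_zero, ee, Fin.succ_ne_zero]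
  · simp [pt_succ, ee]

lemma cont_iota : Continuous (iota n) := (iota n).continuous

/-- tangential smoothing -/
def S (k : Pt n → ℝ) (v : Pt n → ℂ) (x : Pt n) : ℂ :=
  ∫ y : BPt n, (k (iota n y) : ℂ) * v (x - iota n y)

/-- smooth kernels supported in `closedBall 0 s` -/
def Ker (s : ℝ) (k : Pt n → ℝ) : Prop :=
  ContDiff ℝ (⊤ : ℕ∞) k ∧ tsupport k ⊆ closedBall 0 s

lemma Ker.cpt {s : ℝ} {k : Pt n → ℝ} (h : Ker s k) : HasCompactSupport k :=
  HasCompactSupport.of_support_subset_isCompact (isCompact_closedBall 0 s)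
    ((subset_tsupport k).trans h.2)

lemma Ker.zero {s : ℝ} {k : Pt n → ℝ} (h : Ker s k) {y : Pt n} (hy : s < ‖y‖) : k y = 0 :=
  image_eq_zero_of_notMem_tsupport fun hh => by
    have := h.2 hh; simp at this; linarith

lemma Ker.dt {s : ℝ} {k : Pt n → ℝ} (h : Ker s k) (w : Pt n) :
    Ker s (fun x => fderiv ℝ k x w) :=
  ⟨(h.1.fderiv_right (m := (⊤ : ℕ∞)) (by simp)).clm_apply contDiff_const,
    (closure_minimal (fun x hx => by
      by_contra hc
      have : fderiv ℝ k x = 0 := by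
        have := (tsupport_fderiv_subset ℝ (f := k))
        exact image_eq_zero_of_notMem_tsupport fun hh => hc (this hh)
      simp [this] at hx) (isClosed_tsupport k)).trans h.2⟩

lemma Ker.neg {s : ℝ} {k : Pt n → ℝ} (h : Ker s k) : Ker s (fun x => k (-x)) :=
  ⟨h.1.comp contDiff_neg, closure_minimal (fun x hx => by
      by_contra hc
      simp at hc
      exact hx (h.zero (by simpa using hc))) isClosed_closedBall⟩

lemma Ker.iota_cpt {s : ℝ} {k : Pt n → ℝ} (h : Ker s k) :
    HasCompactSupport (fun y => k (iota n y)) :=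
  HasCompactSupport.of_support_subset_isCompact (isCompact_closedBall 0 s) (fun y hy => by
    by_contra hc
    simp at hc
    exact hy (h.zero (by simpa using hc)))

lemma Ker.int {s : ℝ} {k : Pt n → ℝ} (h : Ker s k) : Integrable (fun y => k (iota n y)) :=
  (h.1.continuous.comp cont_iota).integrable_of_hasCompactSupport h.iota_cpt

lemma S_int {s : ℝ} {k : Pt n → ℝ} (h : Ker s k) {v : Pt n → ℂ} (hv : Continuous v) (x : Pt n) :
    Integrable (fun y : BPt n => (k (iota n y) : ℂ) * v (x - iota n y)) := by
  have c := cont_iota (n := n)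
  have ck := h.1.continuous
  refine Continuous.integrable_of_hasCompactSupport (by fun_prop) ?_
  refine HasCompactSupport.mul_right (f := fun y => (k (iota n y) : ℂ)) ?_
  exact h.iota_cpt.comp_left (g := fun r : ℝ => (r : ℂ)) (by simp)

/-- the measure on the boundary plane -/
def tm (n : ℕ) : Measure (Pt n) := Measure.map (iota n) volume

instance : IsFiniteMeasureOnCompacts (tm n) := ⟨fun K hK => by
  rw [tm, Measure.map_apply cont_iota.measurable hK.measurableSet]
  exact (IsCompact.measure_lt_top
    ((iota n).isometry.isClosedEmbedding.isCompact_preimage hK))⟩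

lemma S_eq_conv {s : ℝ} {k : Pt n → ℝ} (h : Ker s k) {v : Pt n → ℂ} (hv : Continuous v) (x : Pt n) :
    S k v x = convolution (fun y => (k y : ℂ)) v (ContinuousLinearMap.mul ℝ ℂ) (tm n) x := by
  unfold convolution S tm
  have ck := h.1.continuous
  rw [integral_map cont_iota.measurable.aemeasurable
    (Continuous.aestronglyMeasurable (by simp only [ContinuousLinearMap.mul_apply']; fun_prop))]
  simp

lemma S_contDiff {s : ℝ} {k : Pt n → ℝ} (h : Ker s k) {v : Pt n → ℂ} (hv : Tst v) :
    ContDiff ℝ (⊤ : ℕ∞) (S k v) := by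
  have e : S k v = convolution (fun y => (k y : ℂ)) v (ContinuousLinearMap.mul ℝ ℂ) (tm n) :=
    funext fun x => S_eq_conv h hv.cont x
  rw [e]
  have ck := h.1.continuous
  have : IsLocallyFiniteMeasure (tm n) := isLocallyFiniteMeasure_of_isFiniteMeasureOnCompacts
  refine HasCompactSupport.contDiff_convolution_right _ hv.cpt ?_ hv.1
  exact Continuous.locallyIntegrable (by fun_prop)

lemma S_supp {s : ℝ} {k : Pt n → ℝ} (h : Ker s k) {v : Pt n → ℂ} (hv : Tst v) :
    IsCompact ((fun p : Pt n × BPt n => p.1 + iota n p.2) '' (tsupport v ×ˢ closedBall 0 s)) ∧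
    tsupport (S k v) ⊆ (fun p : Pt n × BPt n => p.1 + iota n p.2) '' (tsupport v ×ˢ closedBall 0 s) := by
  have hc : IsCompact ((fun p : Pt n × BPt n => p.1 + iota n p.2) '' (tsupport v ×ˢ closedBall 0 s)) := by
    have c := cont_iota (n := n)
    exact (hv.cpt.isCompact.prod (isCompact_closedBall 0 s)).image (by fun_prop)
  refine ⟨hc, closure_minimal (fun x hx => ?_) hc.isClosed⟩
  by_contra hne
  apply hx
  unfold S
  rw [integral_eq_zero_of_ae]
  refine Filter.Eventually.of_forall fun y => ?_
  by_cases hy : s < ‖y‖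
  · simp [h.zero (y := iota n y) (by simpa using hy)]
  · have : v (x - iota n y) = 0 := by
      refine image_eq_zero_of_notMem_tsupport fun hh => hne ⟨(x - iota n y, y), ⟨hh, ?_⟩, by simp⟩
      simpa using hy
    simp [this]

lemma S_tst {s : ℝ} {k : Pt n → ℝ} (h : Ker s k) {v : Pt n → ℂ} (hv : Tst v) : Tst (S k v) := by
  have := S_supp h hv
  refine ⟨S_contDiff h hv, HasCompactSupport.of_support_subset_isCompact this.1
    ((subset_tsupport _).trans this.2), this.2.trans ?_⟩
  rintro _ ⟨⟨x, y⟩, ⟨hx, -⟩, rfl⟩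
  have := hv.supp hx
  simpa [upperHalf, dd_add, dd_iota] using this

lemma S_supp_ball {s r : ℝ} {k : Pt n → ℝ} (h : Ker s k) {v : Pt n → ℂ} (hv : Tst v)
    (hr : tsupport v ⊆ ball 0 r) : tsupport (S k v) ⊆ ball 0 (r + s) := by
  refine (S_supp h hv).2.trans ?_
  rintro _ ⟨⟨x, y⟩, ⟨hx, hy⟩, rfl⟩
  have := hr hx
  simp only [mem_ball_zero_iff, mem_closedBall_zero_iff] at this hy ⊢
  have h3 := norm_add_le x (iota n y)
  have h4 : ‖iota n y‖ = ‖y‖ := (iota n).norm_map y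
  linarith

lemma S_pd {s : ℝ} {k : Pt n → ℝ} (h : Ker s k) {v : Pt n → ℂ} (hv : Tst v) (i : Fin (n + 1)) :
    pd (S k v) i = S k (pd v i) := by
  funext x
  obtain ⟨C, hC⟩ : ∃ C, ∀ x, ‖fderiv ℝ v x‖ ≤ C :=
    (hv.cpt.fderiv ℝ).exists_bound_of_continuous (hv.1.continuous_fderiv (by simp))
  have c := cont_iota (n := n)
  have ck := h.1.continuous
  have cv := hv.cont
  have cdv : Continuous (fderiv ℝ v) := hv.1.continuous_fderiv (by simp)
  have key := hasFDerivAt_integral_of_dominated_of_fderiv_le (μ := (volume : Measure (BPt n)))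
    (F := fun x y => (k (iota n y) : ℂ) * v (x - iota n y))
    (F' := fun x y => (k (iota n y)  : ℂ) • fderiv ℝ v (x - iota n y)) (x₀ := x) (s := univ)
    (bound := fun y => ‖k (iota n y)‖ * C) Filter.univ_mem
    (Filter.Eventually.of_forall fun x => Continuous.aestronglyMeasurable (by fun_prop))
    (S_int h cv x) (Continuous.aestronglyMeasurable (by fun_prop))
    (Filter.Eventually.of_forall fun y x _ => by
      rw [norm_smul, Complex.norm_real]; gcongr; exact hC _)
    (h.int.norm.mul_const C)
    (Filter.Eventually.of_forall fun y x _ => by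
      have := (hv.diff (x - iota n y)).hasFDerivAt.comp x ((hasFDerivAt_id x).sub_const (iota n y))
      exact (this.const_mul _))
  simp only [pd, pdG]
  rw [show fderiv ℝ (S k v) x = _ from key.fderiv]
  rw [ContinuousLinearMap.integral_apply]
  · rfl
  · have := S_int (s := s) h (v := v) cv x
    refine Continuous.integrable_of_hasCompactSupport (by fun_prop) ?_
    refine HasCompactSupport.smul_right (f := fun y => (k (iota n y) : ℂ)) ?_
    exact h.iota_cpt.comp_left (g := fun r : ℝ => (r : ℂ)) (by simp)

lemma S_pd_tan {s : ℝ} {k : Pt n → ℝ} (h : Ker s k) {v : Pt n → ℂ} (hv : Tst v) (j : Fin n) :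
    S k (pd v j.succ) = S (fun x => fderiv ℝ k x (ee j.succ)) v := by
  funext x
  have c := cont_iota (n := n)
  have hk := h.1.differentiable (by simp)
  have e1 : ∀ y, fderiv ℝ (fun y : BPt n => (k (iota n y) : ℂ)) y (EuclideanSpace.single j 1)
      = ((fderiv ℝ k (iota n y) (ee j.succ) : ℝ) : ℂ) := fun y => by
    have h1 := Complex.ofRealCLM.hasFDerivAt.comp y ((hk (iota n y)).hasFDerivAt.comp y
      (iota n).toContinuousLinearMap.hasFDerivAt)
    have h2 : (fun y : BPt n => (k (iota n y) : ℂ)) = Complex.ofRealCLM ∘ (k ∘ (iota n).toContinuousLinearMap) := by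
      ext y; simp
    rw [h2]
    erw [h1.fderiv]
    simp [iota_single]
  have e2 : ∀ y, HasFDerivAt (fun y : BPt n => v (x - iota n y))
      ((fderiv ℝ v (x - iota n y)).comp (- (iota n).toContinuousLinearMap)) y := fun y =>
    (hv.diff (x - iota n y)).hasFDerivAt.comp y ((iota n).toContinuousLinearMap.hasFDerivAt.const_sub x)
  have e3 : ∀ y, fderiv ℝ (fun y : BPt n => v (x - iota n y)) y (EuclideanSpace.single j 1)
      = - pd v j.succ (x - iota n y) := fun y => by
    rw [(e2 y).fderiv]; simp [iota_single, pd, pdG, ee]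
  have := integral_mul_fderiv_eq_neg_fderiv_mul_of_integrable (μ := (volume : Measure (BPt n)))
    (f := fun y => (k (iota n y) : ℂ)) (g := fun y => v (x - iota n y)) (v := EuclideanSpace.single j 1)
    (by simp only [e1]; exact S_int (h.dt (ee j.succ)) hv.cont x)
    (by simp only [e3, mul_neg]; exact (S_int h (hv.pd j.succ).cont x).neg)
    (S_int h hv.cont x)
    (fun y _ => (Complex.ofRealCLM.differentiableAt.comp y ((hk (iota n y)).comp y
      (iota n).toContinuousLinearMap.differentiableAt)))
    (fun y _ => (e2 y).differentiableAt)
  simp only [e1, e3, mul_neg, integral_neg, neg_inj] at this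
  exact this

/-- adjoint -/
lemma S_adj {s : ℝ} {k : Pt n → ℝ} (h : Ker s k) {v ψ : Pt n → ℂ} (hv : Continuous v)
    (hψ : Continuous ψ) (hc : HasCompactSupport ψ) :
    ∫ x, S k v x * ψ x = ∫ x, v x * S (fun y => k (-y)) ψ x := by
  have c := cont_iota (n := n)
  have ck := h.1.continuous
  have cp := h.iota_cpt
  have e1 : ∀ x, S k v x * ψ x = ∫ y : BPt n, (k (iota n y) : ℂ) * v (x - iota n y) * ψ x := fun x => by
    rw [integral_mul_const]; rfl
  have e2 : ∀ x, v x * S (fun y => k (-y)) ψ x = ∫ y : BPt n, (k (iota n y) : ℂ) * v x * ψ (x + iota n y) := by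
    intro x
    unfold S
    rw [← integral_const_mul, ← integral_neg_eq_self]
    congr 1; ext y; simp; ring
  simp only [e1, e2]
  rw [integral_integral_swap_of_hasCompactSupport
      (f := fun x (y : BPt n) => (k (iota n y) : ℂ) * v (x - iota n y) * ψ x) (by fun_prop) ?_,
    integral_integral_swap_of_hasCompactSupport
      (f := fun x (y : BPt n) => (k (iota n y) : ℂ) * v x * ψ (x + iota n y)) (by fun_prop) ?_]
  · congr 1; ext y
    rw [← integral_add_right_eq_self _ (iota n y)]
    simp
  · refine HasCompactSupport.of_support_subset_isCompact
      (K := (fun p : Pt n × BPt n => (p.1 - iota n p.2, p.2)) '' (tsupport ψ ×ˢ closedBall 0 s))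
      ((hc.isCompact.prod (isCompact_closedBall 0 s)).image (by fun_prop)) ?_
    rintro ⟨x, y⟩ hxy
    simp only [Function.uncurry, Function.mem_support, ne_eq, mul_eq_zero, not_or] at hxy
    refine ⟨(x + iota n y, y), ⟨subset_tsupport _ hxy.2, ?_⟩, by simp⟩
    by_contra hh
    apply hxy.1.1
    simp at hh
    simp [h.zero (y := iota n y) (by simpa using hh)]
  · refine HasCompactSupport.of_support_subset_isCompact
      (K := (tsupport ψ ×ˢ closedBall 0 s)) (hc.isCompact.prod (isCompact_closedBall 0 s)) ?_
    rintro ⟨x, y⟩ hxy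
    simp only [Function.uncurry, Function.mem_support, ne_eq, mul_eq_zero, not_or] at hxy
    refine ⟨subset_tsupport _ hxy.2, ?_⟩
    by_contra hh
    apply hxy.1.1
    simp at hh
    simp [h.zero (y := iota n y) (by simpa using hh)]

/-! ### `L²` bounds for smoothing -/

lemma jensen2 {Y : Type*} [MeasurableSpace Y] (ν : Measure Y) {k g : Y → ℝ≥0∞}
    (hk : AEMeasurable k ν) (hg : AEMeasurable g ν) :
    (∫⁻ y, k y * g y ∂ν) ^ 2 ≤ (∫⁻ y, k y ∂ν) * ∫⁻ y, k y * g y ^ 2 ∂ν := by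
  have hg' : AEMeasurable g (ν.withDensity k) := hg.mono_ac (withDensity_absolutelyContinuous _ _)
  have h := ENNReal.lintegral_mul_le_Lp_mul_Lq (ν.withDensity k) (p := 2) (q := 2)
    (by constructor <;> norm_num) hg' (aemeasurable_const (b := (1 : ℝ≥0∞)))
  have e1 : ∫⁻ y, (g * (fun _ => (1 : ℝ≥0∞)) : Y → ℝ≥0∞) y ∂(ν.withDensity k) = ∫⁻ y, k y * g y ∂ν := by
    rw [lintegral_withDensity_eq_lintegral_mul₀ hk (hg.mul aemeasurable_const)]; simp
  have e2 : ∫⁻ y, g y ^ (2 : ℝ) ∂(ν.withDensity k) = ∫⁻ y, k y * g y ^ 2 ∂ν := by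
    rw [lintegral_withDensity_eq_lintegral_mul₀ hk (hg.pow_const _)]; simp
  have e3 : ∫⁻ _, (1 : ℝ≥0∞) ^ (2 : ℝ) ∂(ν.withDensity k) = ∫⁻ y, k y ∂ν := by
    simp
  rw [e1, e2, e3] at h
  calc (∫⁻ y, k y * g y ∂ν) ^ 2 ≤ ((∫⁻ y, k y * g y ^ 2 ∂ν) ^ (1 / (2 : ℝ)) * (∫⁻ y, k y ∂ν) ^ (1 / (2 : ℝ))) ^ 2 := by
        gcongr
    _ = _ := by
        rw [mul_pow, mul_comm, ← ENNReal.rpow_natCast, ← ENNReal.rpow_natCast, ← ENNReal.rpow_mul,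
          ← ENNReal.rpow_mul]; norm_num

lemma conv_L2 {Y : Type*} [MeasurableSpace Y] (ν : Measure Y) [SFinite ν] {j : Y → Pt n}
    (hj : Measurable j) {k : Y → ℝ≥0∞} (hk : Measurable k) {g : Pt n → ℝ≥0∞} (hg : Measurable g) :
    ∫⁻ x, (∫⁻ y, k y * g (x - j y) ∂ν) ^ 2 ≤ (∫⁻ y, k y ∂ν) ^ 2 * ∫⁻ x, g x ^ 2 := by
  calc ∫⁻ x, (∫⁻ y, k y * g (x - j y) ∂ν) ^ 2
      ≤ ∫⁻ x, (∫⁻ y, k y ∂ν) * ∫⁻ y, k y * g (x - j y) ^ 2 ∂ν := by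
        refine lintegral_mono fun x => jensen2 ν hk.aemeasurable ?_
        exact (hg.comp (measurable_const.sub hj)).aemeasurable
    _ = (∫⁻ y, k y ∂ν) * ∫⁻ x, ∫⁻ y, k y * g (x - j y) ^ 2 ∂ν := by
        rw [lintegral_const_mul]
        exact Measurable.lintegral_prod_right' (f := fun p : Pt n × Y => k p.2 * g (p.1 - j p.2) ^ 2) (by fun_prop)
    _ = (∫⁻ y, k y ∂ν) * ∫⁻ y, (∫⁻ x, k y * g (x - j y) ^ 2) ∂ν := by
        rw [lintegral_lintegral_swap]
        exact (show Measurable fun p : Pt n × Y => k p.2 * g (p.1 - j p.2) ^ 2 by fun_prop).aemeasurable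
    _ = (∫⁻ y, k y ∂ν) * ∫⁻ y, k y * (∫⁻ x, g x ^ 2) ∂ν := by
        congr 1; congr 1; ext y
        rw [lintegral_const_mul _ (by fun_prop), lintegral_sub_right_eq_self (fun x => g x ^ 2) (j y)]
    _ = _ := by
        rw [lintegral_mul_const _ hk]; ring

lemma ofReal_nsq {f : Pt n → ℂ} (hf : Integrable (fun x => ‖f x‖ ^ 2)) :
    ENNReal.ofReal (nsq f) = ∫⁻ x, ‖f x‖ₑ ^ 2 := by
  unfold nsq
  rw [ofReal_integral_eq_lintegral_ofReal hf (Filter.Eventually.of_forall fun x => by positivity)]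
  congr 1; ext x
  rw [ENNReal.ofReal_pow (norm_nonneg _), ofReal_norm]

lemma Tst.ofReal_nsq {f : Pt n → ℂ} (hf : Tst f) : ENNReal.ofReal (nsq f) = ∫⁻ x, ‖f x‖ₑ ^ 2 :=
  DP.ofReal_nsq hf.int_sq

/-- `L¹` norm of a kernel on the boundary plane -/
def kn (k : Pt n → ℝ) : ℝ := ∫ y : BPt n, |k (iota n y)|

lemma kn_nonneg (k : Pt n → ℝ) : 0 ≤ kn k := integral_nonneg fun _ => abs_nonneg _

lemma Ker.ofReal_kn {s : ℝ} {k : Pt n → ℝ} (h : Ker s k) :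
    ENNReal.ofReal (kn k) = ∫⁻ y : BPt n, ‖k (iota n y)‖ₑ := by
  unfold kn
  rw [ofReal_integral_eq_lintegral_ofReal h.int.abs (Filter.Eventually.of_forall fun x => by positivity)]
  congr 1; ext x
  rw [← Real.norm_eq_abs, ofReal_norm]

lemma kn_neg {s : ℝ} {k : Pt n → ℝ} (_h : Ker s k) : kn (fun x => k (-x)) = kn k := by
  unfold kn
  rw [← integral_neg_eq_self]
  simp

lemma S_nsq {s : ℝ} {k : Pt n → ℝ} (h : Ker s k) {v : Pt n → ℂ} (hv : Tst v) :
    nsq (S k v) ≤ kn k ^ 2 * nsq v := by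
  have hp : 0 ≤ kn k ^ 2 * nsq v := mul_nonneg (by positivity) (nsq_nonneg _)
  rw [← ENNReal.ofReal_le_ofReal_iff hp, (S_tst h hv).ofReal_nsq, ENNReal.ofReal_mul (by positivity),
    hv.ofReal_nsq, ENNReal.ofReal_pow (kn_nonneg _), h.ofReal_kn]
  have c := cont_iota (n := n)
  have ck := h.1.continuous
  refine le_trans ?_ (conv_L2 (volume : Measure (BPt n)) (j := iota n) c.measurable
    (k := fun y => ‖k (iota n y)‖ₑ) (ck.comp c).enorm.measurable (g := fun x => ‖v x‖ₑ) (hv.cont.enorm.measurable))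
  refine lintegral_mono fun x => ?_
  dsimp only
  gcongr
  refine (enorm_integral_le_lintegral_enorm _).trans (lintegral_mono fun y => ?_)
  rw [enorm_mul]
  gcongr
  rw [← ofReal_norm, ← ofReal_norm, Complex.norm_real]

lemma S_gsq {s : ℝ} {k : Pt n → ℝ} (h : Ker s k) {v : Pt n → ℂ} (hv : Tst v) :
    gsq (S k v) ≤ kn k ^ 2 * gsq v := by
  unfold gsq
  rw [Finset.mul_sum]
  refine Finset.sum_le_sum fun i _ => ?_
  rw [S_pd h hv]
  exact S_nsq h (hv.pd i)

/-- Euclidean length of the gradient -/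
def gl (v : Pt n → ℂ) (x : Pt n) : ℝ := √(∑ i, ‖pd v i x‖ ^ 2)

lemma norm_fderiv_le_gl (v : Pt n → ℂ) (x y : Pt n) : ‖fderiv ℝ v x y‖ ≤ gl v x * ‖y‖ := by
  have e : y = ∑ i, (y i) • ee i := by
    ext j; simp [ee, Finset.sum_apply, Pi.single_apply]
  have e2 : fderiv ℝ v x y = ∑ i, (y i) • pd v i x := by
    conv_lhs => rw [e]
    rw [map_sum]
    refine Finset.sum_congr rfl fun i _ => ?_
    rw [map_smul]; rfl
  rw [e2]
  refine (norm_sum_le _ _).trans ?_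
  simp only [norm_smul]
  have := Real.sum_mul_le_sqrt_mul_sqrt Finset.univ (fun i => ‖pd v i x‖) (fun i => ‖y i‖)
  rw [EuclideanSpace.norm_eq y]
  unfold gl
  refine le_trans (le_of_eq ?_) this
  exact Finset.sum_congr rfl fun i _ => mul_comm _ _

lemma gl_cont {v : Pt n → ℂ} (hv : Tst v) : Continuous (gl v) := by
  have : ∀ i, Continuous (pd v i) := fun i => (hv.pd i).cont
  unfold gl; fun_prop

lemma lint_gl {v : Pt n → ℂ} (hv : Tst v) : ∫⁻ x, ‖gl v x‖ₑ ^ 2 = ENNReal.ofReal (gsq v) := by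
  unfold gsq
  rw [ENNReal.ofReal_sum_of_nonneg fun i _ => nsq_nonneg _]
  simp_rw [(hv.pd _).ofReal_nsq]
  rw [← lintegral_finsetSum _ fun i _ => by
    have := (hv.pd i).cont; fun_prop]
  congr 1; ext x
  rw [← ofReal_norm, ← ENNReal.ofReal_pow (norm_nonneg _), gl, Real.norm_eq_abs,
    sq_abs, Real.sq_sqrt (by positivity), ENNReal.ofReal_sum_of_nonneg fun i _ => by positivity]
  refine Finset.sum_congr rfl fun i _ => ?_
  rw [← ofReal_norm, ENNReal.ofReal_pow (norm_nonneg _)]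

lemma transl_L2 {v : Pt n → ℂ} (hv : Tst v) (y : Pt n) :
    ∫⁻ x, ‖v (x - y) - v x‖ₑ ^ 2 ≤ ‖y‖ₑ ^ 2 * ENNReal.ofReal (gsq v) := by
  have key := conv_L2 (volume.restrict (Ioc (0 : ℝ) 1)) (j := fun t => t • y) (by fun_prop)
    (k := fun _ => ‖y‖ₑ) measurable_const (g := fun x => ‖gl v x‖ₑ) (gl_cont hv).enorm.measurable
  simp only [lintegral_const, lint_gl hv] at key
  refine le_trans (lintegral_mono fun x => ?_) (key.trans (le_of_eq (by simp)))
  gcongr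
  have hd : ∀ t ∈ uIcc (0 : ℝ) 1, HasDerivAt (fun t : ℝ => v (x - t • y)) (fderiv ℝ v (x - t • y) (-y)) t := by
    intro t _
    have h1 : HasDerivAt (fun t : ℝ => x - t • y) (-y) t := by
      simpa using ((hasDerivAt_id t).smul_const y).const_sub x
    exact (hv.diff (x - t • y)).hasFDerivAt.comp_hasDerivAt t h1
  have cc : Continuous (fun t : ℝ => fderiv ℝ v (x - t • y) (-y)) := by
    have : Continuous (fderiv ℝ v) := hv.1.continuous_fderiv (by simp)
    fun_prop
  have := intervalIntegral.integral_eq_sub_of_hasDerivAt hd (cc.intervalIntegrable 0 1)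
  simp only [one_smul, zero_smul, sub_zero] at this
  rw [← this, intervalIntegral.integral_of_le zero_le_one]
  refine (enorm_integral_le_lintegral_enorm _).trans (lintegral_mono fun t => ?_)
  rw [← ofReal_norm, ← ofReal_norm, ← ofReal_norm,
    ← ENNReal.ofReal_mul (norm_nonneg _)]
  apply ENNReal.ofReal_le_ofReal
  refine (norm_fderiv_le_gl _ _ _).trans ?_
  rw [norm_neg, mul_comm, Real.norm_eq_abs]
  gcongr
  exact le_abs_self _

lemma S_sub {s : ℝ} {k : Pt n → ℝ} (h : Ker s k) (h0 : ∀ x, 0 ≤ k x)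
    (h1 : ∫ y : BPt n, k (iota n y) = 1) {v : Pt n → ℂ} (hv : Tst v) :
    nsq (fun x => S k v x - v x) ≤ s ^ 2 * gsq v := by
  have c := cont_iota (n := n)
  have ck := h.1.continuous
  have hg := gsq_nonneg v
  rw [← ENNReal.ofReal_le_ofReal_iff (by positivity), ((S_tst h hv).sub hv).ofReal_nsq]
  have hkn : ∫⁻ y : BPt n, ‖k (iota n y)‖ₑ = 1 := by
    rw [← h.ofReal_kn, kn]
    simp only [abs_of_nonneg (h0 _), h1, ENNReal.ofReal_one]
  have cv := hv.cont
  calc ∫⁻ x, ‖S k v x - v x‖ₑ ^ 2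
      ≤ ∫⁻ x, ∫⁻ y : BPt n, ‖k (iota n y)‖ₑ * ‖v (x - iota n y) - v x‖ₑ ^ 2 := by
        refine lintegral_mono fun x => ?_
        have e : S k v x - v x = ∫ y : BPt n, (k (iota n y) : ℂ) * (v (x - iota n y) - v x) := by
          simp only [mul_sub]
          have i2 : Integrable (fun y : BPt n => (k (iota n y) : ℂ) * v x) :=
            (h.int.ofReal (𝕜 := ℂ)).mul_const (v x)
          have i3 : ∫ y : BPt n, (k (iota n y) : ℂ) = 1 := by
            have := integral_ofReal (𝕜 := ℂ) (μ := (volume : Measure (BPt n))) (f := fun y => k (iota n y))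
            rw [h1] at this; simpa using this
          rw [integral_sub (S_int h cv x) i2, integral_mul_const, i3]
          simp [S]
        rw [e]
        have j := jensen2 (volume : Measure (BPt n)) (k := fun y => ‖k (iota n y)‖ₑ)
          (g := fun y => ‖v (x - iota n y) - v x‖ₑ) (by fun_prop) (by fun_prop)
        rw [hkn, one_mul] at j
        refine le_trans ?_ j
        gcongr
        refine (enorm_integral_le_lintegral_enorm _).trans (lintegral_mono fun y => ?_)
        rw [enorm_mul]
        gcongr
        rw [← ofReal_norm, ← ofReal_norm, Complex.norm_real]
    _ = ∫⁻ y : BPt n, ∫⁻ x, ‖k (iota n y)‖ₑ * ‖v (x - iota n y) - v x‖ₑ ^ 2 := by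
        rw [lintegral_lintegral_swap]
        have m1 : Measurable fun p : Pt n × BPt n => ‖k (iota n p.2)‖ₑ :=
          (ck.comp (c.comp continuous_snd)).enorm.measurable
        have m2 : Measurable fun p : Pt n × BPt n => ‖v (p.1 - iota n p.2) - v p.1‖ₑ :=
          Continuous.measurable (by fun_prop)
        exact (m1.mul (m2.pow_const 2)).aemeasurable
    _ ≤ ∫⁻ y : BPt n, ‖k (iota n y)‖ₑ * ENNReal.ofReal (s ^ 2 * gsq v) := by
        refine lintegral_mono fun y => ?_
        dsimp only
        rw [lintegral_const_mul _ (by fun_prop)]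
        by_cases hy : s < ‖y‖
        · simp [h.zero (y := iota n y) (by simpa using hy)]
        · gcongr
          refine (transl_L2 hv (iota n y)).trans ?_
          rw [ENNReal.ofReal_mul (by positivity), ← ofReal_norm,
            ← ENNReal.ofReal_pow (norm_nonneg _)]
          gcongr
          simpa using hy
    _ = _ := by
        have m1 : Measurable fun y : BPt n => ‖k (iota n y)‖ₑ := (ck.comp c).enorm.measurable
        rw [lintegral_mul_const _ m1, hkn, one_mul]

/-! ### Freezing the coefficients -/

/-- smallness of the gradient of the coefficients -/
def Sm (ε : ℝ) (A : Pt n → Fin (n + 1) → Fin (n + 1) → ℂ) : Prop :=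
  ∀ x ∈ upperHalf n, ∀ i j, ‖fderiv ℝ (fun x => A x i j) x‖ ≤ ε / dd x

lemma norm_ee (k : Fin (n + 1)) : ‖(ee k : Pt n)‖ = 1 := by simp [ee]

lemma dd_ee : dd (ee 0 : Pt n) = 1 := by simp [dd, ee]

lemma ee_mem : (ee 0 : Pt n) ∈ upperHalf n := by simp [upperHalf, dd_ee]

lemma dd_le_norm (x : Pt n) : dd x ≤ ‖x‖ := by
  have := EuclideanSpace.norm_sq_eq x
  have h : (x 0) ^ 2 ≤ ‖x‖ ^ 2 := by
    rw [this]
    have := Finset.single_le_sum (f := fun i => ‖x i‖ ^ 2) (fun i _ => by positivity) (Finset.mem_univ 0)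
    simpa using this
  exact le_trans (le_abs_self _) (abs_le_of_sq_le_sq h (norm_nonneg _))

lemma Coef.diffAt {lam Lam : ℝ} {A : Pt n → Fin (n + 1) → Fin (n + 1) → ℂ} (h : Coef lam Lam A)
    (i j : Fin (n + 1)) {x : Pt n} (hx : x ∈ upperHalf n) :
    DifferentiableAt ℝ (fun x => A x i j) x :=
  ((h.entry i j x hx).contDiffAt (isOpen_upperHalf.mem_nhds hx)).differentiableAt (by simp)

lemma D_bound {lam Lam ε : ℝ} {A : Pt n → Fin (n + 1) → Fin (n + 1) → ℂ} (h : Coef lam Lam A)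
    (hs : Sm ε A) (hε : 0 ≤ ε) {x : Pt n} (hx : x ∈ upperHalf n) (hx1 : ‖x‖ < 1) (i j : Fin (n + 1)) :
    ‖A x i j - A (ee 0) i j‖ ≤ 2 * ε / dd x := by
  have hx0 : 0 < dd x := hx
  have hlt : dd x < 1 := (dd_le_norm x).trans_lt hx1
  have hconv : Convex ℝ {y : Pt n | dd x ≤ dd y} := by
    have : IsLinearMap ℝ (dd : Pt n → ℝ) := ⟨fun x y => by simp [dd], fun c x => by simp [dd]⟩
    exact convex_halfSpace_ge this _
  have m1 : (ee 0 : Pt n) ∈ {y : Pt n | dd x ≤ dd y} := by rw [mem_ofPred_eq, dd_ee]; exact hlt.le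
  have m2 : x ∈ {y : Pt n | dd x ≤ dd y} := le_refl (dd x)
  have := hconv.norm_image_sub_le_of_norm_fderiv_le (𝕜 := ℝ) (f := fun x => A x i j) (C := ε / dd x)
    (x := ee 0) (y := x)
    (fun y hy => h.diffAt i j (lt_of_lt_of_le hx0 hy))
    (fun y hy => (hs y (lt_of_lt_of_le hx0 hy) i j).trans (by
      have : dd x ≤ dd y := hy
      gcongr)) m1 m2
  refine this.trans ?_
  have h2 : ‖x - ee 0‖ ≤ 2 := (norm_sub_le _ _).trans (by rw [norm_ee]; linarith)
  calc ε / dd x * ‖x - ee 0‖ ≤ ε / dd x * 2 := by gcongr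
    _ = _ := by ring

lemma pdA_bound {ε : ℝ} {A : Pt n → Fin (n + 1) → Fin (n + 1) → ℂ}
    (hs : Sm ε A) {x : Pt n} (hx : x ∈ upperHalf n) (i j k : Fin (n + 1)) :
    ‖pd (fun x => A x i j) k x‖ ≤ ε / dd x := by
  have := (fderiv ℝ (fun x => A x i j) x).le_opNorm (ee k)
  rw [norm_ee, mul_one] at this
  exact this.trans (hs x hx i j)

lemma contDiffOn_inv_dd : ContDiffOn ℝ (⊤ : ℕ∞) (fun x : Pt n => ((dd x : ℂ))⁻¹) (upperHalf n) := by
  refine ContDiffOn.inv ?_ ?_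
  · exact (Complex.ofRealCLM.contDiff.comp contDiff_dd).contDiffOn
  · intro x hx; exact_mod_cast (ne_of_gt hx)

lemma Tst.hd {G : Pt n → ℂ} (hG : Tst G) : Tst (fun x => ((dd x : ℂ))⁻¹ * G x) :=
  hG.mul contDiffOn_inv_dd

lemma hardy1 {G : Pt n → ℂ} (hG : Tst G) :
    √(nsq (fun x => ((dd x : ℂ))⁻¹ * G x)) ≤ 2 * √(nsq (pd G 0)) := by
  have := hardy hG (W := fun _ => 1) contDiff_const (fun _ => by simp) (fun x => by simp)
  simp only [one_mul] at this
  have h4 : (2 : ℝ) = √4 := by rw [show (4 : ℝ) = 2 ^ 2 by norm_num, Real.sqrt_sq (by norm_num)]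
  rw [h4, ← Real.sqrt_mul (by norm_num)]
  exact Real.sqrt_le_sqrt this

lemma wcs {D f g : Pt n → ℂ} {c : ℝ} (hc : 0 ≤ c) (hf : Tst f) (hg : Tst g)
    (hD : ∀ x ∈ upperHalf n, f x ≠ 0 → g x ≠ 0 → ‖D x‖ ≤ c / dd x) :
    ‖∫ x, D x * f x * g x‖ ≤ 2 * c * √(nsq f) * √(nsq (pd g 0)) := by
  have hb : ∀ x, ‖D x * f x * g x‖ ≤ c * (‖f x‖ * ‖((dd x : ℂ))⁻¹ * g x‖) := by
    intro x
    by_cases h1 : f x = 0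
    · simp [h1]
    by_cases h2 : g x = 0
    · simp [h2]
    have hx : x ∈ upperHalf n := by
      by_contra hx; exact h1 (hf.zero_of_notMem hx)
    have hx0 : 0 < dd x := hx
    have := hD x hx h1 h2
    rw [norm_mul, norm_mul, norm_mul, norm_inv, Complex.norm_real, Real.norm_of_nonneg hx0.le]
    calc ‖D x‖ * ‖f x‖ * ‖g x‖ ≤ c / dd x * ‖f x‖ * ‖g x‖ := by gcongr
      _ = _ := by field_simp
  have hi : Integrable (fun x => ‖f x‖ * ‖((dd x : ℂ))⁻¹ * g x‖) :=
    (hf.cont.norm.mul hg.hd.cont.norm).integrable_of_hasCompactSupport hf.cpt.norm.mul_right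
  calc ‖∫ x, D x * f x * g x‖ ≤ ∫ x, c * (‖f x‖ * ‖((dd x : ℂ))⁻¹ * g x‖) :=
        norm_integral_le_of_norm_le (hi.const_mul c) (Filter.Eventually.of_forall hb)
    _ = c * ∫ x, ‖f x‖ * ‖((dd x : ℂ))⁻¹ * g x‖ := integral_const_mul _ _
    _ ≤ c * (√(nsq f) * √(nsq (fun x => ((dd x : ℂ))⁻¹ * g x))) := by
        gcongr; exact cs (hf.memLp 2) (hg.hd.memLp 2)
    _ ≤ c * (√(nsq f) * (2 * √(nsq (pd g 0)))) := by gcongr; exact hardy1 hg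
    _ = _ := by ring

lemma nsq_pd_le (v : Pt n → ℂ) (i : Fin (n + 1)) : √(nsq (pd v i)) ≤ √(gsq v) :=
  Real.sqrt_le_sqrt (Finset.single_le_sum (f := fun i => nsq (pd v i)) (fun _ _ => nsq_nonneg _)
    (Finset.mem_univ i))

lemma S_sqrt {s : ℝ} {k : Pt n → ℝ} (h : Ker s k) {v : Pt n → ℂ} (hv : Tst v) :
    √(nsq (S k v)) ≤ kn k * √(nsq v) := by
  rw [← Real.sqrt_sq (kn_nonneg k), ← Real.sqrt_mul (by positivity)]
  exact Real.sqrt_le_sqrt (S_nsq h hv)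

/-- the sum of the `L¹` norms of a kernel and its derivatives -/
def kn1 (k : Pt n → ℝ) : ℝ := kn k + ∑ j : Fin n, kn (fun x => fderiv ℝ k x (ee j.succ))

lemma kn_le_kn1 (k : Pt n → ℝ) : kn k ≤ kn1 k :=
  le_add_of_nonneg_right (Finset.sum_nonneg fun _ _ => kn_nonneg _)

lemma knd_le_kn1 (k : Pt n → ℝ) (j : Fin n) : kn (fun x => fderiv ℝ k x (ee j.succ)) ≤ kn1 k :=
  (Finset.single_le_sum (f := fun j : Fin n => kn (fun x => fderiv ℝ k x (ee j.succ)))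
    (fun _ _ => kn_nonneg _) (Finset.mem_univ j)).trans (le_add_of_nonneg_left (kn_nonneg _))

lemma kn1_nonneg (k : Pt n → ℝ) : 0 ≤ kn1 k := (kn_nonneg k).trans (kn_le_kn1 k)

lemma pd_comm {v : Pt n → ℂ} (hv : Tst v) (i j : Fin (n + 1)) : pd (pd v i) j = pd (pd v j) i := by
  funext x
  have hsym : IsSymmSndFDerivAt ℝ v x := hv.1.contDiffAt.isSymmSndFDerivAt (by simp only [minSmoothness_of_isRCLikeNormedField]; exact WithTop.coe_le_coe.2 (le_top : (2 : ℕ∞) ≤ ⊤))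
  have hd : DifferentiableAt ℝ (fderiv ℝ v) x :=
    (hv.1.fderiv_right (m := (⊤ : ℕ∞)) (by simp)).differentiable (by simp) x
  have e : ∀ a b : Pt n, fderiv ℝ (fun y => fderiv ℝ v y a) x b = fderiv ℝ (fderiv ℝ v) x b a := by
    intro a b
    rw [fderiv_clm_apply hd (by fun_prop)]; simp
  change fderiv ℝ (fun y => fderiv ℝ v y (ee i)) x (ee j) = fderiv ℝ (fun y => fderiv ℝ v y (ee j)) x (ee i)
  rw [e, e]; exact hsym _ _

lemma pd_const_entry {A : Pt n → Fin (n + 1) → Fin (n + 1) → ℂ} (i j k : Fin (n + 1)) (c : ℂ) (x : Pt n) :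
    pd (fun y => A y i j - c) k x = pd (fun y => A y i j) k x := by
  simp only [pd, pdG]; rw [fderiv_sub_const]

/-- bound on one error term -/
lemma R_bound {lam Lam ε s : ℝ} {A : Pt n → Fin (n + 1) → Fin (n + 1) → ℂ} (h : Coef lam Lam A)
    (hs : Sm ε A) (hε : 0 ≤ ε) (h00 : ∀ x ∈ upperHalf n, A x 0 0 = 1)
    {k : Pt n → ℝ} (hk : Ker s k) {v Ψ : Pt n → ℂ} (hv : Tst v) (hΨ : Tst Ψ)
    (hsup : tsupport (S k Ψ) ⊆ ball 0 1) (i j : Fin (n + 1)) :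
    ‖∫ x, (A x i j - A (ee 0) i j) * pd v j x * pd (S k Ψ) i x‖ ≤
      8 * ε * kn1 k * √(gsq v) * √(gsq Ψ) := by
  have hΦ := S_tst hk hΨ
  have hsupi : ∀ i x, pd (S k Ψ) i x ≠ 0 → ‖x‖ < 1 := fun i x hx => by
    have := hsup (tsupport_pd_subset (S k Ψ) i (subset_tsupport _ hx))
    simpa using this
  have hdt : ∀ l : Fin n, pd (S k Ψ) l.succ = S (fun x => fderiv ℝ k x (ee l.succ)) Ψ := fun l => by
    rw [S_pd hk hΨ, S_pd_tan hk hΨ]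
  -- the mixed derivatives
  have hmix : ∀ l : Fin n, √(nsq (pd (pd (S k Ψ) l.succ) 0)) ≤ kn1 k * √(gsq Ψ) := fun l => by
    rw [hdt, S_pd (hk.dt _) hΨ]
    refine (S_sqrt (hk.dt _) (hΨ.pd 0)).trans ?_
    exact mul_le_mul (knd_le_kn1 k l) (nsq_pd_le _ _) (Real.sqrt_nonneg _) (kn1_nonneg _)
  have hp1 := kn1_nonneg k
  have hp2 := Real.sqrt_nonneg (gsq v)
  have hp3 := Real.sqrt_nonneg (gsq Ψ)
  rcases Fin.eq_zero_or_eq_succ i with rfl | ⟨l, rfl⟩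
  · rcases Fin.eq_zero_or_eq_succ j with rfl | ⟨m, rfl⟩
    · have : (fun x => (A x 0 0 - A (ee 0) 0 0) * pd v 0 x * pd (S k Ψ) 0 x) = fun _ => 0 := by
        funext x
        by_cases hx : x ∈ upperHalf n
        · simp [h00 x hx, h00 _ ee_mem]
        · simp [(hv.pd 0).zero_of_notMem hx]
      rw [this]; simp; positivity
    · -- integrate by parts
      set D : Pt n → ℂ := fun x => A x 0 m.succ - A (ee 0) 0 m.succ with hD
      have hDs : ContDiffOn ℝ (⊤ : ℕ∞) D (upperHalf n) := (h.entry 0 m.succ).sub contDiffOn_const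
      have hDv : Tst (fun x => D x * v x) := hv.mul hDs
      set F := pd (S k Ψ) 0 with hF
      have hFt : Tst F := hΦ.pd 0
      have hDF : Tst (fun x => D x * v x * F x) := hFt.mul hDv.1.contDiffOn
      have hz := int_pd_zero (hDF.1.of_le (by simp)) hDF.cpt m.succ
      have e : ∀ x, pd (fun x => D x * v x * F x) m.succ x =
          pd (fun x => A x 0 m.succ) m.succ x * F x * v x + D x * pd v m.succ x * F x
            + D x * pd F m.succ x * v x := fun x => by
        rw [pd_mul (hDv.diff x) (hFt.diff x), hv.pd_mul hDs, hD, pd_const_entry]; ring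
      have c1 : Tst (fun x => pd (fun x => A x 0 m.succ) m.succ x * F x) := by
        refine hFt.mul ?_
        exact ((h.entry 0 m.succ).fderiv_of_isOpen isOpen_upperHalf (m := (⊤ : ℕ∞)) (by simp)).clm_apply contDiffOn_const
      have c2 : Tst (fun x => D x * pd v m.succ x) := (hv.pd _).mul hDs
      have c3 : Tst (fun x => D x * pd F m.succ x) := (hFt.pd _).mul hDs
      have i1 : Integrable (fun x => pd (fun x => A x 0 m.succ) m.succ x * F x * v x) :=
        (c1.cont.mul hv.cont).integrable_of_hasCompactSupport c1.cpt.mul_right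
      have i2 : Integrable (fun x => D x * pd v m.succ x * F x) :=
        (c2.cont.mul hFt.cont).integrable_of_hasCompactSupport c2.cpt.mul_right
      have i3 : Integrable (fun x => D x * pd F m.succ x * v x) :=
        (c3.cont.mul hv.cont).integrable_of_hasCompactSupport c3.cpt.mul_right
      simp only [e] at hz
      have i12 : Integrable (fun x => pd (fun x => A x 0 m.succ) m.succ x * F x * v x +
        D x * pd v m.succ x * F x) := i1.add i2
      rw [integral_add i12 i3, integral_add i1 i2] at hz
      have b1 := wcs (D := fun x => pd (fun x => A x 0 m.succ) m.succ x) hε hFt hv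
        (fun x hx _ _ => pdA_bound hs hx 0 m.succ m.succ)
      have b3 := wcs (D := D) (c := 2 * ε) (by positivity) (hFt.pd m.succ) hv (fun x hx hne _ => by
        have : ‖x‖ < 1 := by
          have := hsup (tsupport_pd_subset (S k Ψ) 0 (tsupport_pd_subset F m.succ (subset_tsupport _ hne)))
          simpa using this
        exact D_bound h hs hε hx this 0 m.succ)
      have f1 : √(nsq F) ≤ kn1 k * √(gsq Ψ) := by
        rw [hF, S_pd hk hΨ]
        refine (S_sqrt hk (hΨ.pd 0)).trans ?_
        exact mul_le_mul (kn_le_kn1 k) (nsq_pd_le _ _) (Real.sqrt_nonneg _) (kn1_nonneg _)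
      have f2 : √(nsq (pd F m.succ)) ≤ kn1 k * √(gsq Ψ) := by
        rw [hF, pd_comm hΦ]; exact hmix m
      have hv0 := nsq_pd_le v 0
      have eq : ∫ x, D x * pd v m.succ x * F x =
          -(∫ x, pd (fun x => A x 0 m.succ) m.succ x * F x * v x) - ∫ x, D x * pd F m.succ x * v x := by
        linear_combination hz
      rw [eq]
      refine (norm_sub_le _ _).trans ?_
      rw [norm_neg]
      have g1 : 2 * ε * √(nsq F) * √(nsq (pd v 0)) ≤ 2 * ε * (kn1 k * √(gsq Ψ)) * √(gsq v) := by gcongr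
      have g2 : 2 * (2 * ε) * √(nsq (pd F m.succ)) * √(nsq (pd v 0)) ≤
        2 * (2 * ε) * (kn1 k * √(gsq Ψ)) * √(gsq v) := by gcongr
      have g3 : 0 ≤ ε * kn1 k * √(gsq v) * √(gsq Ψ) := by positivity
      calc _ ≤ 2 * ε * (kn1 k * √(gsq Ψ)) * √(gsq v) + 2 * (2 * ε) * (kn1 k * √(gsq Ψ)) * √(gsq v) := by
            linarith
        _ ≤ _ := by linarith
  · have b := wcs (D := fun x => A x l.succ j - A (ee 0) l.succ j) (c := 2 * ε) (by positivity)
      (hv.pd j) (hΦ.pd l.succ) (fun x hx _ hne => D_bound h hs hε hx (hsupi _ x hne) _ _)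
    have hvj := nsq_pd_le v j
    have g := hmix l
    have g3 : 0 ≤ ε * kn1 k * √(gsq v) * √(gsq Ψ) := by positivity
    calc _ ≤ _ := b
      _ ≤ 2 * (2 * ε) * √(gsq v) * (kn1 k * √(gsq Ψ)) := by gcongr
      _ ≤ _ := by linarith

lemma Coef.frozen {lam Lam : ℝ} {A : Pt n → Fin (n + 1) → Fin (n + 1) → ℂ} (h : Coef lam Lam A) :
    Coef lam Lam (fun _ : Pt n => A (ee 0)) :=
  ⟨contDiffOn_const, fun _ _ => h.ell _ ee_mem, fun _ _ => h.bdd _ ee_mem⟩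

lemma freeze_id {lam Lam s : ℝ} {A : Pt n → Fin (n + 1) → Fin (n + 1) → ℂ} (h : Coef lam Lam A)
    {k : Pt n → ℝ} (hk : Ker s k) {v Ψ : Pt n → ℂ} (hv : Tst v) (hΨ : Tst Ψ) :
    BF (fun _ => A (ee 0)) (S k v) Ψ = BF A v (S (fun y => k (-y)) Ψ) -
      ∑ i, ∑ j, ∫ x, (A x i j - A (ee 0) i j) * pd v j x * pd (S (fun y => k (-y)) Ψ) i x := by
  have hΦ := S_tst hk.neg hΨ
  have hintg : ∀ i j, Integrable (fun x => A x i j * pd v j x * pd (S (fun y => k (-y)) Ψ) i x) := fun i j => by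
    have : Tst (fun x => A x i j * pd v j x) := (hv.pd j).mul (h.entry i j)
    exact (this.cont.mul (hΦ.pd i).cont).integrable_of_hasCompactSupport this.cpt.mul_right
  have hint2 : ∀ i j, Integrable (fun x => A (ee 0) i j * pd v j x * pd (S (fun y => k (-y)) Ψ) i x) := fun i j => by
    have : Tst (fun x => A (ee 0) i j * pd v j x) := (hv.pd j).mul contDiffOn_const
    exact (this.cont.mul (hΦ.pd i).cont).integrable_of_hasCompactSupport this.cpt.mul_right
  have hint3 : ∀ i j, Integrable (fun x => A (ee 0) i j * pd (S k v) j x * pd Ψ i x) := fun i j => by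
    have : Tst (fun x => A (ee 0) i j * pd (S k v) j x) := ((S_tst hk hv).pd j).mul contDiffOn_const
    exact (this.cont.mul (hΨ.pd i).cont).integrable_of_hasCompactSupport this.cpt.mul_right
  rw [BF_eq (S_tst hk hv), BF_eq hv]
  rw [integral_finsetSum _ fun i _ => integrable_finsetSum _ fun j _ => hint3 i j]
  rw [integral_finsetSum _ fun i _ => integrable_finsetSum _ fun j _ => hintg i j]
  rw [← Finset.sum_sub_distrib]
  refine Finset.sum_congr rfl fun i _ => ?_
  rw [integral_finsetSum _ fun j _ => hint3 i j, integral_finsetSum _ fun j _ => hintg i j,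
    ← Finset.sum_sub_distrib]
  refine Finset.sum_congr rfl fun j _ => ?_
  rw [← integral_sub (hintg i j) (by
    have := (hintg i j).sub (hint2 i j)
    refine this.congr (Filter.Eventually.of_forall fun x => ?_)
    simp; ring)]
  have : ∀ x, A x i j * pd v j x * pd (S (fun y => k (-y)) Ψ) i x -
    (A x i j - A (ee 0) i j) * pd v j x * pd (S (fun y => k (-y)) Ψ) i x =
      A (ee 0) i j * (pd v j x * S (fun y => k (-y)) (pd Ψ i) x) := fun x => by
    rw [S_pd hk.neg hΨ]; ring
  simp only [this]
  rw [integral_const_mul, ← S_adj hk (hv.pd j).cont (hΨ.pd i).cont (hΨ.pd i).cpt,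
    ← integral_const_mul, S_pd hk hv]
  simp only [mul_assoc]

lemma kn1_neg {s : ℝ} {k : Pt n → ℝ} (h : Ker s k) : kn1 (fun x => k (-x)) = kn1 k := by
  unfold kn1
  rw [kn_neg h]
  congr 1
  refine Finset.sum_congr rfl fun j _ => ?_
  have : (fun x => fderiv ℝ (fun x => k (-x)) x (ee j.succ)) = fun x => - fderiv ℝ k (-x) (ee j.succ) := by
    funext x
    have hd : HasFDerivAt k (fderiv ℝ k (-x)) (-x) := ((h.1.differentiable (by simp)) _).hasFDerivAt
    have := hd.comp x ((hasFDerivAt_id x).neg)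
    have e := this.fderiv
    change fderiv ℝ (k ∘ fun x => -x) x (ee j.succ) = _
    have e2 : (k ∘ fun x => -x) = k ∘ (-fun x : Pt n => id x) := rfl
    rw [e2]; erw [e]; simp
  rw [this, ← kn_neg (h.dt (ee j.succ))]
  simp [kn]

/-- The smoothed function is an approximate solution of the frozen equation. -/
lemma freeze {lam Lam ε ε0 s r : ℝ} {A : Pt n → Fin (n + 1) → Fin (n + 1) → ℂ} (h : Coef lam Lam A)
    (hs : Sm ε A) (hε : 0 ≤ ε) (hε0 : 0 ≤ ε0) (h00 : ∀ x ∈ upperHalf n, A x 0 0 = 1)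
    {k : Pt n → ℝ} (hk : Ker s k) {v Ψ : Pt n → ℂ} (hv : Tst v) (hΨ : Tst Ψ)
    (hsol : ∀ ψ, Tst ψ → tsupport ψ ⊆ ball 0 1 → ‖BF A v ψ‖ ≤ ε0 * √(gsq ψ))
    (hr : tsupport Ψ ⊆ ball 0 r) (hrs : r + s ≤ 1) :
    ‖BF (fun _ => A (ee 0)) (S k v) Ψ‖ ≤
      (ε0 * kn k + (n + 1) ^ 2 * (8 * ε * kn1 k) * √(gsq v)) * √(gsq Ψ) := by
  have hsup : tsupport (S (fun y => k (-y)) Ψ) ⊆ ball 0 1 :=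
    (S_supp_ball hk.neg hΨ hr).trans (ball_subset_ball hrs)
  rw [freeze_id h hk hv hΨ]
  refine (norm_sub_le _ _).trans ?_
  have b1 : ‖BF A v (S (fun y => k (-y)) Ψ)‖ ≤ ε0 * kn k * √(gsq Ψ) := by
    refine (hsol _ (S_tst hk.neg hΨ) hsup).trans ?_
    have := S_gsq hk.neg hΨ
    rw [kn_neg hk] at this
    rw [mul_assoc]
    gcongr
    rw [← Real.sqrt_sq (kn_nonneg k), ← Real.sqrt_mul (by positivity)]
    exact Real.sqrt_le_sqrt this
  have b2 : ‖∑ i, ∑ j, ∫ x, (A x i j - A (ee 0) i j) * pd v j x * pd (S (fun y => k (-y)) Ψ) i x‖ ≤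
      ∑ _i : Fin (n + 1), ∑ _j : Fin (n + 1), 8 * ε * kn1 k * √(gsq v) * √(gsq Ψ) := by
    refine (norm_sum_le _ _).trans (Finset.sum_le_sum fun i _ => ?_)
    refine (norm_sum_le _ _).trans (Finset.sum_le_sum fun j _ => ?_)
    have := R_bound h hs hε h00 hk.neg hv hΨ hsup i j
    rwa [kn1_neg hk] at this
  simp only [Finset.sum_const, Finset.card_univ, Fintype.card_fin, nsmul_eq_mul] at b2
  push_cast at b2
  linarith

/-! ### Cutoffs and weighted Sobolev inequality -/

/-- a decreasing sequence of cutoffs -/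
structure Cuts (N : ℕ) (G : ℝ) (η : ℕ → Pt n → ℝ) : Prop where
  smooth : ∀ m, ContDiff ℝ (⊤ : ℕ∞) (η m)
  nn : ∀ m x, 0 ≤ η m x
  le1 : ∀ m x, η m x ≤ 1
  anti : ∀ m x, η (m + 1) x ≤ η m x
  supp : ∀ m, tsupport (η m) ⊆ ball 0 (7 / 8)
  one : ∀ m, ∀ x ∈ ball (0 : Pt n) (1 / 2), η m x = 1
  grad : ∀ m ≤ N, ∀ x, ∑ i, (fderiv ℝ (η m) x (ee i)) ^ 2 ≤ G
  grad' : ∀ m, m + 1 ≤ N → ∀ x, ∑ i, (fderiv ℝ (η (m + 1)) x (ee i)) ^ 2 ≤ G * (η m x) ^ 2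

lemma grad_bdd {f : Pt n → ℝ} (hf : ContDiff ℝ (⊤ : ℕ∞) f) (hc : HasCompactSupport f) :
    ∃ G, 0 ≤ G ∧ ∀ x, ∑ i, (fderiv ℝ f x (ee i)) ^ 2 ≤ G := by
  have hcont : Continuous (fun x => ∑ i, (fderiv ℝ f x (ee i)) ^ 2) :=
    continuous_finsetSum _ fun i _ =>
      ((hf.continuous_fderiv (by simp)).clm_apply continuous_const).pow 2
  have hs : HasCompactSupport (fun x => ∑ i, (fderiv ℝ f x (ee i)) ^ 2) := by
    refine (hc.fderiv ℝ).mono fun x hx => ?_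
    simp only [Function.mem_support] at hx ⊢
    intro h; simp [h] at hx
  obtain ⟨C, hC⟩ := hcont.bounded_above_of_compact_support hs
  exact ⟨C, (norm_nonneg _).trans (hC 0), fun x => (le_abs_self _).trans (hC x)⟩

/-- radii -/
def rr (m : ℕ) : ℝ := 1 / 2 + 1 / (4 * (m + 1))

lemma rr_lt (m : ℕ) : rr (m + 1) < rr m := by
  unfold rr
  have : (0 : ℝ) ≤ m := Nat.cast_nonneg m
  push_cast
  have : 1 / (4 * ((m : ℝ) + 1 + 1)) < 1 / (4 * (m + 1)) := by
    apply one_div_lt_one_div_of_lt <;> linarith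
  linarith

lemma rr_gt (m : ℕ) : 1 / 2 < rr m := by
  unfold rr
  have : (0 : ℝ) < 1 / (4 * (m + 1)) := by positivity
  linarith

lemma rr_le (m : ℕ) : rr m ≤ 3 / 4 := by
  unfold rr
  have h : (0 : ℝ) ≤ m := Nat.cast_nonneg m
  have : 1 / (4 * ((m : ℝ) + 1)) ≤ 1 / 4 := by
    apply one_div_le_one_div_of_le <;> linarith
  linarith

/-- the bump functions -/
def bb (n m : ℕ) : ContDiffBump (0 : Pt n) :=
  ⟨rr (m + 1), rr m, by have := rr_gt (m + 1); linarith, rr_lt m⟩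

lemma exists_cuts (n N : ℕ) : ∃ (G : ℝ) (η : ℕ → Pt n → ℝ), 1 ≤ G ∧ Cuts N G η := by
  have key : ∀ m, ∃ G, 0 ≤ G ∧ ∀ x, ∑ i, (fderiv ℝ (bb n m) x (ee i)) ^ 2 ≤ G := fun m =>
    grad_bdd (bb n m).contDiff (bb n m).hasCompactSupport
  choose g hg0 hg using key
  have hgm : ∀ m ≤ N, ∀ x, ∑ i, (fderiv ℝ (bb n m) x (ee i)) ^ 2 ≤ 1 + ∑ m ∈ Finset.range (N + 1), g m := by
    intro m hm x
    have := Finset.single_le_sum (f := g) (fun i _ => hg0 i) (Finset.mem_range.2 (Nat.lt_succ_of_le hm))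
    have := hg m x
    linarith
  have hts : ∀ m, tsupport (bb n m) = closedBall 0 (rr m) := fun m => (bb n m).tsupport_eq
  have h1 : ∀ m, ∀ x ∈ closedBall (0 : Pt n) (rr (m + 1)), bb n m x = 1 := fun m x hx =>
    (bb n m).one_of_mem_closedBall hx
  refine ⟨1 + ∑ m ∈ Finset.range (N + 1), g m, fun m => bb n m, ?_, ?_⟩
  · have := Finset.sum_nonneg (s := Finset.range (N + 1)) fun i _ => hg0 i
    linarith
  · refine ⟨fun m => (bb n m).contDiff, fun m x => (bb n m).nonneg, fun m x => (bb n m).le_one,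
      ?_, ?_, ?_, hgm, ?_⟩
    · intro m x
      by_cases hx : x ∈ closedBall (0 : Pt n) (rr (m + 1))
      · rw [h1 m x hx]; exact (bb n (m + 1)).le_one
      · rw [image_eq_zero_of_notMem_tsupport (f := bb n (m + 1)) (by rwa [hts])]
        exact (bb n m).nonneg
    · intro m; rw [hts]
      exact closedBall_subset_ball (by have := rr_le m; linarith)
    · intro m x hx
      refine h1 m x ?_
      have := rr_gt (m + 1)
      simp only [mem_ball_zero_iff, mem_closedBall_zero_iff] at hx ⊢
      linarith
    · intro m hm x
      by_cases hx : x ∈ closedBall (0 : Pt n) (rr (m + 1))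
      · rw [h1 m x hx]; simpa using hgm _ hm x
      · have : fderiv ℝ (bb n (m + 1)) x = 0 := by
          refine image_eq_zero_of_notMem_tsupport (f := fderiv ℝ (bb n (m + 1))) fun h => hx ?_
          rw [← hts]; exact tsupport_fderiv_subset ℝ h
        rw [this]
        have := Finset.sum_nonneg (s := Finset.range (N + 1)) fun i _ => hg0 i
        simp; positivity

lemma int_wt {W : Pt n → ℝ} (hW : Continuous W) {G : Pt n → ℂ} (hG : Tst G) :
    Integrable (fun x => W x * ‖G x‖ ^ 2) :=
  (hW.mul (hG.cont.norm.pow 2)).integrable_of_hasCompactSupport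
    (hG.cpt.mono fun x hx => by
      simp only [Function.mem_support] at hx ⊢; intro h; simp [h] at hx)

lemma fderiv_const_dir {f : Pt n → ℝ} {x w : Pt n} (hf : DifferentiableAt ℝ f x)
    (h : ∀ t : ℝ, f (x + t • w) = f x) : fderiv ℝ f x w = 0 := by
  rw [← hf.lineDeriv_eq_fderiv, lineDeriv]
  simp [h]

/-- one-dimensional weight -/
def ww (θ t : ℝ) : ℝ := (1 + (t / θ) ^ 2)⁻¹

/-- product weight -/
def WW (θ : ℝ) (P : Finset (Fin n)) (x : Pt n) : ℝ := ∏ j ∈ P, ww θ (x j.succ)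

lemma ww_pos (θ t : ℝ) : 0 < ww θ t := by unfold ww; positivity

lemma contDiff_coord (j : Fin (n + 1)) : ContDiff ℝ (⊤ : ℕ∞) (fun x : Pt n => x j) :=
  (EuclideanSpace.proj j : Pt n →L[ℝ] ℝ).contDiff

lemma contDiff_ww (θ : ℝ) (j : Fin (n + 1)) : ContDiff ℝ (⊤ : ℕ∞) (fun x : Pt n => ww θ (x j)) := by
  unfold ww
  refine ContDiff.inv ?_ fun x => by positivity
  exact contDiff_const.add (((contDiff_coord j).div_const _).pow 2)

lemma contDiff_WW (θ : ℝ) (P : Finset (Fin n)) : ContDiff ℝ (⊤ : ℕ∞) (WW θ P) :=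
  contDiff_prod fun j _ => contDiff_ww θ j.succ

lemma WW_nonneg (θ : ℝ) (P : Finset (Fin n)) (x : Pt n) : 0 ≤ WW θ P x :=
  Finset.prod_nonneg fun _ _ => (ww_pos _ _).le

lemma WW_dir (θ : ℝ) (P : Finset (Fin n)) (i : Fin (n + 1)) (h : ∀ j ∈ P, j.succ ≠ i) (x : Pt n) :
    fderiv ℝ (WW θ P) x (ee i) = 0 := by
  refine fderiv_const_dir ((contDiff_WW θ P).differentiable (by simp) x) fun t => ?_
  refine Finset.prod_congr rfl fun j hj => ?_
  simp [ee, h j hj]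

lemma sob_step {θ : ℝ} (hθ : 0 < θ) {j : Fin (n + 1)} {W : Pt n → ℝ} (hW : ContDiff ℝ (⊤ : ℕ∞) W)
    (hW0 : ∀ x, 0 ≤ W x) (hW1 : ∀ x, fderiv ℝ W x (ee j) = 0) {G : Pt n → ℂ} (hG : Tst G) :
    ∫ x, ww θ (x j) * W x * ‖G x‖ ^ 2 ≤
      2 * θ * ((∫ x, W x * ‖G x‖ ^ 2) + ∫ x, W x * ‖pd G j x‖ ^ 2) := by
  set h : Pt n → ℝ := fun x => θ * Real.arctan (x j / θ) with hh
  have hhs : ContDiff ℝ (⊤ : ℕ∞) h :=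
    contDiff_const.mul (Real.contDiff_arctan.comp ((contDiff_coord j).div_const _))
  have hhd : ∀ x, fderiv ℝ h x (ee j) = ww θ (x j) := fun x => by
    have h1 : HasFDerivAt (fun x : Pt n => x j) (EuclideanSpace.proj j : Pt n →L[ℝ] ℝ) x :=
      (EuclideanSpace.proj j : Pt n →L[ℝ] ℝ).hasFDerivAt
    have h2 := (((hasDerivAt_id (x j)).div_const θ).arctan.const_mul θ).comp_hasFDerivAt x h1
    have h3 : h = (fun t => θ * Real.arctan (id t / θ)) ∘ fun x : Pt n => x j := rfl
    rw [h3, h2.fderiv]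
    simp [ww, ee]; field_simp
  have hhb : ∀ x, |h x| ≤ 2 * θ := fun x => by
    rw [hh]; simp only [abs_mul, abs_of_pos hθ]
    have := Real.arctan_lt_pi_div_two (x j / θ)
    have := Real.neg_pi_div_two_lt_arctan (x j / θ)
    have : |Real.arctan (x j / θ)| ≤ 2 := by
      rw [abs_le]; constructor <;> linarith [Real.pi_lt_four]
    nlinarith
  set F : Pt n → ℝ := fun x => h x * (W x * inner ℝ (G x) (G x)) with hF
  have hFc : ContDiff ℝ 1 F := by
    have : ContDiff ℝ (⊤ : ℕ∞) F := hhs.mul (hW.mul (hG.1.inner ℝ hG.1))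
    exact this.of_le (by simp)
  have hFs : HasCompactSupport F := by
    refine hG.cpt.mono fun x hx => ?_
    simp only [Function.mem_support, hF] at hx ⊢
    intro h; simp [h] at hx
  have h0 := int_fderiv_zero hFc hFs (ee j)
  have hd : ∀ x, fderiv ℝ F x (ee j) =
      h x * (W x * (2 * inner ℝ (pd G j x) (G x))) + ww θ (x j) * W x * ‖G x‖ ^ 2 := fun x => by
    have hi : DifferentiableAt ℝ (fun y => (inner ℝ (G y) (G y) : ℝ)) x :=
      (hG.diff x).inner ℝ (hG.diff x)
    have hw : DifferentiableAt ℝ W x := hW.differentiable (by simp) x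
    have hhx : DifferentiableAt ℝ h x := hhs.differentiable (by simp) x
    simp only [hF]
    have hwi : DifferentiableAt ℝ (fun y => W y * (inner ℝ (G y) (G y) : ℝ)) x := hw.mul hi
    rw [fderiv_fun_mul hhx hwi, fderiv_fun_mul hw hi]
    simp only [add_apply, smul_apply, hW1, hhd, smul_eq_mul, mul_zero, add_zero]
    rw [fderiv_inner_apply ℝ (hG.diff x) (hG.diff x), real_inner_self_eq_norm_sq]
    rw [real_inner_comm (fderiv ℝ G x (ee j)) (G x)]
    change _ = h x * (W x * (2 * inner ℝ (fderiv ℝ G x (ee j)) (G x))) + _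
    ring
  have hpt : ∀ x, ww θ (x j) * W x * ‖G x‖ ^ 2 ≤ fderiv ℝ F x (ee j) +
      2 * θ * (W x * ‖G x‖ ^ 2 + W x * ‖pd G j x‖ ^ 2) := fun x => by
    rw [hd]
    have a1 := abs_real_inner_le_norm (pd G j x) (G x)
    have a2 : |h x * (W x * (2 * inner ℝ (pd G j x) (G x)))| ≤
        2 * θ * (W x * (2 * (‖pd G j x‖ * ‖G x‖))) := by
      rw [abs_mul (h x), abs_mul (W x), abs_mul 2 (inner ℝ (pd G j x) (G x)), abs_of_nonneg (hW0 x), abs_two]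
      have := hW0 x
      exact mul_le_mul (hhb x) (by gcongr) (by positivity) (by positivity)
    have a3 := neg_le_of_abs_le a2
    have a4 : 2 * (‖pd G j x‖ * ‖G x‖) ≤ ‖G x‖ ^ 2 + ‖pd G j x‖ ^ 2 := by
      nlinarith [sq_nonneg (‖pd G j x‖ - ‖G x‖)]
    have a5 : 2 * θ * (W x * (2 * (‖pd G j x‖ * ‖G x‖))) ≤
        2 * θ * (W x * (‖G x‖ ^ 2 + ‖pd G j x‖ ^ 2)) := by
      have := hW0 x; gcongr
    linarith
  have i1 := int_wt ((contDiff_ww θ j).continuous.mul hW.continuous) hG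
  have i2 : Integrable (fun x => fderiv ℝ F x (ee j)) :=
    ((hFc.continuous_fderiv (by simp)).clm_apply continuous_const).integrable_of_hasCompactSupport
      (hFs.fderiv_apply ℝ _)
  have i3 := int_wt hW.continuous hG
  have i4 := int_wt hW.continuous (hG.pd j)
  have i34 : Integrable (fun x => W x * ‖G x‖ ^ 2 + W x * ‖pd G j x‖ ^ 2) := i3.add i4
  calc _ ≤ ∫ x, (fderiv ℝ F x (ee j) + 2 * θ * (W x * ‖G x‖ ^ 2 + W x * ‖pd G j x‖ ^ 2)) :=
        integral_mono i1 (i2.add (i34.const_mul _)) hpt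
    _ = _ := by
        rw [integral_add i2 (i34.const_mul _), integral_const_mul, integral_add i3 i4, h0]; ring

lemma Tst.cut {η : Pt n → ℝ} (hη : ContDiff ℝ (⊤ : ℕ∞) η) {V : Pt n → ℂ} (hV : Tst V) :
    Tst (fun x => (η x : ℂ) * V x) := hV.mul (contDiff_ofReal hη).contDiffOn

lemma cut_pd_bound {η : Pt n → ℝ} (hη : ContDiff ℝ (⊤ : ℕ∞) η) {V : Pt n → ℂ} (hV : Tst V)
    (j : Fin (n + 1)) (x : Pt n) :
    ‖pd (fun x => (η x : ℂ) * V x) j x‖ ^ 2 ≤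
      2 * ((∑ i, (fderiv ℝ η x (ee i)) ^ 2) * ‖V x‖ ^ 2 + (η x) ^ 2 * ‖pd V j x‖ ^ 2) := by
  rw [hV.pd_mul (contDiff_ofReal hη).contDiffOn, pd_ofReal hη]
  have h1 : (fderiv ℝ η x (ee j)) ^ 2 ≤ ∑ i, (fderiv ℝ η x (ee i)) ^ 2 :=
    Finset.single_le_sum (f := fun i => (fderiv ℝ η x (ee i)) ^ 2) (fun _ _ => by positivity)
      (Finset.mem_univ j)
  have h2 := norm_add_le (((fderiv ℝ η x (ee j) : ℝ) : ℂ) * V x) ((η x : ℂ) * pd V j x)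
  rw [norm_mul, norm_mul, Complex.norm_real, Complex.norm_real] at h2
  have h3 : (‖fderiv ℝ η x (ee j)‖ * ‖V x‖ + ‖η x‖ * ‖pd V j x‖) ^ 2 ≤
      2 * ((fderiv ℝ η x (ee j)) ^ 2 * ‖V x‖ ^ 2 + (η x) ^ 2 * ‖pd V j x‖ ^ 2) := by
    have e1 : (fderiv ℝ η x (ee j)) ^ 2 = ‖fderiv ℝ η x (ee j)‖ ^ 2 := by simp
    have e2 : (η x) ^ 2 = ‖η x‖ ^ 2 := by simp
    rw [e1, e2]
    nlinarith [sq_nonneg (‖fderiv ℝ η x (ee j)‖ * ‖V x‖ - ‖η x‖ * ‖pd V j x‖)]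
  calc _ ≤ (‖fderiv ℝ η x (ee j)‖ * ‖V x‖ + ‖η x‖ * ‖pd V j x‖) ^ 2 := by gcongr
    _ ≤ _ := h3
    _ ≤ _ := by gcongr

/-- iterated weighted Sobolev inequality -/
lemma sob {N : ℕ} {Gc θ : ℝ} {η : ℕ → Pt n → ℝ} (hη : Cuts N Gc η) (hG1 : 1 ≤ Gc) (hθ : 0 < θ)
    {g : List (Fin n) → Pt n → ℂ} (hg : ∀ l, Tst (g l))
    (hgd : ∀ (l : List (Fin n)) (j : Fin n), pd (g l) j.succ = g (j :: l)) {L m : ℕ} {B : ℝ}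
    (hB : ∀ l : List (Fin n), l.length ≤ L → ∫ x, (η m x) ^ 2 * ‖g l x‖ ^ 2 ≤ B) :
    ∀ (P : Finset (Fin n)) (l : List (Fin n)), l.length + P.card ≤ L → m + P.card ≤ N →
      ∫ x, WW θ P x * ((η (m + P.card) x) ^ 2 * ‖g l x‖ ^ 2) ≤ (10 * Gc * θ) ^ P.card * B := by
  intro P
  induction P using Finset.induction_on with
  | empty =>
    intro l hl _
    simpa [WW] using hB l (by simpa using hl)
  | insert j P hj ih =>
    intro l hl hm
    rw [Finset.card_insert_of_notMem hj] at hl hm ⊢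
    set c := P.card with hc
    have ih1 := ih l (by omega) (by omega)
    have ih2 := ih (j :: l) (by simp; omega) (by omega)
    set M := m + c with hM
    have hT : Tst (fun x => (η (M + 1) x : ℂ) * g l x) := (hg l).cut (hη.smooth _)
    have st := sob_step hθ (j := j.succ) (contDiff_WW θ P) (WW_nonneg θ P)
      (WW_dir θ P j.succ (fun k hk h => hj (by rw [← Fin.succ_injective _ h]; exact hk))) hT
    have e1 : (fun x => WW θ (insert j P) x * ((η (m + (c + 1)) x) ^ 2 * ‖g l x‖ ^ 2)) =
        fun x => ww θ (x j.succ) * WW θ P x * ‖(η (M + 1) x : ℂ) * g l x‖ ^ 2 := by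
      funext x
      rw [WW, Finset.prod_insert hj, norm_mul, Complex.norm_real, mul_pow, Real.norm_eq_abs, sq_abs]
      rfl
    rw [e1]
    have sm := (hη.smooth M).continuous
    have iA : Integrable (fun x => WW θ P x * ((η M x) ^ 2 * ‖g l x‖ ^ 2)) := by
      have := int_wt ((contDiff_WW θ P).continuous.mul (sm.pow 2)) (hg l)
      simpa only [mul_assoc, Pi.mul_apply, Pi.pow_apply] using this
    have iB : Integrable (fun x => WW θ P x * ((η M x) ^ 2 * ‖g (j :: l) x‖ ^ 2)) := by
      have := int_wt ((contDiff_WW θ P).continuous.mul (sm.pow 2)) (hg (j :: l))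
      simpa only [mul_assoc, Pi.mul_apply, Pi.pow_apply] using this
    have an : ∀ x, (η (M + 1) x) ^ 2 ≤ (η M x) ^ 2 := fun x => by
      have := hη.anti M x
      have := hη.nn (M + 1) x
      gcongr
    have t1 : ∫ x, WW θ P x * ‖(η (M + 1) x : ℂ) * g l x‖ ^ 2 ≤ (10 * Gc * θ) ^ c * B := by
      refine le_trans (integral_mono (int_wt (contDiff_WW θ P).continuous hT) iA fun x => ?_) ih1
      have := WW_nonneg θ P x
      have := an x
      simp only [norm_mul, Complex.norm_real, mul_pow, Real.norm_eq_abs, sq_abs]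
      gcongr
    have t2 : ∫ x, WW θ P x * ‖pd (fun x => (η (M + 1) x : ℂ) * g l x) j.succ x‖ ^ 2 ≤
        2 * Gc * ((10 * Gc * θ) ^ c * B) + 2 * ((10 * Gc * θ) ^ c * B) := by
      calc _ ≤ ∫ x, (2 * Gc * (WW θ P x * ((η M x) ^ 2 * ‖g l x‖ ^ 2)) +
            2 * (WW θ P x * ((η M x) ^ 2 * ‖g (j :: l) x‖ ^ 2))) := by
            refine integral_mono (int_wt (contDiff_WW θ P).continuous (hT.pd _))
              ((iA.const_mul _).add (iB.const_mul _)) fun x => ?_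
            have b1 := cut_pd_bound (hη.smooth (M + 1)) (hg l) j.succ x
            rw [hgd] at b1
            have b2 := hη.grad' M (by omega) x
            have b3 := an x
            have b4 := WW_nonneg θ P x
            calc WW θ P x * ‖pd (fun x => (η (M + 1) x : ℂ) * g l x) j.succ x‖ ^ 2
                ≤ WW θ P x * (2 * ((Gc * (η M x) ^ 2) * ‖g l x‖ ^ 2 +
                  (η M x) ^ 2 * ‖g (j :: l) x‖ ^ 2)) := by
                  gcongr
                  refine b1.trans ?_
                  gcongr
              _ = _ := by ring
        _ = 2 * Gc * (∫ x, (WW θ P x * ((η M x) ^ 2 * ‖g l x‖ ^ 2))) +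
            2 * ∫ x, (WW θ P x * ((η M x) ^ 2 * ‖g (j :: l) x‖ ^ 2)) := by
            rw [integral_add (iA.const_mul _) (iB.const_mul _), integral_const_mul, integral_const_mul]
        _ ≤ _ := by gcongr
    have hB0 : 0 ≤ B := le_trans (integral_nonneg fun x => by positivity) (hB [] (by simp))
    have hX : 0 ≤ (10 * Gc * θ) ^ c * B := by positivity
    calc _ ≤ _ := st
      _ ≤ 2 * θ * ((10 * Gc * θ) ^ c * B + (2 * Gc * ((10 * Gc * θ) ^ c * B) + 2 * ((10 * Gc * θ) ^ c * B))) := by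
          gcongr
      _ = (3 + 2 * Gc) * (2 * θ * ((10 * Gc * θ) ^ c * B)) := by ring
      _ ≤ (5 * Gc) * (2 * θ * ((10 * Gc * θ) ^ c * B)) := by
          have : 3 + 2 * Gc ≤ 5 * Gc := by linarith
          gcongr
      _ = _ := by ring

/-! ### Interior-boundary estimate for approximate solutions -/

lemma exists_ker (n : ℕ) {s : ℝ} (hs : 0 < s) : ∃ k : Pt n → ℝ, Ker s k ∧ (∀ x, 0 ≤ k x) ∧
    ∫ y : BPt n, k (iota n y) = 1 := by
  set b : ContDiffBump (0 : Pt n) := ⟨s / 2, s, by linarith, by linarith⟩ with hb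
  have hK : Ker s b := ⟨b.contDiff, by rw [b.tsupport_eq]⟩
  set c := ∫ y : BPt n, b (iota n y) with hc
  have hpos : 0 < c := by
    have hcont : Continuous (fun y : BPt n => b (iota n y)) := b.continuous.comp cont_iota
    refine hcont.integral_pos_of_hasCompactSupport_nonneg_nonzero hK.iota_cpt (fun y => b.nonneg) (x := 0) ?_
    rw [map_zero, b.one_of_mem_closedBall (by simpa using b.rIn_pos.le)]; norm_num
  refine ⟨fun x => c⁻¹ * b x, ⟨contDiff_const.mul b.contDiff, ?_⟩, fun x => ?_, ?_⟩
  · exact (tsupport_mul_subset_right).trans hK.2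
  · have := b.nonneg' x; positivity
  · rw [integral_const_mul, ← hc, inv_mul_cancel₀ hpos.ne']

/-- iterated tangential derivatives of a kernel -/
def kd (k : Pt n → ℝ) : List (Fin n) → Pt n → ℝ
  | [] => k
  | j :: l => fun x => fderiv ℝ (kd k l) x (ee j.succ)

lemma kd_ker {s : ℝ} {k : Pt n → ℝ} (h : Ker s k) (l : List (Fin n)) : Ker s (kd k l) := by
  induction l with
  | nil => exact h
  | cons j l ih => exact ih.dt _

lemma pd_S_kd {s : ℝ} {k : Pt n → ℝ} (h : Ker s k) {v : Pt n → ℂ} (hv : Tst v)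
    (l : List (Fin n)) (j : Fin n) : pd (S (kd k l) v) j.succ = S (kd k (j :: l)) v := by
  rw [S_pd (kd_ker h l) hv, S_pd_tan (kd_ker h l) hv]; rfl

/-- error constants -/
def KK (k : Pt n → ℝ) : ℝ := 2 * kn k ^ 2 + 2 * ((n + 1) ^ 2 * (8 * kn1 k)) ^ 2

/-- accumulated error constants -/
def Dl (C0 G : ℝ) (k : Pt n → ℝ) : List (Fin n) → ℝ
  | [] => C0 * KK (kd k [])
  | j :: l => C0 * KK (kd k (j :: l)) + C0 * G * Dl C0 G k l

lemma KK_nonneg (k : Pt n → ℝ) : 0 ≤ KK k := by unfold KK; positivity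

/-- Caccioppoli constant -/
def CC (lam Lam : ℝ) : ℝ := 2 / lam * (4 / lam + 2 * lam + (2 * Lam) ^ 2 / lam) + 1

lemma energy {N : ℕ} {Gc lam Lam ε ε0 s : ℝ} (hlam : 0 < lam) {η : ℕ → Pt n → ℝ}
    (hη : Cuts N Gc η) (hG1 : 1 ≤ Gc)
    {A : Pt n → Fin (n + 1) → Fin (n + 1) → ℂ} (h : Coef lam Lam A)
    (hs : Sm ε A) (hε : 0 ≤ ε) (hε0 : 0 ≤ ε0) (h00 : ∀ x ∈ upperHalf n, A x 0 0 = 1)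
    {k : Pt n → ℝ} (hk : Ker s k) (hk1 : kn k ≤ 1) (hs8 : s ≤ 1 / 8) {v : Pt n → ℂ} (hv : Tst v)
    (hsol : ∀ ψ, Tst ψ → tsupport ψ ⊆ ball 0 1 → ‖BF A v ψ‖ ≤ ε0 * √(gsq ψ))
    (l : List (Fin n)) (hl : l.length ≤ N) :
    ∫ x, (η l.length x) ^ 2 * ∑ i, ‖pd (S (kd k l) v) i x‖ ^ 2 ≤
      (CC lam Lam * Gc) ^ (l.length + 1) * nsq v +
        Dl (CC lam Lam) Gc k l * (ε0 ^ 2 + ε ^ 2 * gsq v) := by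
  have hC : 0 ≤ 2 / lam * (4 / lam + 2 * lam + (2 * Lam) ^ 2 / lam) := by positivity
  have hCC : 0 ≤ CC lam Lam := by unfold CC; positivity
  have hE : 0 ≤ ε0 ^ 2 + ε ^ 2 * gsq v := by have := gsq_nonneg v; positivity
  -- basic step
  have basic : ∀ (l : List (Fin n)) (m : ℕ),
      ∫ x, (η m x) ^ 2 * ∑ i, ‖pd (S (kd k l) v) i x‖ ^ 2 ≤
      CC lam Lam * (KK (kd k l) * (ε0 ^ 2 + ε ^ 2 * gsq v) +
        ∫ x, (∑ i, (fderiv ℝ (η m) x (ee i)) ^ 2) * ‖S (kd k l) v x‖ ^ 2) := by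
    intro l m
    have hkl := kd_ker hk l
    have hV := S_tst hkl hv
    have hsup : tsupport (cutc (η m) (S (kd k l) v)) ⊆ ball 0 (7 / 8) := by
      refine subset_trans ?_ (hη.supp m)
      refine closure_mono fun x hx => ?_
      simp only [Function.mem_support, cutc] at hx ⊢
      intro h; simp [h] at hx
    have fr := freeze h hs hε hε0 h00 hkl hv (hV.cutc (hη.smooth m)) hsol hsup (by linarith)
    have ca := cacc hlam h.frozen hV (hη.smooth m) (hη.nn m) (hη.le1 m) fr
    refine ca.trans ?_
    have hM : (ε0 * kn (kd k l) + (n + 1) ^ 2 * (8 * ε * kn1 (kd k l)) * √(gsq v)) ^ 2 ≤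
        KK (kd k l) * (ε0 ^ 2 + ε ^ 2 * gsq v) := by
      have hsq : √(gsq v) ^ 2 = gsq v := Real.sq_sqrt (gsq_nonneg v)
      have g0 := gsq_nonneg v
      set a := kn (kd k l)
      set b := (n + 1 : ℝ) ^ 2 * (8 * kn1 (kd k l))
      have : (ε0 * a + (n + 1) ^ 2 * (8 * ε * kn1 (kd k l)) * √(gsq v)) =
        a * ε0 + b * (ε * √(gsq v)) := by simp only [b]; ring
      rw [this]
      unfold KK
      have h1 : (a * ε0 + b * (ε * √(gsq v))) ^ 2 ≤ 2 * (a ^ 2 * ε0 ^ 2) + 2 * (b ^ 2 * (ε ^ 2 * gsq v)) := by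
        have e : (b * (ε * √(gsq v))) ^ 2 = b ^ 2 * (ε ^ 2 * gsq v) := by
          rw [mul_pow b, mul_pow ε, hsq]
        nlinarith [sq_nonneg (a * ε0 - b * (ε * √(gsq v)))]
      have h2 : 0 ≤ a ^ 2 * (ε ^ 2 * gsq v) := by positivity
      have h3 : 0 ≤ b ^ 2 * ε0 ^ 2 := by positivity
      calc _ ≤ _ := h1
        _ ≤ (2 * a ^ 2 + 2 * b ^ 2) * (ε0 ^ 2 + ε ^ 2 * gsq v) := by nlinarith
    have hI : 0 ≤ ∫ x, (∑ i, (fderiv ℝ (η m) x (ee i)) ^ 2) * ‖S (kd k l) v x‖ ^ 2 :=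
      integral_nonneg fun x => mul_nonneg (Finset.sum_nonneg fun _ _ => by positivity) (by positivity)
    have hK := KK_nonneg (kd k l)
    have h1 : 2 / lam * (4 / lam + 2 * lam + (2 * Lam) ^ 2 / lam) ≤ CC lam Lam := by
      unfold CC; linarith
    gcongr
  have gcont : ∀ m, Continuous fun x => ∑ i, (fderiv ℝ (η m) x (ee i)) ^ 2 := fun m =>
    continuous_finsetSum _ fun i _ =>
      (((hη.smooth m).continuous_fderiv (by simp)).clm_apply continuous_const).pow 2
  induction l with
  | nil =>
    refine (basic [] 0).trans ?_
    have hV := S_tst (kd_ker hk []) hv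
    have : ∫ x, (∑ i, (fderiv ℝ (η 0) x (ee i)) ^ 2) * ‖S (kd k []) v x‖ ^ 2 ≤ Gc * nsq v := by
      calc _ ≤ ∫ x, Gc * ‖S (kd k []) v x‖ ^ 2 := by
            refine integral_mono (int_wt (gcont 0) hV) (hV.int_sq.const_mul _) fun x => ?_
            have := hη.grad 0 (by omega) x
            dsimp only; gcongr
        _ = Gc * nsq (S k v) := integral_const_mul _ _
        _ ≤ Gc * nsq v := by
            have := S_nsq hk hv
            have h2 := nsq_nonneg v
            have h3 : kn k ^ 2 ≤ 1 := pow_le_one₀ (kn_nonneg k) hk1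
            gcongr
            nlinarith
    calc _ ≤ CC lam Lam * (KK (kd k []) * (ε0 ^ 2 + ε ^ 2 * gsq v) + Gc * nsq v) := by gcongr
      _ = _ := by simp [Dl]; ring
  | cons j l ih =>
    have ih := ih (by simp at hl; omega)
    refine (basic (j :: l) (l.length + 1)).trans ?_
    have hV := S_tst (kd_ker hk l) hv
    have : ∫ x, (∑ i, (fderiv ℝ (η (l.length + 1)) x (ee i)) ^ 2) * ‖S (kd k (j :: l)) v x‖ ^ 2 ≤
        Gc * ∫ x, (η l.length x) ^ 2 * ∑ i, ‖pd (S (kd k l) v) i x‖ ^ 2 := by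
      rw [← integral_const_mul, ← pd_S_kd hk hv]
      refine integral_mono (int_wt (gcont _) (hV.pd _)) (Integrable.const_mul ?_ _) fun x => ?_
      · have : Integrable (fun x => ∑ i, (η l.length x) ^ 2 * ‖pd (S (kd k l) v) i x‖ ^ 2) :=
          integrable_finsetSum _ fun i _ => int_wt ((hη.smooth _).continuous.pow 2) (hV.pd i)
        simpa only [Finset.mul_sum] using this
      · have h1 := hη.grad' l.length (by simpa using hl) x
        have h2 : ‖pd (S (kd k l) v) j.succ x‖ ^ 2 ≤ ∑ i, ‖pd (S (kd k l) v) i x‖ ^ 2 :=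
          Finset.single_le_sum (f := fun i => ‖pd (S (kd k l) v) i x‖ ^ 2) (fun _ _ => by positivity)
            (Finset.mem_univ j.succ)
        calc _ ≤ (Gc * (η l.length x) ^ 2) * ∑ i, ‖pd (S (kd k l) v) i x‖ ^ 2 := by
              gcongr
          _ = _ := by ring
    calc _ ≤ CC lam Lam * (KK (kd k (j :: l)) * (ε0 ^ 2 + ε ^ 2 * gsq v) +
          Gc * ((CC lam Lam * Gc) ^ (l.length + 1) * nsq v +
        Dl (CC lam Lam) Gc k l * (ε0 ^ 2 + ε ^ 2 * gsq v))) := by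
          refine mul_le_mul_of_nonneg_left ?_ hCC
          have := mul_le_mul_of_nonneg_left ih (zero_le_one.trans hG1)
          linarith
      _ = _ := by simp only [Dl, List.length_cons]; ring

lemma WW_lower {θ : ℝ} (hθ : 0 < θ) {x : Pt n} (hx : ‖x‖ < θ) :
    (1 / 2) ^ n ≤ WW θ Finset.univ x := by
  have : ∀ j : Fin n, (1 / 2 : ℝ) ≤ ww θ (x j.succ) := fun j => by
    have h1 : |x j.succ| ≤ ‖x‖ := by
      have := PiLp.norm_apply_le x j.succ
      simpa using this
    have h2 : (x j.succ / θ) ^ 2 ≤ 1 := by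
      rw [div_pow, div_le_one (by positivity), ← sq_abs]
      have := abs_nonneg (x j.succ)
      gcongr; linarith
    unfold ww
    rw [one_div]
    exact inv_anti₀ (by positivity) (by linarith)
  calc (1 / 2 : ℝ) ^ n = ∏ _j : Fin n, (1 / 2 : ℝ) := by simp
    _ ≤ _ := Finset.prod_le_prod (fun _ _ => by norm_num) fun j _ => this j

set_option maxHeartbeats 1000000 in
lemma main_tst (n : ℕ) {lam Lam : ℝ} (hlam : 0 < lam) :
    ∃ C, 0 < C ∧ ∀ s : ℝ, 0 < s → s ≤ 1 / 8 → ∃ Cs, 0 < Cs ∧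
    ∀ (A : Pt n → Fin (n + 1) → Fin (n + 1) → ℂ) (ε ε0 : ℝ), Coef lam Lam A → Sm ε A → 0 ≤ ε → 0 ≤ ε0 →
    (∀ x ∈ upperHalf n, A x 0 0 = 1) → ∀ v : Pt n → ℂ, Tst v →
    (∀ ψ, Tst ψ → tsupport ψ ⊆ ball 0 1 → ‖BF A v ψ‖ ≤ ε0 * √(gsq ψ)) →
    ∀ θ : ℝ, 0 < θ → θ ≤ 1 / 2 →
    ∫ x in ball (0 : Pt n) θ, ‖v x‖ ^ 2 ≤
      C * θ ^ (n + 2) * nsq v + Cs * (ε ^ 2 * gsq v + ε0 ^ 2) + 2 * s ^ 2 * gsq v := by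
  obtain ⟨Gc, η, hG1, hη⟩ := exists_cuts n (3 * n + 5)
  have hG0 : 0 < Gc := by linarith
  have hCC1 : 1 ≤ CC lam Lam := by
    unfold CC
    have : 0 ≤ 2 / lam * (4 / lam + 2 * lam + (2 * Lam) ^ 2 / lam) := by positivity
    linarith
  have hCC0 : 0 < CC lam Lam := by linarith
  set C1 := (CC lam Lam * Gc) ^ (n + 1) with hC1
  have hCG1 : 1 ≤ CC lam Lam * Gc := by nlinarith
  have hC11 : 1 ≤ C1 := one_le_pow₀ hCG1
  set F := 2 ^ n * (8 * (Gc + 1) * (10 * Gc) ^ n) with hF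
  have hF0 : 0 < F := by positivity
  refine ⟨2 * F * C1, by positivity, fun s hs hs8 => ?_⟩
  obtain ⟨k, hk, hk0, hk1⟩ := exists_ker n hs
  have hkn : kn k = 1 := by
    rw [← hk1]; unfold kn; congr 1; funext y; exact abs_of_nonneg (hk0 _)
  obtain ⟨D0, hD0⟩ := ((List.finite_length_le (Fin n) n).image (Dl (CC lam Lam) Gc k)).bddAbove
  have hD : ∀ l : List (Fin n), l.length ≤ n → Dl (CC lam Lam) Gc k l ≤ max D0 1 := fun l hl =>
    (hD0 ⟨l, hl, rfl⟩).trans (le_max_left _ _)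
  set D := max D0 1 with hDdef
  have hDp : 0 < D := lt_of_lt_of_le one_pos (le_max_right _ _)
  refine ⟨2 * F * D, by positivity, fun A ε ε0 hA hsm hε hε0 h00 v hv hsol θ hθ hθ2 => ?_⟩
  set E := ε0 ^ 2 + ε ^ 2 * gsq v with hE
  have hE0 : 0 ≤ E := by have := gsq_nonneg v; positivity
  have hnv := nsq_nonneg v
  set B := C1 * nsq v + D * E with hB
  have en : ∀ l : List (Fin n), l.length ≤ n →
      ∫ x, (η l.length x) ^ 2 * ∑ i, ‖pd (S (kd k l) v) i x‖ ^ 2 ≤ B := fun l hl => by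
    refine (energy hlam hη hG1 hA hsm hε hε0 h00 hk hkn.le hs8 hv hsol l (by omega)).trans ?_
    have h1 : (CC lam Lam * Gc) ^ (l.length + 1) ≤ C1 := pow_le_pow_right₀ hCG1 (by omega)
    have h2 := hD l hl
    rw [hB]; gcongr
  have anti : ∀ m m', m ≤ m' → ∀ x, (η m' x) ^ 2 ≤ (η m x) ^ 2 := fun m m' hm x => by
    have : η m' x ≤ η m x := by
      induction m', hm using Nat.le_induction with
      | base => rfl
      | succ m' _ ih => exact (hη.anti m' x).trans ih
    have := hη.nn m' x
    gcongr
  have hV : ∀ l, Tst (S (kd k l) v) := fun l => S_tst (kd_ker hk l) hv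
  have enl : ∀ l : List (Fin n), l.length ≤ n → ∀ i, ∀ m, l.length ≤ m →
      ∫ x, (η m x) ^ 2 * ‖pd (S (kd k l) v) i x‖ ^ 2 ≤ B := fun l hl i m hm => by
    refine le_trans (integral_mono (int_wt ((hη.smooth _).continuous.pow 2) ((hV l).pd i)) ?_ fun x => ?_) (en l hl)
    · have : Integrable (fun x => ∑ i, (η l.length x) ^ 2 * ‖pd (S (kd k l) v) i x‖ ^ 2) :=
        integrable_finsetSum _ fun i _ => int_wt ((hη.smooth _).continuous.pow 2) ((hV l).pd i)
      simpa only [Finset.mul_sum] using this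
    · have h1 := anti _ _ hm x
      have h2 : ‖pd (S (kd k l) v) i x‖ ^ 2 ≤ ∑ i, ‖pd (S (kd k l) v) i x‖ ^ 2 :=
        Finset.single_le_sum (f := fun i => ‖pd (S (kd k l) v) i x‖ ^ 2) (fun _ _ => by positivity)
          (Finset.mem_univ i)
      have h3 : (η m ^ 2) x = (η m x) ^ 2 := rfl
      dsimp only
      gcongr
  -- the two families
  have fam1 := sob hη hG1 hθ (g := fun l => S (kd k l) v) hV (fun l j => pd_S_kd hk hv l j)
    (L := n) (m := n) (B := B) (fun l hl => by
      cases l with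
      | nil =>
        have : ∫ x, (η n x) ^ 2 * ‖S (kd k []) v x‖ ^ 2 ≤ nsq (S k v) := by
          refine integral_mono (int_wt ((hη.smooth _).continuous.pow 2) (hV [])) (hV []).int_sq fun x => ?_
          have h1 : (η n x) ^ 2 ≤ 1 := pow_le_one₀ (hη.nn n x) (hη.le1 n x)
          have h2 : 0 ≤ ‖S (kd k []) v x‖ ^ 2 := by positivity
          change (η n x) ^ 2 * ‖S (kd k []) v x‖ ^ 2 ≤ ‖S (kd k []) v x‖ ^ 2
          nlinarith
        refine this.trans ((S_nsq hk hv).trans ?_)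
        rw [hkn, hB]
        have : 0 ≤ D * E := by positivity
        nlinarith
      | cons j l =>
        simp only [List.length_cons] at hl
        have := enl l (by omega) j.succ n (by omega)
        rwa [pd_S_kd hk hv] at this)
    Finset.univ [] (by simp) (by simp; omega)
  have fam2 := sob hη hG1 hθ (g := fun l => pd (S (kd k l) v) 0) (fun l => (hV l).pd 0)
    (fun l j => by rw [pd_comm (hV l), pd_S_kd hk hv])
    (L := n) (m := n) (B := B) (fun l hl => enl l hl 0 n hl)
    Finset.univ [] (by simp) (by simp; omega)
  simp only [Finset.card_univ, Fintype.card_fin] at fam1 fam2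
  set V := S k v with hVd
  have hVT : Tst V := hV []
  change ∫ x, WW θ Finset.univ x * ((η (n + n) x) ^ 2 * ‖V x‖ ^ 2) ≤ _ at fam1
  change ∫ x, WW θ Finset.univ x * ((η (n + n) x) ^ 2 * ‖pd V 0 x‖ ^ 2) ≤ _ at fam2
  set X := (10 * Gc * θ) ^ n * B with hX
  have hcutT : Tst (fun x => (η (n + n + 1) x : ℂ) * V x) := hVT.cut (hη.smooth _)
  have hWc : Continuous (WW θ (Finset.univ : Finset (Fin n))) := (contDiff_WW θ _).continuous
  have hd := hardy hcutT (contDiff_WW θ Finset.univ) (WW_nonneg θ Finset.univ)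
    (WW_dir θ Finset.univ 0 (fun j _ => Fin.succ_ne_zero j))
  have sm := ((hη.smooth (n + n)).continuous)
  have iA : Integrable (fun x => WW θ Finset.univ x * ((η (n + n) x) ^ 2 * ‖V x‖ ^ 2)) := by
    have := int_wt (hWc.mul (sm.pow 2)) hVT
    simpa only [mul_assoc, Pi.mul_apply, Pi.pow_apply] using this
  have iB : Integrable (fun x => WW θ Finset.univ x * ((η (n + n) x) ^ 2 * ‖pd V 0 x‖ ^ 2)) := by
    have := int_wt (hWc.mul (sm.pow 2)) (hVT.pd 0)
    simpa only [mul_assoc, Pi.mul_apply, Pi.pow_apply] using this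
  have hd2 : ∫ x, WW θ Finset.univ x * ‖pd (fun x => (η (n + n + 1) x : ℂ) * V x) 0 x‖ ^ 2 ≤
      2 * (Gc + 1) * X := by
    calc _ ≤ ∫ x, (2 * Gc * (WW θ Finset.univ x * ((η (n + n) x) ^ 2 * ‖V x‖ ^ 2)) +
          2 * (WW θ Finset.univ x * ((η (n + n) x) ^ 2 * ‖pd V 0 x‖ ^ 2))) := by
          refine integral_mono (int_wt hWc (hcutT.pd _))
            ((iA.const_mul _).add (iB.const_mul _)) fun x => ?_
          have b1 := cut_pd_bound (hη.smooth (n + n + 1)) hVT 0 x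
          have b2 := hη.grad' (n + n) (by omega) x
          have b3 := anti (n + n) (n + n + 1) (by omega) x
          have b4 := WW_nonneg θ Finset.univ x
          calc WW θ Finset.univ x * ‖pd (fun x => (η (n + n + 1) x : ℂ) * V x) 0 x‖ ^ 2
              ≤ WW θ Finset.univ x * (2 * ((Gc * (η (n + n) x) ^ 2) * ‖V x‖ ^ 2 +
                (η (n + n) x) ^ 2 * ‖pd V 0 x‖ ^ 2)) := by
                gcongr
                refine b1.trans ?_
                gcongr
            _ = _ := by ring
      _ = 2 * Gc * (∫ x, WW θ Finset.univ x * ((η (n + n) x) ^ 2 * ‖V x‖ ^ 2)) +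
          2 * ∫ x, WW θ Finset.univ x * ((η (n + n) x) ^ 2 * ‖pd V 0 x‖ ^ 2) := by
          rw [integral_add (iA.const_mul _) (iB.const_mul _), integral_const_mul, integral_const_mul]
      _ ≤ 2 * Gc * X + 2 * X := by gcongr
      _ = _ := by ring
  have hloc : ∫ x in ball (0 : Pt n) θ, ‖V x‖ ^ 2 ≤ 2 ^ n * θ ^ 2 * (4 * (2 * (Gc + 1) * X)) := by
    have hiH := int_wt hWc hcutT.hd
    calc _ ≤ ∫ x in ball (0 : Pt n) θ, 2 ^ n * θ ^ 2 *
          (WW θ Finset.univ x * ‖((dd x : ℂ))⁻¹ * ((η (n + n + 1) x : ℂ) * V x)‖ ^ 2) := by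
          refine setIntegral_mono_on hVT.int_sq.integrableOn (hiH.const_mul _).integrableOn
            measurableSet_ball fun x hx => ?_
          have hx' : ‖x‖ < θ := by simpa using hx
          rw [hη.one _ x (ball_subset_ball hθ2 hx)]
          by_cases hu : x ∈ upperHalf n
          · have hd0 : 0 < dd x := hu
            have hdθ : dd x ≤ θ := (dd_le_norm x).trans hx'.le
            have hw := WW_lower hθ hx'
            have e : ‖((dd x : ℂ))⁻¹ * ((1 : ℝ) * V x)‖ ^ 2 = ‖V x‖ ^ 2 / (dd x) ^ 2 := by
              rw [norm_mul, norm_mul, norm_inv, Complex.norm_real, Complex.norm_real]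
              simp only [Real.norm_of_nonneg hd0.le, norm_one, one_mul]
              field_simp
            rw [e]
            have h1 : ‖V x‖ ^ 2 ≤ θ ^ 2 * (‖V x‖ ^ 2 / (dd x) ^ 2) := by
              rw [← mul_div_assoc, le_div_iff₀ (by positivity), mul_comm]
              gcongr
            have h2 : (1 : ℝ) ≤ 2 ^ n * WW θ Finset.univ x := by
              calc (1 : ℝ) = 2 ^ n * (1 / 2) ^ n := by rw [← mul_pow]; norm_num
                _ ≤ _ := by gcongr
            have h3 : 0 ≤ θ ^ 2 * (‖V x‖ ^ 2 / (dd x) ^ 2) := by positivity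
            nlinarith
          · rw [hVT.zero_of_notMem hu]; simp
      _ = 2 ^ n * θ ^ 2 * ∫ x in ball (0 : Pt n) θ,
          (WW θ Finset.univ x * ‖((dd x : ℂ))⁻¹ * ((η (n + n + 1) x : ℂ) * V x)‖ ^ 2) :=
          integral_const_mul _ _
      _ ≤ 2 ^ n * θ ^ 2 * ∫ x, (WW θ Finset.univ x *
          ‖((dd x : ℂ))⁻¹ * ((η (n + n + 1) x : ℂ) * V x)‖ ^ 2) := by
          refine mul_le_mul_of_nonneg_left (setIntegral_le_integral hiH ?_) (by positivity)
          exact Filter.Eventually.of_forall fun x => mul_nonneg (WW_nonneg _ _ x) (by positivity)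
      _ ≤ 2 ^ n * θ ^ 2 * (4 * (2 * (Gc + 1) * X)) := by
          gcongr
          exact hd.trans (by gcongr)
  have hX2 : 2 ^ n * θ ^ 2 * (4 * (2 * (Gc + 1) * X)) = F * θ ^ (n + 2) * B := by
    rw [hX, hF]; ring
  rw [hX2] at hloc
  have hsub := S_sub hk hk0 hk1 hv
  have hdT : Tst (fun x => S k v x - v x) := hVT.sub hv
  have hfin : ∫ x in ball (0 : Pt n) θ, ‖v x‖ ^ 2 ≤
      2 * (∫ x in ball (0 : Pt n) θ, ‖V x‖ ^ 2) + 2 * nsq (fun x => S k v x - v x) := by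
    calc _ ≤ ∫ x in ball (0 : Pt n) θ, (2 * ‖V x‖ ^ 2 + 2 * ‖S k v x - v x‖ ^ 2) := by
          refine integral_mono hv.int_sq.integrableOn
            ((hVT.int_sq.const_mul _).add (hdT.int_sq.const_mul _)).integrableOn fun x => ?_
          have h1 : ‖v x‖ ≤ ‖V x‖ + ‖S k v x - v x‖ := by
            calc ‖v x‖ = ‖V x - (S k v x - v x)‖ := by rw [hVd, sub_sub_cancel]
              _ ≤ _ := norm_sub_le _ _
          dsimp only
          have h0 := norm_nonneg (v x)
          nlinarith [sq_nonneg (‖V x‖ - ‖S k v x - v x‖)]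
      _ = 2 * (∫ x in ball (0 : Pt n) θ, ‖V x‖ ^ 2) +
          2 * ∫ x in ball (0 : Pt n) θ, ‖S k v x - v x‖ ^ 2 := by
          rw [integral_add (hVT.int_sq.const_mul _).integrableOn (hdT.int_sq.const_mul _).integrableOn,
            integral_const_mul, integral_const_mul]
      _ ≤ _ := by
          unfold nsq
          gcongr 2 * (∫ x in ball (0 : Pt n) θ, ‖V x‖ ^ 2) + 2 * ?_
          exact setIntegral_le_integral hdT.int_sq (Filter.Eventually.of_forall fun x => by positivity)
  have hpow : θ ^ (n + 2) ≤ 1 := pow_le_one₀ hθ.le (by linarith)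
  have hDE : F * θ ^ (n + 2) * (D * E) ≤ F * 1 * (D * E) := by
    have : 0 ≤ D * E := by positivity
    gcongr
  have hBe : F * θ ^ (n + 2) * B = F * θ ^ (n + 2) * (C1 * nsq v) + F * θ ^ (n + 2) * (D * E) := by
    rw [hB]; ring
  calc _ ≤ _ := hfin
    _ ≤ 2 * (F * θ ^ (n + 2) * (C1 * nsq v) + F * 1 * (D * E)) + 2 * (s ^ 2 * gsq v) := by linarith
    _ = _ := by rw [hE]; ring

/-! ### Vertical slices -/

lemma mp_pt (n : ℕ) : MeasurePreserving (fun p : ℝ × BPt n => pt p.1 p.2)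
    (volume.prod volume) volume := by
  have h1 : MeasurePreserving (fun p : ℝ × BPt n => (p.1, (WithLp.ofLp p.2 : Fin n → ℝ)))
      (volume.prod volume) (volume.prod volume) :=
    (MeasurePreserving.id volume).prod (PiLp.volume_preserving_ofLp (Fin n))
  have h2 := (volume_preserving_piFinSuccAbove (fun _ : Fin (n + 1) => ℝ) 0).symm
  have h3 := (PiLp.volume_preserving_toLp (Fin (n + 1)))
  have := h3.comp (h2.comp h1)
  convert! this using 1
  funext p
  ext i
  refine Fin.cases ?_ (fun j => ?_) i
  · simp [pt_zero, MeasurableEquiv.piFinSuccAbove, Fin.insertNthEquiv]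
  · simp [pt_succ, MeasurableEquiv.piFinSuccAbove, Fin.insertNthEquiv]

lemma pt_eta (x : Pt n) : pt (dd x) (bdry x) = x := by
  ext i
  refine Fin.cases ?_ (fun j => ?_) i
  · rw [pt_zero]; rfl
  · rw [pt_succ]; rfl

lemma measurable_dd : Measurable (dd : Pt n → ℝ) := contDiff_dd.continuous.measurable

lemma continuous_bdry : Continuous (bdry : Pt n → BPt n) := by
  unfold bdry; fun_prop

lemma measurable_bdry : Measurable (bdry : Pt n → BPt n) := continuous_bdry.measurable

lemma continuous_pt : Continuous (fun p : ℝ × BPt n => pt p.1 p.2) := by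
  have : (fun p : ℝ × BPt n => pt p.1 p.2) = fun p => p.1 • (ee 0 : Pt n) + iota n p.2 := by
    funext p; ext i
    refine Fin.cases ?_ (fun j => ?_) i
    · simp [pt_zero, iota_apply]
    · simp [pt_succ, iota_apply]
  rw [this]
  exact (continuous_fst.smul continuous_const).add (cont_iota.comp continuous_snd)

lemma lint_pt {F : Pt n → ℝ≥0∞} (hF : Measurable F) :
    ∫⁻ x, F x = ∫⁻ x' : BPt n, ∫⁻ t : ℝ, F (pt t x') := by
  rw [← (mp_pt n).lintegral_comp hF, lintegral_prod_symm]
  exact (hF.comp continuous_pt.measurable).aemeasurable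

lemma slice {g : ℝ → ℂ} (hd : ∀ t, 0 < t → DifferentiableAt ℝ g t)
    (h0 : Tendsto g (𝓝[>] 0) (𝓝 0)) {t T : ℝ} (ht : 0 < t) (hT : t < T) :
    ‖g t‖ₑ ^ 2 ≤ ENNReal.ofReal T * ∫⁻ s in Ioo 0 T, ‖deriv g s‖ₑ ^ 2 := by
  have hT0 : 0 < T := ht.trans hT
  by_cases hfin : ∫⁻ s in Ioo 0 T, ‖deriv g s‖ₑ ^ 2 = ∞
  · rw [hfin, ENNReal.mul_top (by simpa using hT0)]; exact le_top
  have hcs : (∫⁻ s in Ioo 0 T, ‖deriv g s‖ₑ) ^ 2 ≤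
      ENNReal.ofReal T * ∫⁻ s in Ioo 0 T, ‖deriv g s‖ₑ ^ 2 := by
    have := jensen2 (volume.restrict (Ioo 0 T)) (k := fun _ => 1) (g := fun s => ‖deriv g s‖ₑ)
      aemeasurable_const (measurable_deriv g).enorm.aemeasurable
    simpa using this
  refine le_trans ?_ hcs
  have hfin1 : ∫⁻ s in Ioo 0 T, ‖deriv g s‖ₑ ≠ ∞ := by
    intro h
    rw [h] at hcs
    have : ENNReal.ofReal T * ∫⁻ s in Ioo 0 T, ‖deriv g s‖ₑ ^ 2 < ∞ :=
      ENNReal.mul_lt_top ENNReal.ofReal_lt_top (lt_top_iff_ne_top.2 hfin)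
    simp at hcs
    exact this.ne hcs
  have hintg : IntegrableOn (deriv g) (Ioo 0 T) :=
    ⟨(measurable_deriv g).aestronglyMeasurable, lt_top_iff_ne_top.2 hfin1⟩
  have key : ∀ r, 0 < r → r < t → ‖g t - g r‖ₑ ≤ ∫⁻ s in Ioo 0 T, ‖deriv g s‖ₑ := by
    intro r hr hrt
    have hsub : Ioc r t ⊆ Ioo 0 T := fun s hs => ⟨hr.trans hs.1, hs.2.trans_lt hT⟩
    have e : ∫ s in r..t, deriv g s = g t - g r := by
      refine intervalIntegral.integral_eq_sub_of_hasDerivAt (fun s hs => ?_) ?_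
      · rw [uIcc_of_le hrt.le] at hs
        exact (hd s (hr.trans_le hs.1)).hasDerivAt
      · rw [intervalIntegrable_iff_integrableOn_Ioc_of_le hrt.le]
        exact hintg.mono_set hsub
    rw [← e, intervalIntegral.integral_of_le hrt.le]
    exact (enorm_integral_le_lintegral_enorm _).trans (lintegral_mono_set hsub)
  have lim : Tendsto (fun r => ‖g t - g r‖ₑ) (𝓝[>] 0) (𝓝 ‖g t - 0‖ₑ) :=
    (tendsto_const_nhds.sub h0).enorm
  rw [sub_zero] at lim
  have : ‖g t‖ₑ ≤ ∫⁻ s in Ioo 0 T, ‖deriv g s‖ₑ :=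
    le_of_tendsto lim (by
      filter_upwards [Ioo_mem_nhdsGT ht] with r hr using key r hr.1 hr.2)
  gcongr

lemma hasDerivAt_pt (t : ℝ) (x' : BPt n) : HasDerivAt (fun t : ℝ => pt t x') (ee 0 : Pt n) t := by
  have : (fun t : ℝ => pt t x') = fun t => t • (ee 0 : Pt n) + iota n x' := by
    funext p; ext i
    refine Fin.cases ?_ (fun j => ?_) i
    · simp [pt_zero, iota_apply]
    · simp [pt_succ, iota_apply]
  rw [this]
  simpa using ((hasDerivAt_id t).smul_const (ee 0 : Pt n)).add_const (iota n x')

lemma measurable_pd (u : Pt n → ℂ) (i : Fin (n + 1)) : Measurable (pd u i) :=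
  measurable_fderiv_apply_const ℝ u _

lemma measurable_ind {g : Pt n → ℂ} (hg : ∀ x ∈ upperHalf n, DifferentiableAt ℝ g x) :
    Measurable ((upperHalf n).indicator g) := by
  have hc : ContinuousOn g (upperHalf n) := fun x hx => (hg x hx).continuousAt.continuousWithinAt
  classical
  rw [← Set.piecewise_eq_indicator]
  exact hc.measurable_piecewise continuousOn_const isOpen_upperHalf.measurableSet

/-- the strip of height `T` over `X` -/
def strp (T : ℝ) (X : Set (BPt n)) : Set (Pt n) := {x | 0 < dd x ∧ dd x < T ∧ bdry x ∈ X}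

lemma meas_strp (T : ℝ) {X : Set (BPt n)} (hX : MeasurableSet X) : MeasurableSet (strp T X) :=
  (measurable_dd measurableSet_Ioi).inter ((measurable_dd measurableSet_Iio).inter (measurable_bdry hX))

lemma lint_strp {T : ℝ} {X : Set (BPt n)} (hX : MeasurableSet X) {F : Pt n → ℝ≥0∞}
    (hF : Measurable F) :
    ∫⁻ x in strp T X, F x = ∫⁻ x' in X, ∫⁻ t in Ioo 0 T, F (pt t x') := by
  rw [← lintegral_indicator (meas_strp T hX), lint_pt (hF.indicator (meas_strp T hX)),
    ← lintegral_indicator hX]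
  congr 1; funext x'
  by_cases h : x' ∈ X
  · rw [indicator_of_mem h, ← lintegral_indicator measurableSet_Ioo]
    congr 1; funext t
    by_cases ht : t ∈ Ioo 0 T
    · rw [indicator_of_mem ht, indicator_of_mem]
      simpa [strp, dd_pt, bdry_pt, h] using ht
    · rw [indicator_of_notMem ht, indicator_of_notMem]
      simpa [strp, dd_pt, bdry_pt, h] using ht
  · rw [indicator_of_notMem h]
    simp [strp, dd_pt, bdry_pt, h, indicator]

lemma strip {g : Pt n → ℂ} (hg : ∀ x ∈ upperHalf n, DifferentiableAt ℝ g x) {X : Set (BPt n)}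
    (hX : MeasurableSet X)
    (h0 : ∀ᵐ x' : BPt n, x' ∈ X → Tendsto (fun t : ℝ => g (pt t x')) (𝓝[>] 0) (𝓝 0)) (T : ℝ) :
    ∫⁻ x in strp T X, ‖g x‖ₑ ^ 2 ≤ ENNReal.ofReal T ^ 2 * ∫⁻ x in strp T X, ‖pd g 0 x‖ₑ ^ 2 := by
  have e : ∫⁻ x in strp T X, ‖g x‖ₑ ^ 2 = ∫⁻ x in strp T X, ‖(upperHalf n).indicator g x‖ₑ ^ 2 :=
    setLIntegral_congr_fun (meas_strp T hX) fun x hx => by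
      rw [indicator_of_mem (show x ∈ upperHalf n from hx.1)]
  rw [e, lint_strp hX ((measurable_ind hg).enorm.pow_const 2),
    lint_strp hX ((measurable_pd g 0).enorm.pow_const 2)]
  rw [← lintegral_const_mul']
  swap
  · simp
  refine lintegral_mono_ae ?_
  rw [ae_restrict_iff' hX]
  filter_upwards [h0] with x' h0 hx'
  specialize h0 hx'
  have hd : ∀ t, 0 < t → HasDerivAt (fun t : ℝ => g (pt t x')) (pd g 0 (pt t x')) t := fun t ht =>
    (hg _ (by simpa [upperHalf, dd_pt] using ht)).hasFDerivAt.comp_hasDerivAt t (hasDerivAt_pt t x')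
  have hs : ∀ t ∈ Ioo 0 T, ‖(upperHalf n).indicator g (pt t x')‖ₑ ^ 2 ≤
      ENNReal.ofReal T * ∫⁻ s in Ioo 0 T, ‖pd g 0 (pt s x')‖ₑ ^ 2 := fun t ht => by
    rw [indicator_of_mem (by simpa [upperHalf, dd_pt] using ht.1)]
    refine (slice (g := fun t : ℝ => g (pt t x')) (fun t ht => (hd t ht).differentiableAt) h0 ht.1 ht.2).trans ?_
    gcongr 1
    refine (setLIntegral_congr_fun measurableSet_Ioo fun s hs => ?_).le
    rw [(hd s hs.1).deriv]
  calc _ ≤ ∫⁻ t in Ioo 0 T, ENNReal.ofReal T * ∫⁻ s in Ioo 0 T, ‖pd g 0 (pt s x')‖ₑ ^ 2 :=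
        setLIntegral_mono' measurableSet_Ioo hs
    _ = _ := by
        rw [setLIntegral_const, Real.volume_Ioo, sub_zero]; ring

/-! ### Mollification -/

/-- mollification -/
def Mo (φ : ContDiffBump (0 : Pt n)) (g : Pt n → ℂ) : Pt n → ℂ :=
  convolution (φ.normed volume) g (ContinuousLinearMap.lsmul ℝ ℝ) volume

lemma Mo_def (φ : ContDiffBump (0 : Pt n)) (g : Pt n → ℂ) (x : Pt n) :
    Mo φ g x = ∫ y, φ.normed volume y • g (x - y) := rfl

lemma Mo_exists (φ : ContDiffBump (0 : Pt n)) {g : Pt n → ℂ} (hg : LocallyIntegrable g) (x : Pt n) :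
    Integrable (fun y => φ.normed volume y • g (x - y)) :=
  (φ.hasCompactSupport_normed (μ := volume)).convolutionExists_left
    (ContinuousLinearMap.lsmul ℝ ℝ) φ.continuous_normed hg x

lemma Mo_sub (φ : ContDiffBump (0 : Pt n)) {g g' : Pt n → ℂ} (hg : LocallyIntegrable g)
    (hg' : LocallyIntegrable g') (x : Pt n) :
    Mo φ (fun x => g x - g' x) x = Mo φ g x - Mo φ g' x := by
  simp only [Mo_def, smul_sub]
  exact integral_sub (Mo_exists φ hg x) (Mo_exists φ hg' x)

lemma Mo_L2 (φ : ContDiffBump (0 : Pt n)) {g : Pt n → ℂ} (hg : Measurable g) :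
    ∫⁻ x, ‖Mo φ g x‖ₑ ^ 2 ≤ ∫⁻ x, ‖g x‖ₑ ^ 2 := by
  have h1 : ∫⁻ y, ‖φ.normed volume y‖ₑ = 1 := by
    rw [← ofReal_integral_norm_eq_lintegral_enorm φ.integrable_normed]
    simp only [Real.norm_of_nonneg (φ.nonneg_normed _)]
    rw [φ.integral_normed, ENNReal.ofReal_one]
  have := conv_L2 volume (measurable_id (α := Pt n)) (k := fun y => ‖φ.normed volume y‖ₑ)
    (φ.continuous_normed.measurable.enorm) (hg.enorm)
  rw [h1, one_pow, one_mul] at this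
  refine le_trans (lintegral_mono fun x => ?_) this
  gcongr
  rw [Mo_def]
  refine (enorm_integral_le_lintegral_enorm _).trans (lintegral_mono fun y => ?_)
  rw [enorm_smul]; rfl

lemma eLpNorm_two_sq (g : Pt n → ℂ) : (eLpNorm g 2 volume) ^ 2 = ∫⁻ x, ‖g x‖ₑ ^ 2 := by
  rw [eLpNorm_eq_lintegral_rpow_enorm_toReal (by norm_num) (by norm_num)]
  rw [← ENNReal.rpow_natCast, ← ENNReal.rpow_mul]
  norm_num

lemma three_sq (a b c : ℝ≥0∞) : (a + b + c) ^ 2 ≤ 3 * (a ^ 2 + b ^ 2 + c ^ 2) := by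
  by_cases h : a = ∞ ∨ b = ∞ ∨ c = ∞
  · rcases h with h | h | h <;> simp [h]
  · push Not at h
    obtain ⟨ha, hb, hc⟩ := h
    lift a to ℝ≥0 using ha
    lift b to ℝ≥0 using hb
    lift c to ℝ≥0 using hc
    norm_cast
    rw [← NNReal.coe_le_coe]
    push_cast
    nlinarith [sq_nonneg ((a : ℝ) - b), sq_nonneg ((b : ℝ) - c), sq_nonneg ((a : ℝ) - c)]

lemma moll_L2 {g : Pt n → ℂ} (hm : Measurable g) (hg : MemLp g 2 volume) {ε : ℝ≥0∞} (hε : ε ≠ 0) :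
    ∃ δ : ℝ, 0 < δ ∧ ∀ φ : ContDiffBump (0 : Pt n), φ.rOut ≤ δ →
      ∫⁻ x, ‖g x - Mo φ g x‖ₑ ^ 2 ≤ ε := by
  -- small parameter
  obtain ⟨κ, hκ0, hκ⟩ : ∃ κ : ℝ≥0∞, κ ≠ 0 ∧ 9 * κ ≤ ε := by
    refine ⟨ε / 9, ?_, ?_⟩
    · simp [hε]
    · rw [ENNReal.mul_div_cancel (by norm_num) (by norm_num)]
  obtain ⟨ν, hν0, hν⟩ : ∃ ν : ℝ≥0∞, ν ≠ 0 ∧ ν ^ 2 ≤ κ := by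
    refine ⟨min κ 1, by simp [hκ0], ?_⟩
    calc (min κ 1) ^ 2 = min κ 1 * min κ 1 := sq _
      _ ≤ κ * 1 := mul_le_mul' (min_le_left _ _) (min_le_right _ _)
      _ = κ := mul_one _
  obtain ⟨g', hc, hgg, hcont, hg'⟩ := hg.exists_hasCompactSupport_eLpNorm_sub_le (by norm_num) hν0
  have hgg2 : ∫⁻ x, ‖g x - g' x‖ₑ ^ 2 ≤ κ := by
    have := eLpNorm_two_sq (g - g')
    simp only [Pi.sub_apply] at this
    rw [← this]
    exact le_trans (by gcongr) hν
  set K := cthickening 1 (tsupport g') with hK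
  have hKc : IsCompact K := hc.isCompact.cthickening
  have hKv : volume K ≠ ∞ := hKc.measure_lt_top.ne
  obtain ⟨τ, hτ0, hτ⟩ : ∃ τ : ℝ, 0 < τ ∧ ENNReal.ofReal τ ^ 2 * volume K ≤ κ := by
    have : Tendsto (fun τ : ℝ => ENNReal.ofReal τ ^ 2 * volume K) (𝓝[>] 0)
        (𝓝 (ENNReal.ofReal 0 ^ 2 * volume K)) := by
      refine ENNReal.Tendsto.mul_const ?_ (Or.inr hKv)
      exact ((ENNReal.continuous_pow 2).comp ENNReal.continuous_ofReal).continuousAt.mono_left nhdsWithin_le_nhds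
    simp only [ENNReal.ofReal_zero, ne_eq, OfNat.ofNat_ne_zero, not_false_eq_true, zero_pow, zero_mul] at this
    have h1 := this.eventually (ge_mem_nhds (pos_iff_ne_zero.2 hκ0))
    obtain ⟨τ, h2, h3⟩ := (h1.and self_mem_nhdsWithin).exists
    exact ⟨τ, h3, h2⟩
  obtain ⟨δ, hδ0, hδ⟩ := Metric.uniformContinuous_iff.1 (hc.uniformContinuous_of_continuous hcont) τ hτ0
  refine ⟨min δ 1, by positivity, fun φ hφ => ?_⟩
  have hmid : ∀ x, ‖g' x - Mo φ g' x‖ₑ ≤ K.indicator (fun _ => ENNReal.ofReal τ) x := by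
    intro x
    by_cases hx : x ∈ K
    · rw [indicator_of_mem hx, ← ofReal_norm]
      refine ENNReal.ofReal_le_ofReal ?_
      rw [← dist_eq_norm, dist_comm]
      refine φ.dist_normed_convolution_le hcont.aestronglyMeasurable fun y hy => ?_
      exact (hδ (lt_of_lt_of_le hy (hφ.trans (min_le_left _ _)))).le
    · rw [indicator_of_notMem hx]
      have hz : ∀ y, dist y x ≤ 1 → g' y = 0 := fun y hy => by
        by_contra h
        exact hx (mem_cthickening_of_dist_le x y 1 _ (subset_tsupport _ h) (by rwa [dist_comm]))
      have : Mo φ g' x = g' x := φ.normed_convolution_eq_right fun y hy => by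
        rw [hz x (by simp), hz y (le_trans (le_of_lt hy) (hφ.trans (min_le_right _ _)))]
      simp [this]
  have hmid2 : ∫⁻ x, ‖g' x - Mo φ g' x‖ₑ ^ 2 ≤ κ := by
    calc _ ≤ ∫⁻ x, K.indicator (fun _ => ENNReal.ofReal τ ^ 2) x := by
          refine lintegral_mono fun x => ?_
          refine (pow_le_pow_left' (hmid x) 2).trans ?_
          by_cases hx : x ∈ K <;> simp [hx]
      _ = ENNReal.ofReal τ ^ 2 * volume K := by
          rw [lintegral_indicator hKc.measurableSet, setLIntegral_const]
      _ ≤ κ := hτ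
  have hlg : LocallyIntegrable g := hg.locallyIntegrable (by norm_num)
  have hlg' : LocallyIntegrable g' := hcont.locallyIntegrable
  have hlast : ∫⁻ x, ‖Mo φ (fun x => g x - g' x) x‖ₑ ^ 2 ≤ κ :=
    (Mo_L2 φ (hm.sub hcont.measurable)).trans hgg2
  have hMc : Continuous (Mo φ g') := by
    exact (φ.hasCompactSupport_normed (μ := volume)).continuous_convolution_left _ φ.continuous_normed hlg'
  calc ∫⁻ x, ‖g x - Mo φ g x‖ₑ ^ 2 ≤
      ∫⁻ x, 3 * (‖g x - g' x‖ₑ ^ 2 + ‖g' x - Mo φ g' x‖ₑ ^ 2 + ‖Mo φ (fun x => g x - g' x) x‖ₑ ^ 2) := by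
        refine lintegral_mono fun x => ?_
        refine le_trans ?_ (three_sq _ _ _)
        gcongr
        have e : g x - Mo φ g x = (g x - g' x) + (g' x - Mo φ g' x) + (-(Mo φ (fun x => g x - g' x) x)) := by
          rw [Mo_sub φ hlg hlg']; ring
        rw [e]
        refine (enorm_add_le _ _).trans ?_
        rw [enorm_neg]
        gcongr
        exact enorm_add_le _ _
    _ = 3 * ((∫⁻ x, ‖g x - g' x‖ₑ ^ 2) + (∫⁻ x, ‖g' x - Mo φ g' x‖ₑ ^ 2) +
        ∫⁻ x, ‖Mo φ (fun x => g x - g' x) x‖ₑ ^ 2) := by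
        rw [lintegral_const_mul' _ _ (by norm_num), lintegral_add_left, lintegral_add_left]
        · exact (hm.sub hcont.measurable).enorm.pow_const 2
        · exact ((hm.sub hcont.measurable).enorm.pow_const 2).add
            ((hcont.measurable.sub hMc.measurable).enorm.pow_const 2)
    _ ≤ 3 * (κ + κ + κ) := by gcongr
    _ = 9 * κ := by ring
    _ ≤ ε := hκ

lemma Mo_pd (φ : ContDiffBump (0 : Pt n)) {w : Pt n → ℂ} (hw : Differentiable ℝ w)
    (i : Fin (n + 1)) (hi : LocallyIntegrable (pd w i)) (x : Pt n) :
    pd (Mo φ w) i x = Mo φ (pd w i) x := by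
  have hl : LocallyIntegrable w := hw.continuous.locallyIntegrable
  have hφ1 : ContDiff ℝ 1 (φ.normed volume) := φ.contDiff_normed
  have hφc := φ.hasCompactSupport_normed (μ := volume)
  have hD := hφc.hasFDerivAt_convolution_left (ContinuousLinearMap.lsmul ℝ ℝ) hφ1 hl x
  have e1 : pd (Mo φ w) i x = ∫ y, (fderiv ℝ (φ.normed volume) y (ee i)) • w (x - y) := by
    have : pd (Mo φ w) i x = (convolution (fderiv ℝ (φ.normed volume)) w
      ((ContinuousLinearMap.lsmul ℝ ℝ).precompL (Pt n)) volume x) (ee i) := by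
      rw [← hD.fderiv]; rfl
    rw [this, convolution_def, ContinuousLinearMap.integral_apply]
    · rfl
    · exact (hφc.fderiv ℝ).convolutionExists_left _ (hφ1.continuous_fderiv (by norm_num)) hl x
  have hdy : ∀ y, HasFDerivAt (fun y => w (x - y)) (-(fderiv ℝ w (x - y))) y := fun y => by
    have h1 := (hw (x - y)).hasFDerivAt
    have h2 : HasFDerivAt (fun y : Pt n => x - y) (-(ContinuousLinearMap.id ℝ (Pt n))) y :=
      (hasFDerivAt_id y).const_sub x
    have := h1.comp y h2
    convert! this using 1
    ext v; simp
  have hd : ∀ y, fderiv ℝ (fun y => w (x - y)) y (ee i) = - pd w i (x - y) := fun y => by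
    rw [(hdy y).fderiv]; rfl
  have ibp := integral_smul_fderiv_eq_neg_fderiv_smul_of_integrable (μ := (volume : Measure (Pt n)))
    (f := φ.normed volume) (g := fun y => w (x - y)) (v := (ee i : Pt n)) ?_ ?_ (Mo_exists φ hl x)
    (fun y _ => (hφ1.differentiable (by norm_num)) y) (fun y _ => (hdy y).differentiableAt)
  · rw [e1, Mo_def]
    simp only [hd, smul_neg, integral_neg, neg_inj] at ibp
    exact ibp.symm
  · have hc1 : HasCompactSupport (fun y => fderiv ℝ (φ.normed volume) y (ee i)) :=
      hφc.fderiv_apply ℝ _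
    exact hc1.convolutionExists_left (ContinuousLinearMap.lsmul ℝ ℝ)
      ((hφ1.continuous_fderiv (by norm_num)).clm_apply continuous_const) hl x
  · simp only [hd, smul_neg]
    exact (Mo_exists φ hi x).neg

lemma Mo_tst {w : Pt n → ℂ} (hw : Continuous w) (hc : HasCompactSupport w)
    (hs : tsupport w ⊆ upperHalf n) :
    ∃ δ : ℝ, 0 < δ ∧ ∀ φ : ContDiffBump (0 : Pt n), φ.rOut ≤ δ → Tst (Mo φ w) := by
  obtain ⟨δ, hδ, hsub⟩ := hc.isCompact.exists_cthickening_subset_open isOpen_upperHalf hs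
  refine ⟨δ, hδ, fun φ hφ => ⟨?_, ?_, ?_⟩⟩
  · exact (φ.hasCompactSupport_normed (μ := volume)).contDiff_convolution_left _ φ.contDiff_normed
      hw.locallyIntegrable
  · exact (φ.hasCompactSupport_normed (μ := volume)).convolution _ hc
  · refine subset_trans (closure_minimal ?_ isClosed_cthickening) hsub
    intro x hx
    by_contra hn
    refine hx ?_
    have hz : ∀ y, dist y x ≤ δ → w y = 0 := fun y hy => by
      by_contra h
      exact hn (mem_cthickening_of_dist_le x y δ _ (subset_tsupport _ h) (by rwa [dist_comm]))
    have : Mo φ w x = w x := φ.normed_convolution_eq_right fun y hy => by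
      rw [hz x (by simp [hδ.le]), hz y (le_trans (le_of_lt hy) hφ)]
    rw [this, hz x (by simp [hδ.le])]

lemma moll {w : Pt n → ℂ} (hw : Differentiable ℝ w) (hc : HasCompactSupport w)
    (hs : tsupport w ⊆ upperHalf n) (hg : ∀ i, MemLp (pd w i) 2 volume) {ε : ℝ≥0∞} (hε : ε ≠ 0) :
    ∃ v, Tst v ∧ ∫⁻ x, ‖w x - v x‖ₑ ^ 2 ≤ ε ∧ ∀ i, ∫⁻ x, ‖pd w i x - pd v i x‖ₑ ^ 2 ≤ ε := by
  obtain ⟨δ1, hδ1, h1⟩ := Mo_tst hw.continuous hc hs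
  obtain ⟨δ2, hδ2, h2⟩ := moll_L2 hw.continuous.measurable (hw.continuous.memLp_of_hasCompactSupport hc) hε
  choose δ3 hδ3 h3 using fun i => moll_L2 (measurable_pd w i) (hg i) hε
  obtain ⟨δ4, hδ4, h4⟩ : ∃ δ4 : ℝ, 0 < δ4 ∧ ∀ i, δ4 ≤ δ3 i := by
    refine ⟨Finset.univ.inf' Finset.univ_nonempty δ3, ?_, fun i => Finset.inf'_le _ (Finset.mem_univ i)⟩
    rw [Finset.lt_inf'_iff]; exact fun i _ => hδ3 i
  set δ := min δ1 (min δ2 δ4)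
  have hδ : 0 < δ := by positivity
  set φ : ContDiffBump (0 : Pt n) := ⟨δ / 2, δ, by linarith, by linarith⟩
  refine ⟨Mo φ w, h1 φ (min_le_left _ _), h2 φ ((min_le_right _ _).trans (min_le_left _ _)), fun i => ?_⟩
  have := h3 i φ (((min_le_right _ _).trans (min_le_right _ _)).trans (h4 i))
  simp only [Mo_pd φ hw i ((hg i).locallyIntegrable (by norm_num))]
  exact this

/-! ### Approximation by test functions -/

lemma exists_step : ∃ (χ : ℝ → ℝ) (G : ℝ), ContDiff ℝ (⊤ : ℕ∞) χ ∧ 0 ≤ G ∧ (∀ s, 0 ≤ χ s) ∧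
    (∀ s, χ s ≤ 1) ∧ (∀ s, s ≤ 1 / 2 → χ s = 0) ∧ (∀ s, 1 ≤ s → χ s = 1) ∧ ∀ s, |deriv χ s| ≤ G := by
  have hc : ContDiff ℝ (⊤ : ℕ∞) (fun s : ℝ => Real.smoothTransition (2 * s - 1)) :=
    Real.smoothTransition.contDiff.comp ((contDiff_const.mul contDiff_id).sub contDiff_const)
  have hcd : Continuous (deriv fun s : ℝ => Real.smoothTransition (2 * s - 1)) :=
    hc.continuous_deriv (by simp)
  obtain ⟨G, hG⟩ := (isCompact_Icc (a := (0 : ℝ)) (b := 2)).exists_bound_of_continuousOn hcd.continuousOn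
  have h0 : ∀ s : ℝ, s ≤ 1 / 2 → Real.smoothTransition (2 * s - 1) = 0 := fun s hs =>
    Real.smoothTransition.zero_of_nonpos (by linarith)
  have h1 : ∀ s : ℝ, 1 ≤ s → Real.smoothTransition (2 * s - 1) = 1 := fun s hs =>
    Real.smoothTransition.one_of_one_le (by linarith)
  refine ⟨_, max G 0, hc, le_max_right _ _, fun s => Real.smoothTransition.nonneg _,
    fun s => Real.smoothTransition.le_one _, h0, h1, fun s => ?_⟩
  by_cases hs0 : s < 0
  · have : (fun s : ℝ => Real.smoothTransition (2 * s - 1)) =ᶠ[𝓝 s] fun _ => 0 := by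
      filter_upwards [Iio_mem_nhds hs0] with t ht
      exact h0 t (by linarith [show t < 0 from ht])
    rw [this.deriv_eq]; simp
  by_cases hs1 : 2 < s
  · have : (fun s : ℝ => Real.smoothTransition (2 * s - 1)) =ᶠ[𝓝 s] fun _ => 1 := by
      filter_upwards [Ioi_mem_nhds hs1] with t ht
      exact h1 t (by linarith [show 2 < t from ht])
    rw [this.deriv_eq]; simp
  · exact (hG s ⟨by linarith, by linarith⟩).trans (le_max_left _ _)

lemma two_sq (a b : ℝ≥0∞) : (a + b) ^ 2 ≤ 2 * (a ^ 2 + b ^ 2) := by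
  by_cases h : a = ∞ ∨ b = ∞
  · rcases h with h | h <;> simp [h]
  · push Not at h
    obtain ⟨ha, hb⟩ := h
    lift a to ℝ≥0 using ha
    lift b to ℝ≥0 using hb
    norm_cast
    rw [← NNReal.coe_le_coe]
    push_cast
    nlinarith [sq_nonneg ((a : ℝ) - b)]

lemma strp_lim {F : Pt n → ℝ≥0∞} (hF : Measurable F) (hfin : ∫⁻ x in upperHalf n, F x < ∞)
    {ε : ℝ≥0∞} (hε : ε ≠ 0) :
    ∃ T : ℝ, 0 < T ∧ T ≤ 1 ∧ ∫⁻ x in strp (2 * T) (univ : Set (BPt n)), F x ≤ ε := by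
  set ν := (volume.restrict (upperHalf n)).withDensity F with hν
  have hsub : ∀ T, strp T (univ : Set (BPt n)) ⊆ upperHalf n := fun T x hx => hx.1
  have e : ∀ T, ν (strp T (univ : Set (BPt n))) = ∫⁻ x in strp T (univ : Set (BPt n)), F x := fun T => by
    rw [hν, withDensity_apply _ (meas_strp T MeasurableSet.univ),
      Measure.restrict_restrict (meas_strp T MeasurableSet.univ), inter_eq_left.2 (hsub T)]
  have hlim := tendsto_measure_iInter_atTop (μ := ν)
    (s := fun k : ℕ => strp (2 * (1 / ((k : ℝ) + 1))) (univ : Set (BPt n)))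
    (fun k => (meas_strp _ MeasurableSet.univ).nullMeasurableSet) ?_ ⟨0, ?_⟩
  · have hempty : (⋂ k : ℕ, strp (2 * (1 / ((k : ℝ) + 1))) (univ : Set (BPt n))) = ∅ := by
      ext x
      simp only [mem_iInter, mem_empty_iff_false, iff_false, not_forall]
      by_cases hx : 0 < dd x
      · obtain ⟨k, hk⟩ := exists_nat_one_div_lt (half_pos hx)
        exact ⟨k, fun h => by have := h.2.1; linarith⟩
      · exact ⟨0, fun h => hx h.1⟩
    rw [hempty, measure_empty] at hlim
    obtain ⟨k, hk⟩ := (hlim.eventually (ge_mem_nhds (pos_iff_ne_zero.2 hε))).exists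
    refine ⟨1 / ((k : ℝ) + 1), by positivity, ?_, ?_⟩
    · rw [div_le_one (by positivity)]; linarith [Nat.cast_nonneg (α := ℝ) k]
    · rw [← e]; exact hk
  · intro k l hkl x hx
    refine ⟨hx.1, hx.2.1.trans_le ?_, trivial⟩
    have : (k : ℝ) ≤ l := by exact_mod_cast hkl
    gcongr
  · rw [e]
    exact ((lintegral_mono_set (hsub _)).trans_lt hfin).ne

lemma approx {w : Pt n → ℂ} (hd : ∀ x ∈ upperHalf n, DifferentiableAt ℝ w x) {R : ℝ}
    (hR : ∀ x, R ≤ ‖x‖ → w x = 0) (hg : ∀ i, ∫⁻ x in upperHalf n, ‖pd w i x‖ₑ ^ 2 < ∞)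
    (h0 : ∀ᵐ x' : BPt n, Tendsto (fun t : ℝ => w (pt t x')) (𝓝[>] 0) (𝓝 0)) {ε : ℝ≥0∞} (hε : ε ≠ 0)
    (hε' : ε ≠ ∞) :
    ∃ v, Tst v ∧ ∫⁻ x in upperHalf n, ‖w x - v x‖ₑ ^ 2 ≤ ε ∧
      ∀ i, ∫⁻ x in upperHalf n, ‖pd w i x - pd v i x‖ₑ ^ 2 ≤ ε := by
  obtain ⟨χ, G, hχ, hG, hχ0, hχ1, hχz, hχo, hχd⟩ := exists_step
  set F : Pt n → ℝ≥0∞ := fun x => ∑ i, ‖pd w i x‖ₑ ^ 2 with hF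
  have hFm : Measurable F := Finset.measurable_sum _ fun i _ => (measurable_pd w i).enorm.pow_const 2
  have hFfin : ∫⁻ x in upperHalf n, F x < ∞ := by
    rw [lintegral_finsetSum _ fun i _ => (measurable_pd w i).enorm.pow_const 2]
    exact ENNReal.sum_lt_top.2 fun i _ => hg i
  set M : ℝ≥0∞ := 12 + 8 * ENNReal.ofReal G ^ 2 with hM
  have hM0 : M ≠ 0 := by simp [hM]
  have hMt : M ≠ ∞ := by simp [hM, ENNReal.mul_eq_top]
  obtain ⟨T, hT0, hT1, hT⟩ := strp_lim hFm hFfin (ε := ε / 4 / M) (by simp [hε, hMt])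
  set Z := strp (2 * T) (univ : Set (BPt n)) with hZ
  have hZm : MeasurableSet Z := meas_strp _ MeasurableSet.univ
  have hMH : M * ∫⁻ x in Z, F x ≤ ε / 4 := by
    calc _ ≤ M * (ε / 4 / M) := by gcongr
      _ = ε / 4 := ENNReal.mul_div_cancel hM0 hMt
  -- the cutoff
  set c : Pt n → ℝ := fun x => χ (dd x / T) with hc
  have hcs : ContDiff ℝ (⊤ : ℕ∞) c := hχ.comp (contDiff_dd.div_const T)
  have hcz : ∀ x, dd x ≤ T / 2 → c x = 0 := fun x hx => hχz _ (by
    rw [div_le_iff₀ hT0]; linarith)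
  have hco : ∀ x, T ≤ dd x → c x = 1 := fun x hx => hχo _ (by rwa [le_div_iff₀ hT0, one_mul])
  have hcd : ∀ x i, |fderiv ℝ c x (ee i)| ≤ G / T := fun x i => by
    have hdd : HasFDerivAt (fun x : Pt n => dd x / T) (T⁻¹ • (EuclideanSpace.proj 0 : Pt n →L[ℝ] ℝ)) x := by
      have := ((EuclideanSpace.proj 0 : Pt n →L[ℝ] ℝ).hasFDerivAt (x := x)).const_mul T⁻¹
      refine this.congr_of_eventuallyEq (Filter.Eventually.of_forall fun y => ?_)
      simp [dd, div_eq_inv_mul]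
    have h1 : HasDerivAt χ (deriv χ (dd x / T)) (dd x / T) :=
      (hχ.differentiable (by simp) _).hasDerivAt
    have h2 := h1.comp_hasFDerivAt x hdd
    have h3 : fderiv ℝ c x = deriv χ (dd x / T) • (T⁻¹ • (EuclideanSpace.proj 0 : Pt n →L[ℝ] ℝ)) := h2.fderiv
    rw [h3]
    have h4 : |(ee i : Pt n) 0| ≤ 1 := by
      have := PiLp.norm_apply_le (ee i : Pt n) 0
      rwa [norm_ee] at this
    have : (deriv χ (dd x / T) • (T⁻¹ • (EuclideanSpace.proj 0 : Pt n →L[ℝ] ℝ))) (ee i) =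
      deriv χ (dd x / T) * (T⁻¹ * (ee i : Pt n) 0) := rfl
    rw [this, abs_mul, abs_mul, abs_of_pos (inv_pos.2 hT0)]
    calc _ ≤ G * (T⁻¹ * 1) := by gcongr; exact hχd _
      _ = G / T := by ring
  have hcC := contDiff_ofReal hcs
  set wT : Pt n → ℂ := fun x => (c x : ℂ) * w x with hwT
  have hwTd : Differentiable ℝ wT := fun x => by
    by_cases hx : x ∈ upperHalf n
    · exact (hcC.differentiable (by simp) x).mul (hd x hx)
    · have : wT =ᶠ[𝓝 x] fun _ => 0 := by
        have ho : {y : Pt n | dd y < T / 2} ∈ 𝓝 x :=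
          (isOpen_lt contDiff_dd.continuous continuous_const).mem_nhds (by
            have : ¬ (0 < dd x) := hx
            change dd x < T / 2; linarith)
        filter_upwards [ho] with y hy
        simp only [hwT]; rw [hcz y (le_of_lt hy)]; simp
      exact (differentiableAt_const (0 : ℂ)).congr_of_eventuallyEq this
  have hsup : tsupport wT ⊆ {x | T / 2 ≤ dd x} ∩ closedBall 0 R := by
    refine closure_minimal (fun x hx => ?_)
      ((isClosed_le continuous_const contDiff_dd.continuous).inter isClosed_closedBall)
    constructor
    · by_contra h
      exact hx (by simp only [hwT]; rw [hcz x (le_of_lt (not_le.1 h))]; simp)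
    · by_contra h
      refine hx ?_
      simp only [hwT]
      rw [hR x (le_of_lt (by simpa using h)), mul_zero]
  have hwTc : HasCompactSupport wT :=
    (isCompact_closedBall (0 : Pt n) R).of_isClosed_subset (isClosed_tsupport _)
      (hsup.trans inter_subset_right)
  have hΩm : MeasurableSet (upperHalf n) := isOpen_upperHalf.measurableSet
  set H : ℝ≥0∞ := ∫⁻ x in Z, F x with hH
  have hZΩ : Z ⊆ upperHalf n := fun x hx => hx.1
  have hmZ : ∀ x ∈ upperHalf n, x ∉ Z → 2 * T ≤ dd x := fun x hx hxZ => by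
    by_contra h
    exact hxZ ⟨hx, not_le.1 h, trivial⟩
  have hpF : ∀ i, ∫⁻ x in Z, ‖pd w i x‖ₑ ^ 2 ≤ H := fun i => by
    refine lintegral_mono fun x => ?_
    exact Finset.single_le_sum (f := fun i => ‖pd w i x‖ₑ ^ 2) (fun _ _ => bot_le) (Finset.mem_univ i)
  have hwZ : ∫⁻ x in Z, ‖w x‖ₑ ^ 2 ≤ ENNReal.ofReal (2 * T) ^ 2 * H := by
    refine (strip hd MeasurableSet.univ (h0.mono fun x hx _ => hx) (2 * T)).trans ?_
    gcongr
    exact hpF 0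
  have hind : ∀ f : Pt n → ℝ≥0∞, ∫⁻ x in upperHalf n, Z.indicator f x = ∫⁻ x in Z, f x := fun f => by
    rw [lintegral_indicator hZm, Measure.restrict_restrict hZm, inter_eq_left.2 hZΩ]
  have hle4 : 4 * H ≤ ε / 4 := by
    refine le_trans ?_ hMH
    gcongr
    rw [hM]
    calc (4 : ℝ≥0∞) ≤ 12 := by norm_num
      _ ≤ _ := le_self_add
  have E1 : ∫⁻ x in upperHalf n, ‖w x - wT x‖ₑ ^ 2 ≤ ε / 4 := by
    calc _ ≤ ∫⁻ x in upperHalf n, Z.indicator (fun x => ‖w x‖ₑ ^ 2) x := by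
          refine setLIntegral_mono' hΩm fun x hx => ?_
          by_cases hxZ : x ∈ Z
          · rw [indicator_of_mem hxZ]
            gcongr
            rw [enorm_le_iff_norm_le]
            have : w x - wT x = ((1 - c x : ℝ) : ℂ) * w x := by simp only [hwT]; push_cast; ring
            rw [this, norm_mul, Complex.norm_real, Real.norm_eq_abs,
              abs_of_nonneg (by linarith [hχ1 (dd x / T)])]
            have := hχ0 (dd x / T)
            have h3 : 1 - c x ≤ 1 := by simp only [hc]; linarith
            exact mul_le_of_le_one_left (norm_nonneg _) h3
          · rw [indicator_of_notMem hxZ]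
            simp only [hwT]
            rw [hco x (by linarith [hmZ x hx hxZ])]
            simp
      _ ≤ ENNReal.ofReal (2 * T) ^ 2 * H := by rw [hind]; exact hwZ
      _ ≤ 4 * H := by
          gcongr
          rw [← ENNReal.ofReal_pow (by positivity)]
          have : (4 : ℝ≥0∞) = ENNReal.ofReal 4 := by simp
          rw [this]
          exact ENNReal.ofReal_le_ofReal (by nlinarith)
      _ ≤ ε / 4 := hle4
  have E2 : ∀ i, ∫⁻ x in upperHalf n, ‖pd w i x - pd wT i x‖ₑ ^ 2 ≤ ε / 4 := fun i => by
    calc _ ≤ ∫⁻ x in upperHalf n, Z.indicator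
          (fun x => 2 * (‖pd w i x‖ₑ ^ 2 + ENNReal.ofReal (G / T) ^ 2 * ‖w x‖ₑ ^ 2)) x := by
          refine setLIntegral_mono' hΩm fun x hx => ?_
          by_cases hxZ : x ∈ Z
          · rw [indicator_of_mem hxZ, ← mul_pow]
            refine le_trans ?_ (two_sq _ _)
            gcongr
            have e : pd wT i x = ((fderiv ℝ c x (ee i) : ℝ) : ℂ) * w x + (c x : ℂ) * pd w i x := by
              rw [← pd_ofReal hcs]
              exact pd_mul (hcC.differentiable (by simp) x) (hd x hx) i
            have e2 : pd w i x - pd wT i x =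
                ((1 - c x : ℝ) : ℂ) * pd w i x - ((fderiv ℝ c x (ee i) : ℝ) : ℂ) * w x := by
              rw [e]; push_cast; ring
            rw [← ofReal_norm (x := w x), ← ofReal_norm (x := pd w i x), ← ofReal_norm (x := pd w i x - pd wT i x),
              ← ENNReal.ofReal_mul (by positivity), ← ENNReal.ofReal_add (by positivity) (by positivity)]
            refine ENNReal.ofReal_le_ofReal ?_
            rw [e2]
            refine (norm_sub_le _ _).trans ?_
            rw [norm_mul, norm_mul, Complex.norm_real, Complex.norm_real, Real.norm_eq_abs,
              Real.norm_eq_abs, abs_of_nonneg (show (0:ℝ) ≤ 1 - c x by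
                have := hχ1 (dd x / T); simp only [hc]; linarith)]
            have := hχ0 (dd x / T)
            have h3 : 1 - c x ≤ 1 := by simp only [hc]; linarith
            gcongr
            · exact mul_le_of_le_one_left (norm_nonneg _) h3
            · exact hcd x i
          · rw [indicator_of_notMem hxZ]
            have : wT =ᶠ[𝓝 x] w := by
              have ho : {y : Pt n | T < dd y} ∈ 𝓝 x :=
                (isOpen_lt continuous_const contDiff_dd.continuous).mem_nhds (by
                  change T < dd x; linarith [hmZ x hx hxZ])
              filter_upwards [ho] with y hy
              simp only [hwT]; rw [hco y (le_of_lt hy)]; simp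
            have e : pd wT i x = pd w i x := by
              simp only [pd, pdG]; rw [this.fderiv_eq]
            rw [e]; simp
      _ = 2 * ((∫⁻ x in Z, ‖pd w i x‖ₑ ^ 2) + ENNReal.ofReal (G / T) ^ 2 * ∫⁻ x in Z, ‖w x‖ₑ ^ 2) := by
          rw [hind, lintegral_const_mul' _ _ (by simp),
            lintegral_add_left ((measurable_pd w i).enorm.pow_const 2),
            lintegral_const_mul' _ _ (by finiteness)]
      _ ≤ 2 * (H + ENNReal.ofReal (G / T) ^ 2 * (ENNReal.ofReal (2 * T) ^ 2 * H)) := by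
          gcongr
          exact hpF i
      _ = (2 + 8 * ENNReal.ofReal G ^ 2) * H := by
          have : ENNReal.ofReal (G / T) * ENNReal.ofReal (2 * T) = 2 * ENNReal.ofReal G := by
            rw [← ENNReal.ofReal_mul (by positivity)]
            have : G / T * (2 * T) = 2 * G := by field_simp
            rw [this, ENNReal.ofReal_mul (by norm_num)]; simp
          rw [← mul_assoc, ← mul_pow, this]
          ring
      _ ≤ M * H := by
          gcongr
          rw [hM]
          gcongr
          norm_num
      _ ≤ ε / 4 := hMH
  have e4 : ε / 4 ≠ ∞ := by finiteness
  have hsΩ : tsupport wT ⊆ upperHalf n := fun x hx => by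
    have : T / 2 ≤ dd x := (hsup hx).1
    change 0 < dd x
    linarith
  have hL : ∀ i, MemLp (pd wT i) 2 volume := fun i => by
    refine ⟨(measurable_pd wT i).aestronglyMeasurable, ?_⟩
    have : (eLpNorm (pd wT i) 2 volume) ^ 2 < ∞ := by
      rw [eLpNorm_two_sq]
      calc ∫⁻ x, ‖pd wT i x‖ₑ ^ 2 = ∫⁻ x in upperHalf n, ‖pd wT i x‖ₑ ^ 2 := by
            rw [← lintegral_indicator hΩm]
            congr 1; funext x
            by_cases hx : x ∈ upperHalf n
            · rw [indicator_of_mem hx]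
            · rw [indicator_of_notMem hx, image_eq_zero_of_notMem_tsupport fun h =>
                hx (hsΩ (tsupport_pd_subset wT i h))]
              simp
        _ ≤ ∫⁻ x in upperHalf n, 2 * (‖pd w i x‖ₑ ^ 2 + ‖pd w i x - pd wT i x‖ₑ ^ 2) := by
            refine lintegral_mono fun x => ?_
            refine le_trans ?_ (two_sq _ _)
            gcongr
            have : pd wT i x = pd w i x - (pd w i x - pd wT i x) := by ring
            calc ‖pd wT i x‖ₑ = ‖pd w i x - (pd w i x - pd wT i x)‖ₑ := by rw [← this]
              _ ≤ _ := enorm_sub_le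
        _ = 2 * ((∫⁻ x in upperHalf n, ‖pd w i x‖ₑ ^ 2) +
              ∫⁻ x in upperHalf n, ‖pd w i x - pd wT i x‖ₑ ^ 2) := by
            rw [lintegral_const_mul' _ _ (by simp),
              lintegral_add_left ((measurable_pd w i).enorm.pow_const 2)]
        _ < ∞ := by
            have h1 := (hg i).ne
            have h2 := ((E2 i).trans_lt e4.lt_top).ne
            exact ENNReal.mul_lt_top (by simp) (ENNReal.add_lt_top.2 ⟨h1.lt_top, h2.lt_top⟩)
    by_contra h
    rw [not_lt, top_le_iff] at h
    rw [h] at this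
    simp at this
  obtain ⟨v, hv, hv1, hv2⟩ := moll hwTd hwTc hsΩ hL (ε := ε / 4) (by simp [hε])
  have hsum : 2 * (ε / 4 + ε / 4) = ε := by
    have h4 : ε / 4 = ε / 2 / 2 := by
      rw [div_eq_mul_inv, div_eq_mul_inv, div_eq_mul_inv, mul_assoc,
        ← ENNReal.mul_inv (by simp) (by simp)]; norm_num
    rw [h4, ENNReal.add_halves, ENNReal.mul_div_cancel (by simp) (by simp)]
  refine ⟨v, hv, ?_, fun i => ?_⟩
  · calc _ ≤ ∫⁻ x in upperHalf n, 2 * (‖w x - wT x‖ₑ ^ 2 + ‖wT x - v x‖ₑ ^ 2) := by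
          refine lintegral_mono fun x => le_trans ?_ (two_sq _ _)
          gcongr
          have : w x - v x = (w x - wT x) + (wT x - v x) := by ring
          rw [this]
          exact enorm_add_le _ _
      _ = 2 * ((∫⁻ x in upperHalf n, ‖w x - wT x‖ₑ ^ 2) + ∫⁻ x in upperHalf n, ‖wT x - v x‖ₑ ^ 2) := by
          rw [lintegral_const_mul' _ _ (by simp)]
          congr 1
          exact lintegral_add_right (μ := volume.restrict (upperHalf n)) (fun x => ‖w x - wT x‖ₑ ^ 2)
            (g := fun x => ‖wT x - v x‖ₑ ^ 2) ((hwTd.continuous.measurable.sub hv.cont.measurable).enorm.pow_const 2)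
      _ ≤ 2 * (ε / 4 + ε / 4) := by
          gcongr
          exact (setLIntegral_le_lintegral _ _).trans hv1
      _ = ε := hsum
  · calc _ ≤ ∫⁻ x in upperHalf n, 2 * (‖pd w i x - pd wT i x‖ₑ ^ 2 + ‖pd wT i x - pd v i x‖ₑ ^ 2) := by
          refine lintegral_mono fun x => le_trans ?_ (two_sq _ _)
          gcongr
          have : pd w i x - pd v i x = (pd w i x - pd wT i x) + (pd wT i x - pd v i x) := by ring
          rw [this]
          exact enorm_add_le _ _
      _ = 2 * ((∫⁻ x in upperHalf n, ‖pd w i x - pd wT i x‖ₑ ^ 2) +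
            ∫⁻ x in upperHalf n, ‖pd wT i x - pd v i x‖ₑ ^ 2) := by
          rw [lintegral_const_mul' _ _ (by simp)]
          congr 1
          exact lintegral_add_right (μ := volume.restrict (upperHalf n)) (fun x => ‖pd w i x - pd wT i x‖ₑ ^ 2)
            (g := fun x => ‖pd wT i x - pd v i x‖ₑ ^ 2)
            (((measurable_pd wT i).sub (measurable_pd v i)).enorm.pow_const 2)
      _ ≤ 2 * (ε / 4 + ε / 4) := by
          gcongr
          · exact E2 i
          · exact (setLIntegral_le_lintegral _ _).trans (hv2 i)
      _ = ε := hsum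

/-! ### Unit scale estimate -/

lemma BF_split {lam Lam : ℝ} {A : Pt n → Fin (n + 1) → Fin (n + 1) → ℂ} (hA : Coef lam Lam A)
    {v ψ : Pt n → ℂ} (hv : ∀ j, MemLp (pd v j) 2 (volume.restrict (upperHalf n))) (hψ : Tst ψ) :
    BF A v ψ = ∑ i, ∑ j, ∫ x in upperHalf n, pd v j x * (A x i j * pd ψ i x) := by
  have hintg : ∀ i j, Integrable (fun x => pd v j x * (A x i j * pd ψ i x))
      (volume.restrict (upperHalf n)) := fun i j =>
    MemLp.integrable_mul (p := 2) (q := 2) (hv j)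
      ((((hψ.pd i).mul (hA.entry i j)).memLp 2).restrict (upperHalf n))
  unfold BF
  calc _ = ∫ x in upperHalf n, ∑ i, ∑ j, pd v j x * (A x i j * pd ψ i x) := by
        congr 1; funext x
        refine Finset.sum_congr rfl fun i _ => Finset.sum_congr rfl fun j _ => ?_
        ring
    _ = ∑ i, ∫ x in upperHalf n, ∑ j, pd v j x * (A x i j * pd ψ i x) :=
        integral_finsetSum _ fun i _ => integrable_finsetSum _ fun j _ => hintg i j
    _ = _ := Finset.sum_congr rfl fun i _ => integral_finsetSum _ fun j _ => hintg i j

lemma BF_diff {lam Lam : ℝ} (hLam : 0 ≤ Lam) {A : Pt n → Fin (n + 1) → Fin (n + 1) → ℂ}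
    (hA : Coef lam Lam A) {v w ψ : Pt n → ℂ}
    (hv : ∀ j, MemLp (pd v j) 2 (volume.restrict (upperHalf n)))
    (hw : ∀ j, MemLp (pd w j) 2 (volume.restrict (upperHalf n))) {e : ℝ} (he : 0 ≤ e)
    (hD : ∀ j, ∫⁻ x in upperHalf n, ‖pd w j x - pd v j x‖ₑ ^ 2 ≤ ENNReal.ofReal (e ^ 2)) (hψ : Tst ψ) :
    ‖BF A w ψ - BF A v ψ‖ ≤ (n + 1) ^ 2 * Lam * e * √(gsq ψ) := by
  rw [BF_split hA hv hψ, BF_split hA hw hψ, ← Finset.sum_sub_distrib]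
  have ha : ∀ i j, MemLp (fun x => A x i j * pd ψ i x) 2 (volume.restrict (upperHalf n)) := fun i j =>
    (((hψ.pd i).mul (hA.entry i j)).memLp 2).restrict (upperHalf n)
  have key : ∀ i j, ‖(∫ x in upperHalf n, pd w j x * (A x i j * pd ψ i x)) -
      ∫ x in upperHalf n, pd v j x * (A x i j * pd ψ i x)‖ ≤ Lam * e * √(gsq ψ) := fun i j => by
    have i1 : Integrable (fun x => pd w j x * (A x i j * pd ψ i x)) (volume.restrict (upperHalf n)) :=
      MemLp.integrable_mul (p := 2) (q := 2) (hw j) (ha i j)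
    have i2 : Integrable (fun x => pd v j x * (A x i j * pd ψ i x)) (volume.restrict (upperHalf n)) :=
      MemLp.integrable_mul (p := 2) (q := 2) (hv j) (ha i j)
    rw [← integral_sub i1 i2]
    have hd : MemLp (fun x => pd w j x - pd v j x) 2 (volume.restrict (upperHalf n)) := (hw j).sub (hv j)
    have h1 := cs' hd (ha i j)
    have h2 : (∫ x in upperHalf n, ‖pd w j x - pd v j x‖ ^ 2) ≤ e ^ 2 := by
      rw [← ENNReal.ofReal_le_ofReal_iff (by positivity), ofReal_integral_eq_lintegral_ofReal
        ((memLp_two_iff_integrable_sq_norm hd.1).1 hd) (Filter.Eventually.of_forall fun x => by positivity)]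
      refine le_trans (le_of_eq ?_) (hD j)
      congr 1; funext x
      rw [← ofReal_norm, ENNReal.ofReal_pow (norm_nonneg _)]
    have h3 : (∫ x in upperHalf n, ‖A x i j * pd ψ i x‖ ^ 2) ≤ Lam ^ 2 * gsq ψ := by
      calc _ ≤ ∫ x in upperHalf n, Lam ^ 2 * ‖pd ψ i x‖ ^ 2 := by
            refine setIntegral_mono_on ((memLp_two_iff_integrable_sq_norm (ha i j).1).1 (ha i j))
              (((hψ.pd i).int_sq.const_mul _).integrableOn) isOpen_upperHalf.measurableSet fun x hx => ?_
            rw [norm_mul, mul_pow]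
            gcongr
            exact hA.norm_entry hx i j
        _ ≤ ∫ x, Lam ^ 2 * ‖pd ψ i x‖ ^ 2 :=
            setIntegral_le_integral ((hψ.pd i).int_sq.const_mul _)
              (Filter.Eventually.of_forall fun x => by positivity)
        _ = Lam ^ 2 * nsq (pd ψ i) := integral_const_mul _ _
        _ ≤ _ := by
            gcongr
            exact Finset.single_le_sum (f := fun i => nsq (pd ψ i)) (fun _ _ => nsq_nonneg _) (Finset.mem_univ i)
    calc _ = ‖∫ x in upperHalf n, (pd w j x - pd v j x) * (A x i j * pd ψ i x)‖ := by
          congr 2; funext x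
          ring
      _ ≤ _ := h1
      _ ≤ √(e ^ 2) * √(Lam ^ 2 * gsq ψ) := by gcongr
      _ = Lam * e * √(gsq ψ) := by
          rw [Real.sqrt_sq he, Real.sqrt_mul (by positivity), Real.sqrt_sq hLam]; ring
  refine (norm_sum_le _ _).trans ?_
  calc _ ≤ ∑ i : Fin (n + 1), ∑ j : Fin (n + 1), Lam * e * √(gsq ψ) := by
        refine Finset.sum_le_sum fun i _ => ?_
        rw [← Finset.sum_sub_distrib]
        exact (norm_sum_le _ _).trans (Finset.sum_le_sum fun j _ => key i j)
    _ = _ := by simp; ring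

lemma BF_congr {A : Pt n → Fin (n + 1) → Fin (n + 1) → ℂ} {v w ψ : Pt n → ℂ} {U : Set (Pt n)}
    (hU : IsOpen U) (h : ∀ x ∈ U, v x = w x) (hs : tsupport ψ ⊆ U) : BF A v ψ = BF A w ψ := by
  unfold BF
  congr 1; funext x
  refine Finset.sum_congr rfl fun i _ => Finset.sum_congr rfl fun j _ => ?_
  by_cases hx : x ∈ U
  · have : v =ᶠ[𝓝 x] w := by
      filter_upwards [hU.mem_nhds hx] with y hy using h y hy
    have e : pd v j x = pd w j x := by simp only [pd, pdG]; rw [this.fderiv_eq]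
    rw [e]
  · rw [image_eq_zero_of_notMem_tsupport (f := pd ψ i) fun h' => hx (hs (tsupport_pd_subset ψ i h'))]
    simp

lemma tst_unit (n : ℕ) {lam Lam : ℝ} (hlam : 0 < lam) :
    ∃ C K, 0 < C ∧ 0 < K ∧ ∀ s : ℝ, 0 < s → s ≤ 1 / 8 → ∃ Cs, 0 < Cs ∧
    ∀ (A : Pt n → Fin (n + 1) → Fin (n + 1) → ℂ) (ε M : ℝ), Coef lam Lam A → Sm ε A → 0 ≤ ε → 0 ≤ M →
    (∀ x ∈ upperHalf n, A x 0 0 = 1) → ∀ W : Pt n → ℂ, Tst W →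
    (∀ ψ, Tst ψ → tsupport ψ ⊆ ball 0 3 → ‖BF A W ψ‖ ≤ M * √(gsq ψ)) →
    ∀ θ : ℝ, 0 < θ → θ ≤ 1 / 2 →
    ∫ x in ball (0 : Pt n) θ, ‖W x‖ ^ 2 ≤
      C * θ ^ (n + 2) * nsq W + (Cs * ε ^ 2 + 2 * s ^ 2) * (K * (nsq W + M ^ 2)) + Cs * M ^ 2 := by
  obtain ⟨C, hC, H⟩ := main_tst n (lam := lam) (Lam := Lam) hlam
  let ζ : ContDiffBump (0 : Pt n) := ⟨1, 3 / 2, by norm_num, by norm_num⟩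
  let η : ContDiffBump (0 : Pt n) := ⟨2, 5 / 2, by norm_num, by norm_num⟩
  have hζs : ContDiff ℝ (⊤ : ℕ∞) (ζ : Pt n → ℝ) := ζ.contDiff
  have hηs : ContDiff ℝ (⊤ : ℕ∞) (η : Pt n → ℝ) := η.contDiff
  obtain ⟨G1, hG1, hζG⟩ := grad_bdd hζs ζ.hasCompactSupport
  obtain ⟨G2, hG2, hηG⟩ := grad_bdd hηs η.hasCompactSupport
  set c0 : ℝ := 2 / lam * (4 / lam + 2 * lam + (2 * Lam) ^ 2 / lam) with hc0
  have hc0p : 0 ≤ c0 := by positivity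
  refine ⟨C, 2 * ((n + 1) * G1 + c0 * (1 + G2)) + 1, hC, by positivity, fun s hs hs8 => ?_⟩
  obtain ⟨Cs, hCs, H⟩ := H s hs hs8
  refine ⟨Cs, hCs, fun A ε M hA hS hε hM h00 W hW hsol θ hθ hθ2 => ?_⟩
  set K : ℝ := 2 * ((n + 1) * G1 + c0 * (1 + G2)) + 1 with hK
  -- energy bound
  have hen : ∫ x, (η x) ^ 2 * ∑ i, ‖pd W i x‖ ^ 2 ≤ c0 * (M ^ 2 + G2 * nsq W) := by
    refine (cacc hlam hA hW hηs (fun x => η.nonneg) (fun x => η.le_one) (M := M) ?_).trans ?_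
    · refine hsol _ (hW.cutc hηs) ?_
      have : tsupport (cutc η W) ⊆ tsupport η := by
        refine closure_mono fun x hx => ?_
        intro h
        exact hx (by simp [cutc, h])
      refine this.trans ?_
      rw [η.tsupport_eq]
      exact closedBall_subset_ball (by change (5 / 2 : ℝ) < 3; norm_num)
    · gcongr
      unfold nsq
      rw [← integral_const_mul]
      refine integral_mono (int_wt ?_ hW) (hW.int_sq.const_mul _) fun x => ?_
      · have := hηs.continuous_fderiv (by simp)
        fun_prop
      · have := hηG x
        dsimp only
        gcongr
  set v : Pt n → ℂ := fun x => (ζ x : ℂ) * W x with hv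
  have hvT : Tst v := hW.cut hζs
  have hv1 : ∀ x ∈ ball (0 : Pt n) 1, v x = W x := fun x hx => by
    have : ζ x = 1 := ζ.one_of_mem_closedBall (ball_subset_closedBall hx)
    simp [hv, this]
  have hnv : nsq v ≤ nsq W := by
    refine integral_mono hvT.int_sq hW.int_sq fun x => ?_
    simp only [hv, norm_mul, Complex.norm_real, Real.norm_eq_abs, abs_of_nonneg ζ.nonneg]
    gcongr
    · exact mul_nonneg ζ.nonneg (norm_nonneg _)
    · exact mul_le_of_le_one_left (norm_nonneg (W x)) ζ.le_one
  have hζη : ∀ x, ζ x ≤ η x := fun x => by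
    by_cases hx : x ∈ closedBall (0 : Pt n) 2
    · rw [η.one_of_mem_closedBall hx]; exact ζ.le_one
    · rw [ζ.zero_of_le_dist]
      · exact η.nonneg
      · change (3 / 2 : ℝ) ≤ dist x 0
        have : 2 < dist x 0 := by simpa using hx
        linarith
  have hηi : ∀ i, Integrable (fun x => (η x) ^ 2 * ‖pd W i x‖ ^ 2) := fun i =>
    int_wt (by have := hηs.continuous; fun_prop) (hW.pd i)
  have hgv : gsq v ≤ K * (nsq W + M ^ 2) := by
    have h1 : ∀ i, nsq (pd v i) ≤ 2 * (G1 * nsq W + ∫ x, (η x) ^ 2 * ‖pd W i x‖ ^ 2) := fun i => by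
      unfold nsq
      rw [← integral_const_mul, ← integral_add (hW.int_sq.const_mul _) (hηi i), ← integral_const_mul]
      refine integral_mono (hvT.pd i).int_sq (((hW.int_sq.const_mul _).add (hηi i)).const_mul _) fun x => ?_
      refine (cut_pd_bound hζs hW i x).trans ?_
      have a1 := hζG x
      have a2 := hζη x
      have a3 : 0 ≤ ζ x := ζ.nonneg
      gcongr
    calc gsq v ≤ ∑ i, 2 * (G1 * nsq W + ∫ x, (η x) ^ 2 * ‖pd W i x‖ ^ 2) := Finset.sum_le_sum fun i _ => h1 i
      _ = 2 * ((n + 1) * G1 * nsq W + ∫ x, (η x) ^ 2 * ∑ i, ‖pd W i x‖ ^ 2) := by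
          simp_rw [Finset.mul_sum]
          rw [integral_finsetSum _ fun i _ => hηi i]
          rw [← Finset.mul_sum, Finset.sum_add_distrib]
          simp; ring
      _ ≤ 2 * ((n + 1) * G1 * nsq W + c0 * (M ^ 2 + G2 * nsq W)) := by gcongr
      _ ≤ K * (nsq W + M ^ 2) := by
          have a := nsq_nonneg W
          have b := sq_nonneg M
          rw [hK]
          have d1 : 0 ≤ (n + 1) * G1 * M ^ 2 := by positivity
          have d2 : 0 ≤ c0 * nsq W := by positivity
          have d3 : 0 ≤ c0 * G2 * M ^ 2 := by positivity
          nlinarith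
  have hm := H A ε M hA hS hε hM h00 v hvT (fun ψ hψ hs => by
    rw [BF_congr isOpen_ball hv1 hs]
    exact hsol ψ hψ (hs.trans (ball_subset_ball (by norm_num)))) θ hθ hθ2
  have e : ∫ x in ball (0 : Pt n) θ, ‖W x‖ ^ 2 = ∫ x in ball (0 : Pt n) θ, ‖v x‖ ^ 2 := by
    refine setIntegral_congr_fun measurableSet_ball fun x hx => ?_
    change ‖W x‖ ^ 2 = ‖v x‖ ^ 2
    rw [hv1 x (ball_subset_ball (by linarith) hx)]
  rw [e]
  refine hm.trans ?_
  have g0 := gsq_nonneg v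
  calc _ = C * θ ^ (n + 2) * nsq v + (Cs * ε ^ 2 + 2 * s ^ 2) * gsq v + Cs * M ^ 2 := by ring
    _ ≤ _ := by gcongr

/-- hypotheses on the solution in the ball of radius `4` -/
structure Sol (r : ℝ) (Q : BPt n) (A : Pt n → Fin (n + 1) → Fin (n + 1) → ℂ) (u : Pt n → ℂ) : Prop where
  diff : ∀ x ∈ upperHalf n, DifferentiableAt ℝ u x
  en : ∀ i, ∫⁻ x in upperHalf n, ‖pd u i x‖ₑ ^ 2 < ∞
  sol : WeakSol0 A u
  tr : ∀ᵐ x' : BPt n, x' ∈ ball Q r → Tendsto (fun t : ℝ => u (pt t x')) (𝓝[>] 0) (𝓝 0)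

lemma norm_bdry_le (t : ℝ) (x' : BPt n) : ‖x'‖ ≤ ‖pt t x'‖ := by
  have := norm_pt_sq t x'
  rw [← sq_le_sq₀ (norm_nonneg _) (norm_nonneg _), this]
  nlinarith [sq_nonneg t]

lemma unit_aux {lam Lam : ℝ} (hLam : 0 ≤ Lam) {A : Pt n → Fin (n + 1) → Fin (n + 1) → ℂ}
    (hA : Coef lam Lam A) {u : Pt n → ℂ} (hu : Sol 4 0 A u)
    (hfin : ∫⁻ x in upperHalf n ∩ ball 0 4, ‖u x‖ₑ ^ 2 < ∞) {e : ℝ} (he : 0 < e) :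
    ∃ W, Tst W ∧ (∀ ψ, Tst ψ → tsupport ψ ⊆ ball 0 3 → ‖BF A W ψ‖ ≤ (n + 1) ^ 2 * Lam * e * √(gsq ψ)) ∧
      nsq W ≤ 2 * ((∫⁻ x in upperHalf n ∩ ball 0 4, ‖u x‖ₑ ^ 2).toReal + e ^ 2) ∧
      ∀ θ ≤ 1, ∫⁻ x in upperHalf n ∩ ball 0 θ, ‖u x‖ₑ ^ 2 ≤
        ENNReal.ofReal (2 * (e ^ 2 + ∫ x in ball (0 : Pt n) θ, ‖W x‖ ^ 2)) := by
  let ζ : ContDiffBump (0 : Pt n) := ⟨3, 7 / 2, by norm_num, by norm_num⟩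
  have hζs : ContDiff ℝ (⊤ : ℕ∞) (ζ : Pt n → ℝ) := ζ.contDiff
  have hζC := contDiff_ofReal hζs
  obtain ⟨G, hG, hζG⟩ := grad_bdd hζs ζ.hasCompactSupport
  have hΩm : MeasurableSet (upperHalf n) := isOpen_upperHalf.measurableSet
  set w : Pt n → ℂ := fun x => (ζ x : ℂ) * u x with hw
  have hz : ∀ x : Pt n, 7 / 2 ≤ ‖x‖ → ζ x = 0 := fun x hx => ζ.zero_of_le_dist (by simpa using hx)
  have hw3 : ∀ x ∈ ball (0 : Pt n) 3, w x = u x := fun x hx => by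
    have : ζ x = 1 := ζ.one_of_mem_closedBall (ball_subset_closedBall hx)
    simp [hw, this]
  have hwle : ∀ x, ‖w x‖ₑ ^ 2 ≤ (ball (0 : Pt n) 4).indicator (fun x => ‖u x‖ₑ ^ 2) x := fun x => by
    by_cases hx : x ∈ ball (0 : Pt n) 4
    · rw [indicator_of_mem hx]
      gcongr
      rw [enorm_le_iff_norm_le]
      simp only [hw, norm_mul, Complex.norm_real, Real.norm_eq_abs, abs_of_nonneg ζ.nonneg]
      exact mul_le_of_le_one_left (norm_nonneg (u x)) ζ.le_one
    · rw [indicator_of_notMem hx]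
      have : 4 ≤ ‖x‖ := by simpa using hx
      simp only [hw]
      rw [hz x (by linarith)]; simp
  set N := ∫⁻ x in upperHalf n ∩ ball 0 4, ‖u x‖ₑ ^ 2 with hN
  have hind : ∀ f : Pt n → ℝ≥0∞, ∫⁻ x in upperHalf n, (ball (0 : Pt n) 4).indicator f x =
      ∫⁻ x in upperHalf n ∩ ball 0 4, f x := fun f => by
    rw [lintegral_indicator measurableSet_ball, Measure.restrict_restrict measurableSet_ball, inter_comm]
  have hwN : ∫⁻ x in upperHalf n, ‖w x‖ₑ ^ 2 ≤ N := by
    rw [hN, ← hind]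
    exact lintegral_mono hwle
  have hwd : ∀ x ∈ upperHalf n, DifferentiableAt ℝ w x := fun x hx =>
    (hζC.differentiable (by simp) x).mul (hu.diff x hx)
  have hwg : ∀ i, ∫⁻ x in upperHalf n, ‖pd w i x‖ₑ ^ 2 < ∞ := fun i => by
    calc _ ≤ ∫⁻ x in upperHalf n, 2 * (‖pd u i x‖ₑ ^ 2 +
          ENNReal.ofReal G * (ball (0 : Pt n) 4).indicator (fun x => ‖u x‖ₑ ^ 2) x) := by
          refine setLIntegral_mono' hΩm fun x hx => ?_
          have e1 : pd w i x = ((fderiv ℝ ζ x (ee i) : ℝ) : ℂ) * u x + (ζ x : ℂ) * pd u i x := by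
            rw [← pd_ofReal hζs]
            exact pd_mul (hζC.differentiable (by simp) x) (hu.diff x hx) i
          rw [e1, add_comm]
          refine (pow_le_pow_left' (enorm_add_le _ _) 2).trans ((two_sq _ _).trans ?_)
          gcongr
          · rw [enorm_le_iff_norm_le, norm_mul, Complex.norm_real, Real.norm_eq_abs, abs_of_nonneg ζ.nonneg]
            exact mul_le_of_le_one_left (norm_nonneg _) ζ.le_one
          · by_cases hx4 : x ∈ ball (0 : Pt n) 4
            · rw [indicator_of_mem hx4, enorm_mul, mul_pow]
              gcongr
              rw [← ofReal_norm, Complex.norm_real, ← ENNReal.ofReal_pow (norm_nonneg _)]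
              refine ENNReal.ofReal_le_ofReal ?_
              rw [Real.norm_eq_abs, sq_abs]
              exact (Finset.single_le_sum (f := fun i => (fderiv ℝ ζ x (ee i)) ^ 2)
                (fun _ _ => sq_nonneg _) (Finset.mem_univ i)).trans (hζG x)
            · have h4 : 4 ≤ ‖x‖ := by simpa using hx4
              have : fderiv ℝ ζ x = 0 := by
                have : (ζ : Pt n → ℝ) =ᶠ[𝓝 x] fun _ => 0 := by
                  have ho : {y : Pt n | 7 / 2 < ‖y‖} ∈ 𝓝 x :=
                    (isOpen_lt continuous_const continuous_norm).mem_nhds (by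
                      change (7 / 2 : ℝ) < ‖x‖; linarith)
                  filter_upwards [ho] with y hy
                  exact hz y (le_of_lt hy)
                rw [this.fderiv_eq]; simp
              rw [this]; simp
      _ = 2 * ((∫⁻ x in upperHalf n, ‖pd u i x‖ₑ ^ 2) + ENNReal.ofReal G * N) := by
          rw [lintegral_const_mul' _ _ (by simp),
            lintegral_add_left ((measurable_pd u i).enorm.pow_const 2),
            lintegral_const_mul' _ _ (by finiteness), hind]
      _ < ∞ := ENNReal.mul_lt_top (by simp) (ENNReal.add_lt_top.2
          ⟨hu.en i, ENNReal.mul_lt_top (by simp) hfin⟩)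
  have hw0 : ∀ᵐ x' : BPt n, Tendsto (fun t : ℝ => w (pt t x')) (𝓝[>] 0) (𝓝 0) := by
    filter_upwards [hu.tr] with x' hx'
    by_cases h : x' ∈ ball (0 : BPt n) 4
    · refine squeeze_zero_norm (a := fun t => ‖u (pt t x')‖) (fun t => ?_)
        (by simpa using (hx' h).norm)
      simp only [hw, norm_mul, Complex.norm_real, Real.norm_eq_abs, abs_of_nonneg ζ.nonneg]
      exact mul_le_of_le_one_left (norm_nonneg _) ζ.le_one
    · have : ∀ t : ℝ, w (pt t x') = 0 := fun t => by
        have h4 : 4 ≤ ‖x'‖ := by simpa using h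
        have := norm_bdry_le t x'
        simp only [hw]
        rw [hz _ (by linarith)]; simp
      simp [this]
  obtain ⟨W, hW, hW1, hW2⟩ := approx hwd (R := 7 / 2) (fun x hx => by simp [hw, hz x hx]) hwg hw0
    (ε := ENNReal.ofReal (e ^ 2)) (by simp; positivity) (by simp)
  have hΩz : ∫⁻ x, ‖W x‖ₑ ^ 2 = ∫⁻ x in upperHalf n, ‖W x‖ₑ ^ 2 := by
    rw [← lintegral_indicator hΩm]
    congr 1; funext x
    by_cases hx : x ∈ upperHalf n
    · rw [indicator_of_mem hx]
    · rw [indicator_of_notMem hx, hW.zero_of_notMem hx]; simp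
  have hdm : Measurable ((upperHalf n).indicator fun x => w x - W x) := measurable_ind fun x hx =>
    (hwd x hx).sub (hW.diff x)
  have hdm' : AEMeasurable (fun x => ‖w x - W x‖ₑ ^ 2) (volume.restrict (upperHalf n)) := by
    refine (hdm.enorm.pow_const 2).aemeasurable.congr ?_
    filter_upwards [ae_restrict_mem hΩm] with x hx
    simp [indicator_of_mem hx]
  have hmem : ∀ (g : Pt n → ℂ), (∀ i, ∫⁻ x in upperHalf n, ‖pd g i x‖ₑ ^ 2 < ∞) → ∀ j,
      MemLp (pd g j) 2 (volume.restrict (upperHalf n)) := fun g hg j => by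
    refine ⟨(measurable_pd g j).aestronglyMeasurable, ?_⟩
    rw [eLpNorm_lt_top_iff_lintegral_rpow_enorm_lt_top (by simp) (by simp)]
    simpa using hg j
  refine ⟨W, hW, fun ψ hψ hs => ?_, ?_, fun θ hθ => ?_⟩
  · have h0 : BF A w ψ = 0 := by
      rw [BF_congr isOpen_ball hw3 hs]
      exact hu.sol ψ hψ.contDiff hψ.cpt hψ.supp
    have := BF_diff hLam hA (v := W) (w := w) (fun j => ((hW.pd j).memLp 2).restrict _) (hmem w hwg) he.le hW2 hψ
    rwa [h0, zero_sub, norm_neg] at this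
  · have hN' : ENNReal.ofReal N.toReal = N := ENNReal.ofReal_toReal hfin.ne
    rw [← ENNReal.ofReal_le_ofReal_iff (by positivity), hW.ofReal_nsq, hΩz,
      ENNReal.ofReal_mul (by norm_num), ENNReal.ofReal_add (by positivity) (by positivity), hN']
    calc _ ≤ ∫⁻ x in upperHalf n, 2 * (‖w x - W x‖ₑ ^ 2 + ‖w x‖ₑ ^ 2) := by
          refine lintegral_mono fun x => le_trans ?_ (two_sq _ _)
          gcongr
          have : W x = w x - (w x - W x) := by ring
          calc ‖W x‖ₑ = ‖w x - (w x - W x)‖ₑ := by rw [← this]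
            _ ≤ ‖w x‖ₑ + ‖w x - W x‖ₑ := enorm_sub_le
            _ = _ := add_comm _ _
      _ = 2 * ((∫⁻ x in upperHalf n, ‖w x - W x‖ₑ ^ 2) + ∫⁻ x in upperHalf n, ‖w x‖ₑ ^ 2) := by
          rw [lintegral_const_mul' _ _ (by simp), lintegral_add_left' hdm']
      _ ≤ 2 * (ENNReal.ofReal (e ^ 2) + N) := by gcongr
      _ = _ := by rw [add_comm]; simp
  · have hm : MeasurableSet (upperHalf n ∩ ball (0 : Pt n) θ) := hΩm.inter measurableSet_ball
    rw [ENNReal.ofReal_mul (by norm_num), ENNReal.ofReal_add (by positivity)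
      (integral_nonneg fun x => by positivity)]
    calc ∫⁻ x in upperHalf n ∩ ball 0 θ, ‖u x‖ₑ ^ 2
        ≤ ∫⁻ x in upperHalf n ∩ ball 0 θ, 2 * (‖w x - W x‖ₑ ^ 2 + ‖W x‖ₑ ^ 2) := by
          refine setLIntegral_mono' hm fun x hx => ?_
          rw [← hw3 x (ball_subset_ball (by linarith) hx.2)]
          refine le_trans ?_ (two_sq _ _)
          gcongr
          calc ‖w x‖ₑ = ‖(w x - W x) + W x‖ₑ := by rw [sub_add_cancel]
            _ ≤ _ := enorm_add_le _ _
      _ = 2 * ((∫⁻ x in upperHalf n ∩ ball 0 θ, ‖w x - W x‖ₑ ^ 2) +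
            ∫⁻ x in upperHalf n ∩ ball 0 θ, ‖W x‖ₑ ^ 2) := by
          rw [lintegral_const_mul' _ _ (by simp),
            lintegral_add_right _ (hW.cont.measurable.enorm.pow_const 2)]
      _ ≤ 2 * (ENNReal.ofReal (e ^ 2) + ENNReal.ofReal (∫ x in ball (0 : Pt n) θ, ‖W x‖ ^ 2)) := by
          gcongr
          · exact (lintegral_mono_set inter_subset_left).trans hW1
          · rw [ofReal_integral_eq_lintegral_ofReal hW.int_sq.integrableOn
              (Filter.Eventually.of_forall fun x => by positivity)]
            refine (lintegral_mono_set inter_subset_right).trans (le_of_eq ?_)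
            congr 1; funext x
            rw [← ofReal_norm, ENNReal.ofReal_pow (norm_nonneg _)]
      _ = _ := by simp

lemma unit_scale (n : ℕ) {lam Lam : ℝ} (hlam : 0 < lam) (hLam : 0 ≤ Lam) :
    ∃ θ ε : ℝ, 0 < θ ∧ θ ≤ 1 / 2 ∧ 0 < ε ∧
    ∀ (A : Pt n → Fin (n + 1) → Fin (n + 1) → ℂ), Coef lam Lam A → Sm ε A →
    (∀ x ∈ upperHalf n, A x 0 0 = 1) → ∀ u : Pt n → ℂ, Sol 4 0 A u →
    ∫⁻ x in upperHalf n ∩ ball 0 θ, ‖u x‖ₑ ^ 2 ≤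
      ENNReal.ofReal ((θ / 4) ^ (n + 1)) * ∫⁻ x in upperHalf n ∩ ball 0 4, ‖u x‖ₑ ^ 2 := by
  obtain ⟨C, K, hC, hK, H⟩ := tst_unit n (lam := lam) (Lam := Lam) hlam
  set θ : ℝ := min (1 / 2) (1 / (12 * C * 4 ^ (n + 1))) with hθd
  have hθ : 0 < θ := by rw [hθd]; positivity
  have hθ2 : θ ≤ 1 / 2 := min_le_left _ _
  set P : ℝ := (θ / 4) ^ (n + 1) with hP
  have hP0 : 0 < P := by positivity
  have hθC : 4 * C * θ ^ (n + 2) ≤ P / 3 := by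
    have h1 : θ ≤ 1 / (12 * C * 4 ^ (n + 1)) := min_le_right _ _
    rw [le_div_iff₀ (by positivity)] at h1
    have h2 : P / 3 = θ ^ (n + 1) / (3 * 4 ^ (n + 1)) := by rw [hP, div_pow]; field_simp
    rw [h2, le_div_iff₀ (by positivity)]
    calc 4 * C * θ ^ (n + 2) * (3 * 4 ^ (n + 1)) = θ ^ (n + 1) * (θ * (12 * C * 4 ^ (n + 1))) := by ring
      _ ≤ θ ^ (n + 1) * 1 := by gcongr
      _ = _ := by ring
  set s : ℝ := min (1 / 8) √(P / (24 * K)) with hsd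
  have hs : 0 < s := by rw [hsd]; positivity
  have hsK : 8 * s ^ 2 * K ≤ P / 3 := by
    have : s ^ 2 ≤ P / (24 * K) := by
      calc s ^ 2 ≤ √(P / (24 * K)) ^ 2 := by gcongr; exact min_le_right _ _
        _ = _ := Real.sq_sqrt (by positivity)
    rw [le_div_iff₀ (by positivity)] at this
    linarith
  obtain ⟨Cs, hCs, H⟩ := H s hs (min_le_left _ _)
  set ε : ℝ := √(P / (12 * Cs * K)) with hεd
  have hε : 0 < ε := by rw [hεd]; positivity
  have hεK : 4 * Cs * ε ^ 2 * K = P / 3 := by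
    rw [hεd, Real.sq_sqrt (by positivity)]; field_simp; norm_num
  refine ⟨θ, ε, hθ, hθ2, hε, fun A hA hS h00 u hu => ?_⟩
  by_cases hfin : ∫⁻ x in upperHalf n ∩ ball 0 4, ‖u x‖ₑ ^ 2 < ∞
  swap
  · rw [not_lt, top_le_iff] at hfin
    rw [hfin, ENNReal.mul_top (by simpa using hP0)]
    exact le_top
  set N := ∫⁻ x in upperHalf n ∩ ball 0 4, ‖u x‖ₑ ^ 2 with hN
  have hN' : ENNReal.ofReal N.toReal = N := ENNReal.ofReal_toReal hfin.ne
  have hN0 : 0 ≤ N.toReal := ENNReal.toReal_nonneg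
  set L : ℝ := (n + 1) ^ 2 * Lam with hL
  have hL0 : 0 ≤ L := by positivity
  set D : ℝ := 2 + 4 * C * θ ^ (n + 2) + 4 * (Cs * ε ^ 2 + 2 * s ^ 2) * K +
    2 * (Cs * ε ^ 2 + 2 * s ^ 2) * K * L ^ 2 + 2 * Cs * L ^ 2 with hD
  have hD0 : 0 < D := by positivity
  have main : ∀ e : ℝ, 0 < e → ∫⁻ x in upperHalf n ∩ ball 0 θ, ‖u x‖ₑ ^ 2 ≤
      ENNReal.ofReal (P * N.toReal + D * e ^ 2) := fun e he => by
    obtain ⟨W, hW, hsol, hn, hfinal⟩ := unit_aux hLam hA hu hfin he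
    refine (hfinal θ (by linarith)).trans (ENNReal.ofReal_le_ofReal ?_)
    have h1 := H A ε (L * e) hA hS hε.le (by positivity) h00 W hW (fun ψ hψ hs => by
      rw [hL]; exact hsol ψ hψ hs) θ hθ hθ2
    have hq : 0 ≤ Cs * ε ^ 2 + 2 * s ^ 2 := by positivity
    have h2 : ∫ x in ball (0 : Pt n) θ, ‖W x‖ ^ 2 ≤ C * θ ^ (n + 2) * (2 * (N.toReal + e ^ 2)) +
        (Cs * ε ^ 2 + 2 * s ^ 2) * (K * (2 * (N.toReal + e ^ 2) + (L * e) ^ 2)) + Cs * (L * e) ^ 2 := by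
      refine h1.trans ?_
      gcongr
    have h3 : (4 * C * θ ^ (n + 2) + 4 * Cs * ε ^ 2 * K + 8 * s ^ 2 * K) * N.toReal ≤ P * N.toReal := by
      gcongr
      linarith
    calc _ ≤ 2 * (e ^ 2 + (C * θ ^ (n + 2) * (2 * (N.toReal + e ^ 2)) +
        (Cs * ε ^ 2 + 2 * s ^ 2) * (K * (2 * (N.toReal + e ^ 2) + (L * e) ^ 2)) + Cs * (L * e) ^ 2)) := by
          gcongr
      _ = (4 * C * θ ^ (n + 2) + 4 * Cs * ε ^ 2 * K + 8 * s ^ 2 * K) * N.toReal + D * e ^ 2 := by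
          rw [hD]; ring
      _ ≤ _ := by gcongr
  rw [← hN', ← ENNReal.ofReal_mul hP0.le]
  have hlim : Tendsto (fun e : ℝ => ENNReal.ofReal (P * N.toReal + D * e ^ 2)) (𝓝[>] 0)
      (𝓝 (ENNReal.ofReal (P * N.toReal + D * 0 ^ 2))) := by
    refine ENNReal.tendsto_ofReal (Tendsto.mono_left ?_ nhdsWithin_le_nhds)
    exact Continuous.tendsto (f := fun e : ℝ => P * N.toReal + D * e ^ 2) (by fun_prop) 0
  have := ge_of_tendsto hlim (b := ∫⁻ x in upperHalf n ∩ ball 0 θ, ‖u x‖ₑ ^ 2)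
    (by filter_upwards [self_mem_nhdsWithin] with e he using main e he)
  simpa using this

/-! ### Scaling and iteration -/

/-- the affine rescaling -/
def Af (r : ℝ) (Q : BPt n) (x : Pt n) : Pt n := r • x + pt 0 Q

lemma dd_Af (r : ℝ) (Q : BPt n) (x : Pt n) : dd (Af r Q x) = r * dd x := by
  simp [Af, dd, pt_zero]

lemma Af_mem {r : ℝ} (hr : 0 < r) (Q : BPt n) (x : Pt n) : Af r Q x ∈ upperHalf n ↔ x ∈ upperHalf n := by
  change 0 < dd _ ↔ 0 < dd _
  rw [dd_Af, mul_pos_iff_of_pos_left hr]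

lemma contDiff_Af (r : ℝ) (Q : BPt n) : ContDiff ℝ (⊤ : ℕ∞) (Af r Q : Pt n → Pt n) := by
  unfold Af; fun_prop

lemma hasFDerivAt_Af (r : ℝ) (Q : BPt n) (x : Pt n) :
    HasFDerivAt (Af r Q : Pt n → Pt n) (r • ContinuousLinearMap.id ℝ (Pt n)) x := by
  exact ((hasFDerivAt_id x).const_smul r).add_const _

lemma lint_Af {r : ℝ} (hr : 0 < r) (Q : BPt n) (f : Pt n → ℝ≥0∞) :
    ∫⁻ x, f (Af r Q x) = ENNReal.ofReal ((r ^ (n + 1))⁻¹) * ∫⁻ x, f x := by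
  have h := (Homeomorph.smulOfNeZero r hr.ne' : Pt n ≃ₜ Pt n).measurableEmbedding.lintegral_map
    (μ := volume) (fun x => f (x + pt 0 Q))
  have h2 := Measure.map_addHaar_smul (volume : Measure (Pt n)) hr.ne'
  have h3 : ((Homeomorph.smulOfNeZero r hr.ne' : Pt n ≃ₜ Pt n) : Pt n → Pt n) = (r • ·) := rfl
  rw [h3, h2, lintegral_smul_measure] at h
  rw [lintegral_add_right_eq_self f (pt 0 Q)] at h
  simp only [finrank_euclideanSpace, Fintype.card_fin] at h
  rw [abs_of_pos (by positivity)] at h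
  exact h.symm

lemma int_Af {r : ℝ} (hr : 0 < r) (Q : BPt n) (f : Pt n → ℂ) :
    ∫ x, f (Af r Q x) = (((r ^ (n + 1))⁻¹ : ℝ) : ℂ) * ∫ x, f x := by
  have h := Measure.integral_comp_smul (volume : Measure (Pt n)) (fun x => f (x + pt 0 Q)) r
  rw [integral_add_right_eq_self f (pt 0 Q)] at h
  simp only [finrank_euclideanSpace, Fintype.card_fin] at h
  rw [abs_of_pos (by positivity)] at h
  rw [← Complex.real_smul]
  exact h

lemma lint_Af_on {r : ℝ} (hr : 0 < r) (Q : BPt n) (f : Pt n → ℝ≥0∞) {S S' : Set (Pt n)}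
    (hS : MeasurableSet S) (hS' : MeasurableSet S') (h : ∀ x, Af r Q x ∈ S' ↔ x ∈ S) :
    ∫⁻ x in S, f (Af r Q x) = ENNReal.ofReal ((r ^ (n + 1))⁻¹) * ∫⁻ x in S', f x := by
  rw [← lintegral_indicator hS, ← lintegral_indicator hS', ← lint_Af hr Q]
  congr 1; funext x
  by_cases hx : x ∈ S
  · rw [indicator_of_mem hx, indicator_of_mem ((h x).2 hx)]
  · rw [indicator_of_notMem hx, indicator_of_notMem (fun h' => hx ((h x).1 h'))]

lemma fderiv_Af {E : Type*} [NormedAddCommGroup E] [NormedSpace ℝ E] {g : Pt n → E} {r : ℝ} (hr : 0 < r)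
    (Q : BPt n) (x : Pt n) :
    fderiv ℝ (fun x => g (Af r Q x)) x = r • fderiv ℝ g (Af r Q x) := by
  have h1 := fderiv_comp_smul (𝕜 := ℝ) (f := fun y => g (y + pt 0 Q)) (x := x) r
  have h2 : fderiv ℝ (fun y => g (y + pt 0 Q)) (r • x) = fderiv ℝ g (r • x + pt 0 Q) :=
    fderiv_comp_add_right _
  rw [h2] at h1
  exact h1

lemma pd_Af (g : Pt n → ℂ) {r : ℝ} (hr : 0 < r) (Q : BPt n) (i : Fin (n + 1)) (x : Pt n) :
    pd (fun x => g (Af r Q x)) i x = (r : ℂ) * pd g i (Af r Q x) := by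
  simp only [pd, pdG]
  rw [fderiv_Af hr Q x]
  simp

lemma Coef.scale {lam Lam : ℝ} {A : Pt n → Fin (n + 1) → Fin (n + 1) → ℂ} (hA : Coef lam Lam A) {r : ℝ}
    (hr : 0 < r) (Q : BPt n) : Coef lam Lam (fun x => A (Af r Q x)) :=
  ⟨hA.smooth.comp (contDiff_Af r Q).contDiffOn fun x hx => (Af_mem hr Q x).2 hx,
    fun x hx => hA.ell _ ((Af_mem hr Q x).2 hx), fun x hx => hA.bdd _ ((Af_mem hr Q x).2 hx)⟩

lemma Sm.scale {ε : ℝ} {A : Pt n → Fin (n + 1) → Fin (n + 1) → ℂ} (hA : Sm ε A) {r : ℝ}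
    (hr : 0 < r) (Q : BPt n) : Sm ε (fun x => A (Af r Q x)) := fun x hx i j => by
  rw [fderiv_Af (g := fun x => A x i j) hr Q x, norm_smul, Real.norm_eq_abs, abs_of_pos hr]
  have h := hA _ ((Af_mem hr Q x).2 hx) i j
  rw [dd_Af] at h
  have hx' : 0 < dd x := hx
  calc _ ≤ r * (ε / (r * dd x)) := by gcongr
    _ = ε / dd x := by field_simp

lemma Af_pt (r : ℝ) (Q : BPt n) (t : ℝ) (x' : BPt n) : Af r Q (pt t x') = pt (r * t) (r • x' + Q) := by
  ext i
  refine Fin.cases ?_ (fun j => ?_) i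
  · simp [Af, pt_zero]
  · simp [Af, pt_succ]

lemma Sol.scale {r R : ℝ} {Q : BPt n} {A : Pt n → Fin (n + 1) → Fin (n + 1) → ℂ} {u : Pt n → ℂ}
    (h : Sol R Q A u) (hr : 0 < r) (hR : 4 * r ≤ R) :
    Sol 4 0 (fun x => A (Af r Q x)) (fun x => u (Af r Q x)) := by
  have hΩm : MeasurableSet (upperHalf n) := isOpen_upperHalf.measurableSet
  refine ⟨fun x hx => ?_, fun i => ?_, fun φ hφ hc hs => ?_, ?_⟩
  · exact (h.diff _ ((Af_mem hr Q x).2 hx)).comp x (hasFDerivAt_Af r Q x).differentiableAt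
  · simp_rw [pd_Af u hr Q i, enorm_mul, mul_pow]
    rw [lintegral_const_mul' _ _ (by finiteness),
      lint_Af_on hr Q (fun y => ‖pd u i y‖ₑ ^ 2) hΩm hΩm (Af_mem hr Q)]
    exact ENNReal.mul_lt_top (by finiteness) (ENNReal.mul_lt_top (by simp) (h.en i))
  · set B : Pt n → Pt n := fun y => r⁻¹ • (y - pt 0 Q) with hB
    have hBA : ∀ x, B (Af r Q x) = x := fun x => by
      simp [hB, Af, smul_smul, inv_mul_cancel₀ hr.ne']
    have hAB : ∀ y, Af r Q (B y) = y := fun y => by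
      simp [hB, Af, smul_smul, mul_inv_cancel₀ hr.ne']
    have hBc : ContDiff ℝ (⊤ : ℕ∞) B := by rw [hB]; fun_prop
    set ψ : Pt n → ℂ := fun y => φ (B y) with hψ
    let Ah : Pt n ≃ₜ Pt n := ⟨⟨Af r Q, B, hBA, hAB⟩, (contDiff_Af r Q).continuous, hBc.continuous⟩
    have hts : tsupport ψ = Ah '' tsupport φ := by
      have : ψ = φ ∘ Ah.symm := rfl
      rw [this, tsupport_comp_eq_preimage, ← Ah.image_eq_preimage_symm]
    have hψc : HasCompactSupport ψ := by
      unfold HasCompactSupport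
      rw [hts]
      exact hc.isCompact.image Ah.continuous
    have hψs : tsupport ψ ⊆ upperHalf n := by
      rw [hts]
      rintro _ ⟨x, hx, rfl⟩
      exact (Af_mem hr Q x).2 (hs hx)
    have hsol := h.sol ψ (hφ.comp hBc) hψc hψs
    have hφe : φ = fun x => ψ (Af r Q x) := by funext x; simp [hψ, hBA]
    rw [← integral_indicator hΩm] at hsol ⊢
    have key : ((upperHalf n).indicator fun x => ∑ i, ∑ j, A (Af r Q x) i j *
        pd (fun x => u (Af r Q x)) j x * pd φ i x) = fun x => (r : ℂ) ^ 2 * (upperHalf n).indicator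
          (fun x => ∑ i, ∑ j, A x i j * pd u j x * pd ψ i x) (Af r Q x) := by
      funext x
      by_cases hx : x ∈ upperHalf n
      · rw [indicator_of_mem hx, indicator_of_mem ((Af_mem hr Q x).2 hx), Finset.mul_sum]
        refine Finset.sum_congr rfl fun i _ => ?_
        rw [Finset.mul_sum]
        refine Finset.sum_congr rfl fun j _ => ?_
        rw [pd_Af u hr Q j x]
        have : pd φ i x = (r : ℂ) * pd ψ i (Af r Q x) := by
          conv_lhs => rw [hφe]
          exact pd_Af ψ hr Q i x
        rw [this]; ring
      · rw [indicator_of_notMem hx, indicator_of_notMem (fun h' => hx ((Af_mem hr Q x).1 h')), mul_zero]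
    rw [key, integral_const_mul, int_Af hr Q ((upperHalf n).indicator
          (fun x => ∑ i, ∑ j, A x i j * pd u j x * pd ψ i x)), hsol]
    simp
  · have q1 := (measurePreserving_add_right (volume : Measure (BPt n)) Q).quasiMeasurePreserving
    have q2 := Measure.quasiMeasurePreserving_smul (volume : Measure (BPt n)) hr.ne'
    have := (q1.comp q2).ae h.tr
    filter_upwards [this] with x' hx' hb
    have hb' : r • x' + Q ∈ ball Q R := by
      rw [mem_ball, dist_eq_norm, add_sub_cancel_right, norm_smul, Real.norm_eq_abs, abs_of_pos hr]
      have : ‖x'‖ < 4 := by simpa using hb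
      nlinarith
    have ht := hx' hb'
    have hmul : Tendsto (fun t : ℝ => r * t) (𝓝[>] 0) (𝓝[>] 0) := by
      refine tendsto_nhdsWithin_iff.2 ⟨?_, ?_⟩
      · have : Tendsto (fun t : ℝ => r * t) (𝓝 0) (𝓝 (r * 0)) := (continuous_const.mul continuous_id).tendsto 0
        rw [mul_zero] at this
        exact this.mono_left nhdsWithin_le_nhds
      · filter_upwards [self_mem_nhdsWithin] with t ht
        exact mul_pos hr ht
    have := ht.comp hmul
    refine this.congr fun t => ?_
    simp only [Function.comp, Af_pt]

lemma decay (n : ℕ) {lam Lam : ℝ} (hlam : 0 < lam) (hLam : 0 ≤ Lam) :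
    ∃ C ε : ℝ, 0 < C ∧ 0 < ε ∧
    ∀ (A : Pt n → Fin (n + 1) → Fin (n + 1) → ℂ), Coef lam Lam A → Sm ε A →
    (∀ x ∈ upperHalf n, A x 0 0 = 1) → ∀ (u : Pt n → ℂ) (Q : BPt n) (R : ℝ), Sol R Q A u →
    ∀ ρ, 0 < ρ → ρ ≤ R → ∫⁻ x in upperHalf n ∩ ball (pt 0 Q) ρ, ‖u x‖ₑ ^ 2 ≤
      ENNReal.ofReal (C * (ρ / R) ^ (n + 1)) * ∫⁻ x in upperHalf n ∩ ball (pt 0 Q) R, ‖u x‖ₑ ^ 2 := by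
  obtain ⟨θ, ε, hθ, hθ2, hε, H⟩ := unit_scale n (lam := lam) (Lam := Lam) hlam hLam
  set τ : ℝ := θ / 4 with hτ
  have hτ0 : 0 < τ := by positivity
  have hτ1 : τ < 1 := by rw [hτ]; linarith
  refine ⟨(τ⁻¹) ^ (n + 1), ε, by positivity, hε, fun A hA hS h00 u Q R hu ρ hρ hρR => ?_⟩
  have hΩm : MeasurableSet (upperHalf n) := isOpen_upperHalf.measurableSet
  set b : ℝ → ℝ≥0∞ := fun ρ => ∫⁻ x in upperHalf n ∩ ball (pt 0 Q) ρ, ‖u x‖ₑ ^ 2 with hb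
  have hR0 : 0 < R := by linarith
  have hmem : ∀ (r s : ℝ), 0 < r → ∀ x, Af r Q x ∈ upperHalf n ∩ ball (pt 0 Q) (r * s) ↔
      x ∈ upperHalf n ∩ ball (0 : Pt n) s := fun r s hr x => by
    rw [mem_inter_iff, mem_inter_iff, Af_mem hr Q x, mem_ball, mem_ball, dist_eq_norm, dist_zero_right]
    have : ‖Af r Q x - pt 0 Q‖ = r * ‖x‖ := by
      simp [Af, norm_smul, abs_of_pos hr]
    rw [this, mul_lt_mul_iff_right₀ hr]
  have step : ∀ S, 0 < S → S ≤ R → b (τ * S) ≤ ENNReal.ofReal (τ ^ (n + 1)) * b S := fun S hS0 hSR => by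
    have hr : 0 < S / 4 := by positivity
    have h1 := H _ (hA.scale hr Q) (hS.scale hr Q) (fun x hx => h00 _ ((Af_mem hr Q x).2 hx)) _
      (hu.scale hr (by linarith))
    rw [lint_Af_on hr Q (fun x => ‖u x‖ₑ ^ 2) (hΩm.inter measurableSet_ball)
        (hΩm.inter measurableSet_ball) (hmem (S / 4) θ hr),
      lint_Af_on hr Q (fun x => ‖u x‖ₑ ^ 2) (hΩm.inter measurableSet_ball)
        (hΩm.inter measurableSet_ball) (hmem (S / 4) 4 hr)] at h1
    have e1 : S / 4 * θ = τ * S := by rw [hτ]; ring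
    have e2 : S / 4 * 4 = S := by ring
    rw [e1, e2, mul_left_comm] at h1
    have c0 : ENNReal.ofReal (((S / 4) ^ (n + 1))⁻¹) ≠ 0 := by
      exact (ENNReal.ofReal_pos.2 (by positivity)).ne'
    exact (ENNReal.mul_le_mul_iff_right c0 (by simp)).1 h1
  have iter : ∀ k : ℕ, b (τ ^ k * R) ≤ ENNReal.ofReal ((τ ^ k) ^ (n + 1)) * b R := fun k => by
    induction k with
    | zero => simp
    | succ k ih =>
      have hk1 : τ ^ k ≤ 1 := pow_le_one₀ hτ0.le hτ1.le
      have := step (τ ^ k * R) (by positivity) (by nlinarith)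
      calc b (τ ^ (k + 1) * R) = b (τ * (τ ^ k * R)) := by congr 1; ring
        _ ≤ ENNReal.ofReal (τ ^ (n + 1)) * b (τ ^ k * R) := this
        _ ≤ ENNReal.ofReal (τ ^ (n + 1)) * (ENNReal.ofReal ((τ ^ k) ^ (n + 1)) * b R) := by gcongr
        _ = _ := by
          rw [← mul_assoc, ← ENNReal.ofReal_mul (by positivity)]
          congr 2; ring
  obtain ⟨k, hk1, hk2⟩ := exists_nat_pow_near_of_lt_one (x := ρ / R) (y := τ) (by positivity)
    ((div_le_one hR0).2 hρR) hτ0 hτ1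
  calc b ρ ≤ b (τ ^ k * R) := by
        refine lintegral_mono_set (inter_subset_inter_right _ (ball_subset_ball ?_))
        rwa [← div_le_iff₀ hR0]
    _ ≤ ENNReal.ofReal ((τ ^ k) ^ (n + 1)) * b R := iter k
    _ ≤ _ := by
        gcongr
        rw [← mul_pow]
        gcongr
        rw [pow_succ, mul_comm] at hk1
        rw [← div_eq_inv_mul, le_div_iff₀ hτ0, mul_comm]
        exact hk1.le

/-! ### From the hypotheses of the theorem to `Coef`, `Sm`, `Sol` -/

lemma ae_nonneg_all {F : Pt n → ℝ} (hF : ContinuousOn F (upperHalf n))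
    (h : ∀ᵐ x ∂(volume.restrict (upperHalf n)), 0 ≤ F x) : ∀ x ∈ upperHalf n, 0 ≤ F x := by
  have ho : IsOpen (upperHalf n ∩ F ⁻¹' Iio 0) := hF.isOpen_inter_preimage isOpen_upperHalf isOpen_Iio
  have hz : volume (upperHalf n ∩ F ⁻¹' Iio 0) = 0 := by
    rw [ae_restrict_iff' isOpen_upperHalf.measurableSet] at h
    refine measure_mono_null ?_ h
    intro x hx hn
    exact absurd (hn hx.1) (not_le.2 hx.2)
  have he := ho.measure_eq_zero_iff (μ := (volume : Measure (Pt n))) |>.1 hz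
  intro x hx
  by_contra hlt
  have : x ∈ upperHalf n ∩ F ⁻¹' Iio 0 := ⟨hx, not_le.1 hlt⟩
  rw [he] at this
  exact this

lemma coef_of_ell {lam Lam : ℝ} (hlam : 0 < lam) {A : Pt n → Fin (n + 1) → Fin (n + 1) → ℂ}
    (hs : ContDiffOn ℝ (⊤ : ℕ∞) A (upperHalf n)) (h : IsPElliptic 2 lam Lam (upperHalf n) A) :
    Coef lam Lam A := by
  have hc : ∀ i j, ContinuousOn (fun x => A x i j) (upperHalf n) := fun i j =>
    continuousOn_pi.1 (continuousOn_pi.1 hs.continuousOn i) j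
  have hn : ∀ ξ : EuclideanSpace ℂ (Fin (n + 1)), ‖ξ‖ ^ 2 = ∑ i, ‖ξ i‖ ^ 2 := fun ξ =>
    EuclideanSpace.norm_sq_eq ξ
  refine ⟨hs, fun x hx ξ => ?_, fun x hx ξ η => ?_⟩
  · have h1 := ae_nonneg_all (F := fun x =>
      (∑ i, (∑ j, A x i j * ξ j) * (starRingEnd ℂ) (ξ i)).re - lam * ∑ i, ‖ξ i‖ ^ 2) ?_ ?_ x hx
    · simpa using h1
    · refine ContinuousOn.sub ?_ continuousOn_const
      refine Complex.continuous_re.comp_continuousOn ?_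
      refine continuousOn_finset_sum _ fun i _ => ContinuousOn.mul ?_ continuousOn_const
      exact continuousOn_finset_sum _ fun j _ => (hc i j).mul continuousOn_const
    · filter_upwards [h.1] with y hy
      have h2 := hy (WithLp.toLp 2 ξ)
      rw [hn] at h2
      have hJ : ∀ i, Jp 2 (WithLp.toLp 2 ξ) i = (1 / 2 : ℝ) * ξ i := fun i => by
        apply Complex.ext <;> simp [Jp] <;> ring
      have h3 : (∑ i, (∑ j, A y i j * ξ j) * (starRingEnd ℂ) (Jp 2 (WithLp.toLp 2 ξ) i)) =
          ((1 / 2 : ℝ) : ℂ) * ∑ i, (∑ j, A y i j * ξ j) * (starRingEnd ℂ) (ξ i) := by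
        rw [Finset.mul_sum]
        refine Finset.sum_congr rfl fun i _ => ?_
        rw [hJ, map_mul, Complex.conj_ofReal]; ring
      change lam * ∑ i, ‖ξ i‖ ^ 2 ≤ (∑ i, (∑ j, A y i j * ξ j) *
        (starRingEnd ℂ) (Jp 2 (WithLp.toLp 2 ξ) i)).re at h2
      rw [h3, Complex.re_ofReal_mul] at h2
      have : 0 ≤ lam * ∑ i, ‖ξ i‖ ^ 2 := by positivity
      linarith
  · have h1 := ae_nonneg_all (F := fun x => Lam * √(∑ i, ‖ξ i‖ ^ 2) * √(∑ i, ‖η i‖ ^ 2) -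
      ‖∑ i, (∑ j, A x i j * ξ j) * η i‖) ?_ ?_ x hx
    · simpa using h1
    · refine ContinuousOn.sub continuousOn_const (ContinuousOn.norm ?_)
      refine continuousOn_finset_sum _ fun i _ => ContinuousOn.mul ?_ continuousOn_const
      exact continuousOn_finset_sum _ fun j _ => (hc i j).mul continuousOn_const
    · filter_upwards [h.2] with y hy
      have h2 := hy (WithLp.toLp 2 ξ) (WithLp.toLp 2 fun i => (starRingEnd ℂ) (η i))
      rw [EuclideanSpace.norm_eq, EuclideanSpace.norm_eq] at h2
      simpa using h2

lemma norm_fderiv_entry {A : Pt n → Fin (n + 1) → Fin (n + 1) → ℂ} {x : Pt n}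
    (hA : DifferentiableAt ℝ A x) (i j : Fin (n + 1)) :
    ‖fderiv ℝ (fun x => A x i j) x‖ ≤ ‖fderiv ℝ A x‖ := by
  have h1 := hasFDerivAt_pi'.1 (hasFDerivAt_pi'.1 hA.hasFDerivAt i) j
  rw [h1.fderiv]
  refine ContinuousLinearMap.opNorm_le_bound _ (norm_nonneg _) fun v => ?_
  have h2 : ‖fderiv ℝ A x v i j‖ ≤ ‖fderiv ℝ A x v‖ :=
    (norm_le_pi_norm (fderiv ℝ A x v i) j).trans (norm_le_pi_norm (fderiv ℝ A x v) i)
  exact h2.trans (ContinuousLinearMap.le_opNorm _ _)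

lemma dist_dd (x y : Pt n) : |dd x - dd y| ≤ dist x y := by
  rw [← dd_sub, dist_eq_norm, abs_le]
  constructor
  · have := dd_le_norm (-(x - y))
    rw [norm_neg] at this
    have h : dd (-(x - y)) = - dd (x - y) := by simp [dd]
    linarith
  · exact dd_le_norm _

lemma sm_of_carleson (n : ℕ) {ε : ℝ} (hε : 0 < ε) : ∃ K : ℝ, 0 < K ∧
    ∀ A : Pt n → Fin (n + 1) → Fin (n + 1) → ℂ, ContDiffOn ℝ (⊤ : ℕ∞) A (upperHalf n) →
    carlesonNorm (coefMeasureA A) < ENNReal.ofReal K → Sm ε A := by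
  set v : ℝ≥0∞ := volume (ball (0 : Pt n) 1) with hv
  set w : ℝ≥0∞ := volume (ball (0 : BPt n) 1) with hw
  have hv0 : 0 < v := measure_ball_pos _ _ one_pos
  have hw0 : 0 < w := measure_ball_pos _ _ one_pos
  have hvt : v ≠ ∞ := measure_ball_lt_top.ne
  have hwt : w ≠ ∞ := measure_ball_lt_top.ne
  have hv' : 0 < v.toReal := ENNReal.toReal_pos hv0.ne' hvt
  have hw' : 0 < w.toReal := ENNReal.toReal_pos hw0.ne' hwt
  set c : ℝ := (1 / 2) * (1 / 8) ^ (n + 1) * v.toReal / (2 ^ n * w.toReal) with hc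
  have hc0 : 0 < c := by positivity
  refine ⟨c * ε ^ 2, by positivity, fun A hA hK x hx i j => ?_⟩
  have hΩm : MeasurableSet (upperHalf n) := isOpen_upperHalf.measurableSet
  have hd : 0 < dd x := hx
  set d := dd x with hdd
  refine (norm_fderiv_entry ((hA.contDiffAt (isOpen_upperHalf.mem_nhds hx)).differentiableAt (by simp)) i j).trans ?_
  set g : ℝ := ‖fderiv ℝ A x‖ with hg
  have hg0 : 0 ≤ g := norm_nonneg _
  have hsub : ball x (d / 8) ⊆ upperHalf n ∩ ball (pt 0 (bdry x)) (2 * d) := by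
    intro y hy
    rw [mem_ball] at hy
    have h1 := abs_le.1 (dist_dd y x)
    refine ⟨?_, ?_⟩
    · change 0 < dd y
      linarith [h1.1]
    · rw [mem_ball]
      have h2 : dist x (pt 0 (bdry x)) = d := by
        have e : x - pt 0 (bdry x) = pt d 0 := by
          ext i
          refine Fin.cases ?_ (fun k => ?_) i
          · simp [pt_zero, hdd, dd]
          · simp [pt_succ, bdry]
        rw [dist_eq_norm, e]
        have := norm_pt_sq (n := n) d 0
        rw [norm_zero] at this
        have h3 : ‖(pt d 0 : Pt n)‖ ^ 2 = d ^ 2 := by rw [this]; ring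
        exact (sq_eq_sq₀ (norm_nonneg _) hd.le).1 h3
      linarith [dist_triangle y x (pt 0 (bdry x))]
  have h1 : coefMeasureA A (upperHalf n ∩ ball (pt 0 (bdry x)) (2 * d)) / volume (ball (0 : BPt n) (2 * d))
      ≤ carlesonNorm (coefMeasureA A) := by
    unfold carlesonNorm
    exact le_iSup_of_le (bdry x) (le_iSup_of_le (2 * d) (le_iSup_of_le (by positivity) le_rfl))
  have h2 : ENNReal.ofReal (g ^ 2 * (d / 2)) * volume (ball x (d / 8)) ≤
      coefMeasureA A (upperHalf n ∩ ball (pt 0 (bdry x)) (2 * d)) := by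
    unfold coefMeasureA
    rw [withDensity_apply _ (hΩm.inter measurableSet_ball), Measure.restrict_restrict
      (hΩm.inter measurableSet_ball)]
    have e : upperHalf n ∩ ball (pt 0 (bdry x)) (2 * d) ∩ upperHalf n =
      upperHalf n ∩ ball (pt 0 (bdry x)) (2 * d) := by
      ext y; simp only [mem_inter_iff]; tauto
    rw [e]
    refine le_trans ?_ (lintegral_mono_set hsub)
    rw [← setLIntegral_const]
    refine setLIntegral_mono' measurableSet_ball fun y hy => ?_
    rw [mem_ball] at hy
    have h3 := abs_le.1 (dist_dd y x)
    unfold coefDensityA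
    rw [ENNReal.ofReal_mul (by positivity)]
    gcongr
    · refine le_iSup_of_le x (le_iSup_of_le ?_ ?_)
      · rw [mem_ball, dist_comm]; linarith [h3.1]
      · rw [ENNReal.ofReal_pow hg0, hg, ofReal_norm (x := fderiv ℝ A x)]
        rw [ENNReal.rpow_two]; exact le_rfl
    · linarith [h3.1]
  rw [Measure.addHaar_ball_of_pos _ _ (by positivity)] at h1 h2
  simp only [finrank_euclideanSpace, Fintype.card_fin] at h1 h2
  rw [← hv] at h2
  rw [← hw] at h1
  have h4 : ENNReal.ofReal (g ^ 2 * (d / 2)) * (ENNReal.ofReal ((d / 8) ^ (n + 1)) * v) <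
      ENNReal.ofReal (c * ε ^ 2) * (ENNReal.ofReal ((2 * d) ^ n) * w) := by
    refine h2.trans_lt ?_
    rw [← ENNReal.div_lt_iff]
    · exact h1.trans_lt hK
    · left; exact (ENNReal.mul_pos (ENNReal.ofReal_pos.2 (by positivity)).ne' hw0.ne').ne'
    · left; finiteness
  rw [← ENNReal.ofReal_toReal hvt, ← ENNReal.ofReal_toReal hwt, ← ENNReal.ofReal_mul (by positivity),
    ← ENNReal.ofReal_mul (by positivity), ← ENNReal.ofReal_mul (by positivity),
    ← ENNReal.ofReal_mul (by positivity), ENNReal.ofReal_lt_ofReal_iff (by positivity)] at h4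
  have h5 : g ^ 2 * (d / 2) * ((d / 8) ^ (n + 1) * v.toReal) =
      (g * d) ^ 2 * (c * ((2 * d) ^ n * w.toReal)) := by
    rw [hc, mul_pow 2 d n]
    field_simp
    try ring
  have h6 : c * ε ^ 2 * ((2 * d) ^ n * w.toReal) = ε ^ 2 * (c * ((2 * d) ^ n * w.toReal)) := by ring
  rw [h5, h6] at h4
  have h7 := lt_of_mul_lt_mul_right h4 (by positivity)
  rw [le_div_iff₀ hd]
  exact (lt_of_pow_lt_pow_left₀ 2 hε.le h7).le

lemma sol_of {A : Pt n → Fin (n + 1) → Fin (n + 1) → ℂ} {u : Pt n → ℂ} {f : BPt n → ℂ} {Q Q' : BPt n}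
    {r r' : ℝ} (hw : WeakSol0 A u) (hd : ∀ x ∈ upperHalf n, DifferentiableAt ℝ u x) (he : Energy u)
    (ht : HasTrace u f) (hf : ∀ x' ∈ ball Q r, f x' = 0) (hs : ball Q' r' ⊆ ball Q r) : Sol r' Q' A u := by
  refine ⟨hd, fun i => lt_of_le_of_lt ?_ he, hw, ?_⟩
  · refine lintegral_mono fun x => ?_
    rw [ENNReal.rpow_two]
    gcongr
    change ‖pd u i x‖ₑ ≤ ‖fderiv ℝ u x‖ₑ
    rw [← ofReal_norm (x := pd u i x), ← ofReal_norm (x := fderiv ℝ u x)]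
    refine ENNReal.ofReal_le_ofReal ?_
    have := (fderiv ℝ u x).le_opNorm (EuclideanSpace.single i (1 : ℝ))
    simpa [pd, pdG] using this
  · filter_upwards [ht] with x' hx' hb
    rwa [hf x' (hs hb)] at hx'

/-! ### Assembly -/

lemma dist_bdry (x y : Pt n) : dist (bdry x) (bdry y) ≤ dist x y := by
  have h := norm_bdry_le (dd (x - y)) (bdry (x - y))
  rw [pt_eta] at h
  rw [dist_eq_norm, dist_eq_norm]
  exact h

lemma dist_pt_le (x : Pt n) (x' : BPt n) : dist x (pt 0 x') ≤ dist (bdry x) x' + |dd x| := by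
  have e : x - pt 0 x' = pt (dd x) (bdry x - x') := by
    ext i
    refine Fin.cases ?_ (fun k => ?_) i
    · simp [pt_zero, dd]
    · simp [pt_succ, bdry]
  rw [dist_eq_norm, dist_eq_norm, e, ← sq_le_sq₀ (norm_nonneg _) (by positivity), norm_pt_sq,
    ← sq_abs (dd x)]
  nlinarith [norm_nonneg (bdry x - x'), abs_nonneg (dd x)]

lemma avg_sq (u : Pt n → ℂ) (x : Pt n) : avg 2 u x ^ (2 : ℝ) =
    (volume (ball x (dd x / 2)))⁻¹ * ∫⁻ z in ball x (dd x / 2), ‖u z‖ₑ ^ 2 := by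
  unfold avg
  rw [← ENNReal.rpow_mul]
  norm_num
  rfl

lemma avg_le_ntMax {a : ℝ} (u : Pt n → ℂ) {x : Pt n} {z' : BPt n} (hx : 0 < dd x)
    (h : dist z' (bdry x) < a * dd x) : avg 2 u x ≤ ntMax 2 a u z' := by
  unfold ntMax
  refine le_iSup_of_le x (le_iSup_of_le ⟨hx, ?_⟩ le_rfl)
  rw [bdry_pt, dd_pt, zero_sub, abs_neg, abs_of_pos hx]
  exact h

set_option maxHeartbeats 1000000 in
lemma whitney {a : ℝ} (ha : 0 < a) {u : Pt n → ℂ} (hd : ∀ x ∈ upperHalf n, DifferentiableAt ℝ u x)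
    (x' : BPt n) {ρ : ℝ} (hρ : 0 < ρ) :
    ∫⁻ y in upperHalf n ∩ ball (pt 0 x') ρ, ‖u y‖ₑ ^ 2 ≤
      ENNReal.ofReal ((5 / 2) ^ (n + 1) * (2 * ρ)) *
        ∫⁻ z' in ball x' (2 * ρ), ntMax 2 a u z' ^ (2 : ℝ) := by
  have hΩm : MeasurableSet (upperHalf n) := isOpen_upperHalf.measurableSet
  set v : ℝ≥0∞ := volume (ball (0 : Pt n) 1) with hv
  have hv0 : v ≠ 0 := (measure_ball_pos _ _ one_pos).ne'
  have hvt : v ≠ ∞ := measure_ball_lt_top.ne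
  set U : Pt n → ℝ≥0∞ := fun y => ‖(upperHalf n).indicator u y‖ₑ ^ 2 with hU
  have hUm : Measurable U := (measurable_ind hd).enorm.pow_const 2
  have hUe : ∀ y ∈ upperHalf n, U y = ‖u y‖ₑ ^ 2 := fun y hy => by
    simp only [hU]; rw [indicator_of_mem hy]
  set S := strp (2 * ρ) (ball x' (2 * ρ)) with hS
  have hSm : MeasurableSet S := meas_strp _ measurableSet_ball
  set G : Pt n → ℝ≥0∞ := fun x => ENNReal.ofReal ((5 / dd x) ^ (n + 1)) * v⁻¹ with hG
  have hGm : Measurable G :=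
    ((measurable_const.div measurable_dd).pow_const _).ennreal_ofReal.mul_const _
  set D : Set (Pt n × Pt n) := {q | dist q.2 q.1 < dd q.1 / 2} with hD
  have hDm : MeasurableSet D := by
    refine measurableSet_lt ?_ ((measurable_dd.comp measurable_fst).div_const 2)
    exact measurable_snd.dist measurable_fst
  set k : Pt n → Pt n → ℝ≥0∞ := fun x y => D.indicator (fun _ => 1) (x, y) with hk
  have hkm : Measurable (Function.uncurry k) := measurable_const.indicator hDm
  clear_value v U G k
  have one : ∀ y ∈ upperHalf n ∩ ball (pt 0 x') ρ, 1 ≤ ∫⁻ x in S, G x * k x y := fun y hy => by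
    have hy0 : 0 < dd y := hy.1
    have hy1 : dist y (pt 0 x') < ρ := hy.2
    have hy2 := dist_dd y (pt 0 x')
    rw [dd_pt, sub_zero, abs_of_pos hy0] at hy2
    have hy3 := dist_bdry y (pt 0 x')
    rw [bdry_pt] at hy3
    have near : ∀ x ∈ ball y (dd y / 4), 3 / 4 * dd y < dd x ∧ dd x < 5 / 4 * dd y ∧
        dist (bdry x) (bdry y) < dd y / 4 ∧ dist y x < dd y / 4 := fun x hx => by
      rw [mem_ball] at hx
      have h1 := abs_le.1 (dist_dd x y)
      have h2 := dist_bdry x y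
      rw [dist_comm y x]
      refine ⟨by linarith [h1.1], by linarith [h1.2], by linarith, hx⟩
    have hsub : ball y (dd y / 4) ⊆ S := fun x hx => by
      obtain ⟨h1, h2, h3, h4⟩ := near x hx
      refine ⟨by linarith, by linarith, ?_⟩
      rw [mem_ball]
      linarith [dist_triangle (bdry x) (bdry y) x']
    refine le_trans ?_ (lintegral_mono_set hsub)
    have hc : (1 : ℝ≥0∞) = ∫⁻ x in ball y (dd y / 4), ENNReal.ofReal ((4 / dd y) ^ (n + 1)) * v⁻¹ := by
      rw [setLIntegral_const, Measure.addHaar_ball_of_pos _ _ (by positivity)]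
      simp only [finrank_euclideanSpace, Fintype.card_fin]
      rw [← hv, mul_comm (ENNReal.ofReal ((dd y / 4) ^ (n + 1))) v, mul_assoc, ← mul_assoc v⁻¹,
        ENNReal.inv_mul_cancel hv0 hvt, one_mul, ← ENNReal.ofReal_mul (by positivity), ← mul_pow]
      have : 4 / dd y * (dd y / 4) = 1 := by field_simp
      rw [this]; simp
    rw [hc]
    refine setLIntegral_mono' measurableSet_ball fun x hx => ?_
    obtain ⟨h1, h2, h3, h4⟩ := near x hx
    have hx0 : 0 < dd x := by linarith
    have hkx : k x y = 1 := by
      simp only [hk]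
      rw [indicator_of_mem]
      change dist y x < dd x / 2
      linarith
    rw [hkx, mul_one]
    simp only [hG]
    gcongr ENNReal.ofReal (?_ ^ _) * _
    rw [div_le_div_iff₀ hy0 hx0]
    linarith
  set F : Pt n → ℝ≥0∞ := fun x => G x * ∫⁻ y, k x y * U y with hF
  have hkU : Measurable (Function.uncurry fun x y => k x y * U y) :=
    hkm.mul (hUm.comp measurable_snd)
  have hK1 : Measurable (fun q : Pt n × Pt n => k q.2 q.1) := hkm.comp measurable_swap
  have hK2 : Measurable (fun q : Pt n × Pt n => k q.2 q.1 * U q.1) := hK1.mul (hUm.comp measurable_fst)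
  have hK3 : Measurable (Function.uncurry fun y x => G x * (k x y * U y)) :=
    (hGm.comp measurable_snd).mul hK2
  have hFm : Measurable F := hGm.mul hkU.lintegral_prod_right
  have hFle : ∀ (t : ℝ) (z' : BPt n), 0 < t →
      F (pt t z') ≤ ENNReal.ofReal ((5 / 2) ^ (n + 1)) * ntMax 2 a u z' ^ (2 : ℝ) := fun t z' ht => by
    have hN : avg 2 u (pt t z') ^ (2 : ℝ) ≤ ntMax 2 a u z' ^ (2 : ℝ) := by
      gcongr
      refine avg_le_ntMax u (by rwa [dd_pt]) ?_
      rw [bdry_pt, dd_pt, dist_self]; positivity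
    refine le_trans ?_ (mul_le_mul_right hN _)
    rw [avg_sq]
    simp only [hF, hG, dd_pt]
    have hball : ball (pt t z') (t / 2) ⊆ upperHalf n := fun y hy => by
      have h1 := abs_le.1 (dist_dd y (pt t z'))
      rw [mem_ball] at hy
      rw [dd_pt] at h1
      change 0 < dd y
      linarith [h1.1]
    have hin : ∫⁻ y, k (pt t z') y * U y = ∫⁻ z in ball (pt t z') (t / 2), ‖u z‖ₑ ^ 2 := by
      rw [← lintegral_indicator measurableSet_ball]
      congr 1; funext y
      by_cases hy : y ∈ ball (pt t z') (t / 2)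
      · rw [indicator_of_mem hy, hUe y (hball hy)]
        have : k (pt t z') y = 1 := by
          simp only [hk]
          rw [indicator_of_mem]
          change dist y (pt t z') < dd (pt t z') / 2
          rw [dd_pt]; exact hy
        rw [this, one_mul]
      · rw [indicator_of_notMem hy]
        have : k (pt t z') y = 0 := by
          simp only [hk]
          rw [indicator_of_notMem]
          intro h
          change dist y (pt t z') < dd (pt t z') / 2 at h
          rw [dd_pt] at h; exact hy h
        rw [this, zero_mul]
    rw [hin, ← mul_assoc]
    refine mul_le_mul' ?_ le_rfl
    rw [Measure.addHaar_ball_of_pos _ _ (by positivity)]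
    simp only [finrank_euclideanSpace, Fintype.card_fin]
    rw [← hv, ENNReal.mul_inv (Or.inr hvt) (Or.inr hv0), ← mul_assoc,
      ← ENNReal.ofReal_inv_of_pos (by positivity), ← ENNReal.ofReal_mul (by positivity), ← inv_pow,
      ← mul_pow]
    have : 5 / 2 * (t / 2)⁻¹ = 5 / t := by field_simp
    rw [this]
  have hFS : ∫⁻ x in S, F x = ∫⁻ z' in ball x' (2 * ρ), ∫⁻ t in Ioo 0 (2 * ρ), F (pt t z') :=
    lint_strp measurableSet_ball hFm
  clear_value F S
  calc ∫⁻ y in upperHalf n ∩ ball (pt 0 x') ρ, ‖u y‖ₑ ^ 2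
      ≤ ∫⁻ y in upperHalf n ∩ ball (pt 0 x') ρ, ∫⁻ x in S, G x * (k x y * U y) := by
        refine setLIntegral_mono' (hΩm.inter measurableSet_ball) fun y hy => ?_
        have e : ∀ x, G x * (k x y * U y) = G x * k x y * U y := fun x => by ring
        simp_rw [e]
        rw [lintegral_mul_const' _ _ (by simp [hU]), hUe y hy.1]
        calc ‖u y‖ₑ ^ 2 = 1 * ‖u y‖ₑ ^ 2 := (one_mul _).symm
          _ ≤ _ := by gcongr; exact one y hy
    _ ≤ ∫⁻ y, ∫⁻ x in S, G x * (k x y * U y) := setLIntegral_le_lintegral _ _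
    _ = ∫⁻ x in S, ∫⁻ y, G x * (k x y * U y) := by
        exact lintegral_lintegral_swap hK3.aemeasurable
    _ = ∫⁻ x in S, F x := by
        refine lintegral_congr fun x => ?_
        simp only [hF]
        rw [lintegral_const_mul]
        exact hkU.comp measurable_prodMk_left
    _ = ∫⁻ z' in ball x' (2 * ρ), ∫⁻ t in Ioo 0 (2 * ρ), F (pt t z') := hFS
    _ ≤ ∫⁻ z' in ball x' (2 * ρ), ENNReal.ofReal ((5 / 2) ^ (n + 1) * (2 * ρ)) *
          ntMax 2 a u z' ^ (2 : ℝ) := by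
        refine lintegral_mono fun z' => ?_
        calc ∫⁻ t in Ioo 0 (2 * ρ), F (pt t z')
            ≤ ∫⁻ t in Ioo 0 (2 * ρ), ENNReal.ofReal ((5 / 2) ^ (n + 1)) * ntMax 2 a u z' ^ (2 : ℝ) :=
              setLIntegral_mono' measurableSet_Ioo fun t ht => hFle t z' ht.1
          _ = _ := by
              rw [setLIntegral_const, Real.volume_Ioo, sub_zero,
                ENNReal.ofReal_mul (p := (5 / 2) ^ (n + 1)) (by positivity), mul_right_comm]
    _ = _ := lintegral_const_mul' _ _ (by simp)

lemma large_height {a κ ρ : ℝ} (ha : 0 < a) (hκ : 0 < κ) (hρ : 0 < ρ) (u : Pt n → ℂ) {Q x' : BPt n}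
    (hx' : x' ∈ ball Q ρ) {x : Pt n} (hx : 0 < dd x) (hxx : dist x' (bdry x) < a * dd x)
    (hh : κ * ρ ≤ dd x) :
    avg 2 u x ^ (2 : ℝ) ≤ ENNReal.ofReal ((12 / min (a * κ / 2) 1) ^ n) *
      avgI (ball Q (12 * ρ)) (fun x' => ntMax 2 a u x' ^ (2 : ℝ)) := by
  set σ : ℝ := min (a * κ / 2) 1 with hσ
  have hσ0 : 0 < σ := by rw [hσ]; positivity
  have hσ1 : σ ≤ 1 := min_le_right _ _
  have hσ2 : σ ≤ a * κ / 2 := min_le_left _ _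
  clear_value σ
  set w : ℝ≥0∞ := volume (ball (0 : BPt n) 1) with hw
  have hw0 : w ≠ 0 := (measure_ball_pos _ _ one_pos).ne'
  have hwt : w ≠ ∞ := measure_ball_lt_top.ne
  have hah : 0 < a * dd x := by positivity
  set τ : ℝ := σ * ρ / (a * dd x) with hτ
  have hτ0 : 0 < τ := by positivity
  have hτe : τ * (a * dd x) = σ * ρ := by rw [hτ]; field_simp
  have hτ1 : τ ≤ 1 := by
    rw [hτ, div_le_one hah]
    have h1 : σ * ρ ≤ a * κ / 2 * ρ := by gcongr
    have h2 : a * (κ * ρ) ≤ a * dd x := by gcongr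
    nlinarith
  set p' : BPt n := x' + τ • (bdry x - x') with hp
  rw [dist_comm, dist_eq_norm] at hxx
  have h1 : dist p' x' < σ * ρ := by
    rw [hp, dist_eq_norm, add_sub_cancel_left, norm_smul, Real.norm_eq_abs, abs_of_pos hτ0, ← hτe]
    gcongr
  have h2 : dist p' (bdry x) ≤ (1 - τ) * (a * dd x) := by
    have e : p' - bdry x = (-(1 - τ)) • (bdry x - x') := by rw [hp]; module
    rw [dist_eq_norm, e, norm_smul, norm_neg, Real.norm_eq_abs, abs_of_nonneg (by linarith)]
    exact mul_le_mul_of_nonneg_left hxx.le (by linarith)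
  have hsub : ball p' (σ * ρ) ⊆ ball Q (12 * ρ) := fun z hz => by
    rw [mem_ball] at hz hx' ⊢
    have t1 := dist_triangle z p' Q
    have t2 := dist_triangle p' x' Q
    have : σ * ρ ≤ 1 * ρ := by gcongr
    linarith
  have key : volume (ball p' (σ * ρ)) * avg 2 u x ^ (2 : ℝ) ≤
      ∫⁻ z' in ball Q (12 * ρ), ntMax 2 a u z' ^ (2 : ℝ) := by
    refine le_trans ?_ (lintegral_mono_set hsub)
    rw [mul_comm, ← setLIntegral_const]
    refine setLIntegral_mono' measurableSet_ball fun z hz => ?_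
    gcongr
    refine avg_le_ntMax u hx ?_
    rw [mem_ball] at hz
    have t1 := dist_triangle z p' (bdry x)
    nlinarith
  unfold avgI
  rw [Measure.addHaar_ball_of_pos _ _ (by positivity)] at key ⊢
  simp only [finrank_euclideanSpace, Fintype.card_fin] at key ⊢
  rw [← hw] at key ⊢
  have hc0 : ENNReal.ofReal ((σ * ρ) ^ n) * w ≠ 0 :=
    mul_ne_zero (ENNReal.ofReal_pos.2 (by positivity)).ne' hw0
  have hct : ENNReal.ofReal ((σ * ρ) ^ n) * w ≠ ∞ := by finiteness
  rw [mul_comm, ← ENNReal.le_div_iff_mul_le (Or.inl hc0) (Or.inl hct), ENNReal.div_eq_inv_mul] at key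
  refine key.trans ?_
  rw [← mul_assoc]
  refine mul_le_mul' ?_ le_rfl
  rw [ENNReal.mul_inv (Or.inr hwt) (Or.inr hw0), ENNReal.mul_inv (Or.inr hwt) (Or.inr hw0), ← mul_assoc,
    ← ENNReal.ofReal_inv_of_pos (by positivity), ← ENNReal.ofReal_inv_of_pos (by positivity),
    ← ENNReal.ofReal_mul (by positivity), ← inv_pow, ← inv_pow, ← mul_pow]
  have : 12 / σ * (12 * ρ)⁻¹ = (σ * ρ)⁻¹ := by field_simp
  rw [this]

lemma pointwise_bound (n : ℕ) {lam Lam a : ℝ} (hlam : 0 < lam) (hLam : 0 < Lam) (ha : 0 < a) :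
    ∃ K C : ℝ, 0 < K ∧ 0 < C ∧
      ∀ (A : Pt n → Fin (n + 1) → Fin (n + 1) → ℂ) (u : Pt n → ℂ) (f : BPt n → ℂ)
        (Q : BPt n) (ρ : ℝ), 0 < ρ →
        ContDiffOn ℝ (⊤ : ℕ∞) A (upperHalf n) →
        IsPElliptic 2 lam Lam (upperHalf n) A →
        (∀ x ∈ upperHalf n, A x 0 0 = 1) →
        carlesonNorm (coefMeasureA A) < ENNReal.ofReal K →
        WeakSol0 A u → (∀ x ∈ upperHalf n, DifferentiableAt ℝ u x) → Energy u →
        HasTrace u f →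
        (∀ x' ∈ ball Q (16 * ρ), f x' = 0) →
        ∀ x' ∈ ball Q ρ, ntMax 2 a u x' ^ (2 : ℝ) ≤ ENNReal.ofReal C *
            avgI (ball Q (12 * ρ)) (fun x' => ntMax 2 a u x' ^ (2 : ℝ)) := by
  obtain ⟨C0, ε, hC0, hε, H⟩ := decay n hlam hLam.le
  obtain ⟨K, hK, HK⟩ := sm_of_carleson n hε
  set v : ℝ≥0∞ := volume (ball (0 : Pt n) 1) with hv
  set w : ℝ≥0∞ := volume (ball (0 : BPt n) 1) with hw
  have hv0 : v ≠ 0 := (measure_ball_pos _ _ one_pos).ne'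
  have hvt : v ≠ ∞ := measure_ball_lt_top.ne
  have hw0 : w ≠ 0 := (measure_ball_pos _ _ one_pos).ne'
  have hwt : w ≠ ∞ := measure_ball_lt_top.ne
  have hv' : 0 < v.toReal := ENNReal.toReal_pos hv0 hvt
  have hw' : 0 < w.toReal := ENNReal.toReal_pos hw0 hwt
  set κ : ℝ := 1 / (a + 2) with hκ
  have hκ0 : 0 < κ := by positivity
  set C1 : ℝ := (12 / min (a * κ / 2) 1) ^ n with hC1
  have hC1p : 0 < C1 := by positivity
  set C2 : ℝ := C0 * (5 * (a + 2)) ^ (n + 1) * 2 * 12 ^ n * w.toReal / v.toReal with hC2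
  have hC2p : 0 < C2 := by positivity
  refine ⟨K, C1 + C2, hK, by positivity, fun A u f Q ρ hρ hA hell h00 hcarl hws hd he htr hf x' hx' => ?_⟩
  have hcoef := coef_of_ell hlam hA hell
  have hSm := HK A hA hcarl
  set M : ℝ≥0∞ := avgI (ball Q (12 * ρ)) (fun x' => ntMax 2 a u x' ^ (2 : ℝ)) with hM
  suffices hpt : ∀ x ∈ cone a (pt 0 x'), avg 2 u x ^ (2 : ℝ) ≤ ENNReal.ofReal (C1 + C2) * M by
    refine (ENNReal.le_rpow_inv_iff (by norm_num : (0 : ℝ) < 2)).1 ?_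
    unfold ntMax
    exact iSup₂_le fun x hx => (ENNReal.le_rpow_inv_iff (by norm_num : (0 : ℝ) < 2)).2 (hpt x hx)
  intro x hx
  obtain ⟨hx0, hxd⟩ := hx
  rw [bdry_pt, dd_pt, zero_sub, abs_neg, abs_of_pos hx0] at hxd
  rcases le_or_gt (κ * ρ) (dd x) with hh | hh
  · refine (large_height ha hκ0 hρ u hx' hx0 hxd hh).trans ?_
    gcongr
    linarith
  · have hr : (a + 2) * dd x ≤ ρ := by
      rw [hκ] at hh
      have : (a + 2) * dd x ≤ (a + 2) * (1 / (a + 2) * ρ) := by gcongr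
      refine this.trans (le_of_eq ?_)
      field_simp
    rw [mem_ball] at hx'
    have hsol : Sol ρ x' A u := sol_of hws hd he htr hf (ball_subset_ball' (by linarith))
    have h1 := H A hcoef hSm h00 u x' ρ hsol ((a + 2) * dd x) (by positivity) hr
    have h2 := whitney ha hd x' hρ
    have hb : ball x (dd x / 2) ⊆ upperHalf n ∩ ball (pt 0 x') ((a + 2) * dd x) := fun y hy => by
      rw [mem_ball] at hy
      have t1 := abs_le.1 (dist_dd y x)
      refine ⟨?_, ?_⟩
      · change 0 < dd y
        linarith [t1.1]
      · rw [mem_ball]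
        have t2 := dist_pt_le x x'
        rw [abs_of_pos hx0, dist_comm] at t2
        have t3 := dist_triangle y x (pt 0 x')
        rw [dist_comm x (pt 0 x')] at t3
        rw [dist_comm (bdry x) x'] at t2
        nlinarith
    have h3 : ∫⁻ z' in ball x' (2 * ρ), ntMax 2 a u z' ^ (2 : ℝ) ≤
        ENNReal.ofReal ((12 * ρ) ^ n) * w * M := by
      rw [hM, avgI, ← mul_assoc, Measure.addHaar_ball_of_pos _ _ (by positivity)]
      simp only [finrank_euclideanSpace, Fintype.card_fin]
      rw [← hw, ENNReal.mul_inv_cancel (mul_ne_zero (ENNReal.ofReal_pos.2 (by positivity)).ne' hw0)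
        (by finiteness), one_mul]
      exact lintegral_mono_set (ball_subset_ball' (by linarith))
    rw [avg_sq, Measure.addHaar_ball_of_pos _ _ (by positivity)]
    simp only [finrank_euclideanSpace, Fintype.card_fin]
    rw [← hv]
    calc _ ≤ (ENNReal.ofReal ((dd x / 2) ^ (n + 1)) * v)⁻¹ *
          (ENNReal.ofReal (C0 * ((a + 2) * dd x / ρ) ^ (n + 1)) *
            (ENNReal.ofReal ((5 / 2) ^ (n + 1) * (2 * ρ)) * (ENNReal.ofReal ((12 * ρ) ^ n) * w * M))) := by
          refine mul_le_mul' le_rfl ((lintegral_mono_set hb).trans (h1.trans ?_))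
          exact mul_le_mul' le_rfl (h2.trans (mul_le_mul' le_rfl h3))
      _ = ENNReal.ofReal C2 * M := by
          rw [← ENNReal.ofReal_toReal hvt, ← ENNReal.ofReal_toReal hwt,
            ← ENNReal.ofReal_mul (by positivity), ← ENNReal.ofReal_inv_of_pos (by positivity)]
          simp only [← mul_assoc]
          rw [← ENNReal.ofReal_mul (by positivity), ← ENNReal.ofReal_mul (by positivity),
            ← ENNReal.ofReal_mul (by positivity), ← ENNReal.ofReal_mul (by positivity)]
          congr 2
          rw [hC2]
          simp only [mul_pow, div_pow]
          field_simp
          ring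
      _ ≤ _ := by
          gcongr
          linarith

/-- reverse Hölder inequality (`eq-pf9`): under the hypotheses of the
extended-range Dirichlet theorem with smooth coefficients and small Carleson norm, for
`2 < p < p_max` there are `β, m > 1` and `C > 0` such that for every boundary ball `Δ` and
every energy solution whose boundary datum vanishes on `4βmΔ`,
`(⨍_Δ [Ñ_{2,a}(u)]^p)^{1/p} ≤ C (⨍_{3βmΔ} [Ñ_{2,a}(u)]²)^{1/2}`.  The range condition
`p < p_max` is encoded without division as in the Dirichlet theorem. -/
theorem reverse_holder_ntmax
    (n : ℕ) (hn : 1 ≤ n) (p lam Lam a : ℝ)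
    (hp : 2 < p) (hlam : 0 < lam) (hLam : 0 < Lam) (ha : 0 < a) :
    ∃ K β m C : ℝ, 0 < K ∧ 1 < β ∧ 1 < m ∧ 0 < C ∧
      ∀ (A : Pt n → Fin (n + 1) → Fin (n + 1) → ℂ) (u : Pt n → ℂ) (f : BPt n → ℂ)
        (Q : BPt n) (ρ : ℝ), 0 < ρ →
        -- smooth coefficients, elliptic with constants `lam`, `Lam`
        ContDiffOn ℝ (⊤ : ℕ∞) A (upperHalf n) →
        IsPElliptic 2 lam Lam (upperHalf n) A →
        (∀ x ∈ upperHalf n, A x 0 0 = 1) →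
        (∀ x ∈ upperHalf n, ∀ j : Fin (n + 1), j ≠ 0 → (A x 0 j).im = 0) →
        -- `p < p_max`
        (((n : ℝ) * (pZero (upperHalf n) A Lam - 1) - pZero (upperHalf n) A Lam ≤ 0) ∨
          p * ((n : ℝ) * (pZero (upperHalf n) A Lam - 1) - pZero (upperHalf n) A Lam) <
            pZero (upperHalf n) A Lam * (n : ℝ)) →
        -- small Carleson norm
        carlesonNorm (coefMeasureA A) < ENNReal.ofReal K →
        -- `u` is an energy solution with boundary datum `f`
        WeakSol0 A u → (∀ x ∈ upperHalf n, DifferentiableAt ℝ u x) → Energy u →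
        HasTrace u f →
        -- `f` vanishes on `4βmΔ`
        (∀ x' ∈ ball Q (4 * β * m * ρ), f x' = 0) →
        -- conclusion: reverse Hölder inequality for `Ñ_{2,a}(u)`
        (avgI (ball Q ρ) (fun x' => ntMax 2 a u x' ^ p)) ^ (1 / p) ≤
          ENNReal.ofReal C *
            (avgI (ball Q (3 * β * m * ρ))
              (fun x' => ntMax 2 a u x' ^ (2 : ℝ))) ^ (1 / (2 : ℝ)) := by
  obtain ⟨K, C, hK, hC, H⟩ := pointwise_bound n hlam hLam ha
  refine ⟨K, 2, 2, C ^ (1 / (2 : ℝ)), hK, by norm_num, by norm_num, by positivity, ?_⟩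
  intro A u f Q ρ hρ hA hell h00 _ _ hcarl hws hd he htr hf
  have e16 : (4 * 2 * 2 * ρ : ℝ) = 16 * ρ := by ring
  have e12 : (3 * 2 * 2 * ρ : ℝ) = 12 * ρ := by ring
  rw [e16] at hf
  rw [e12]
  have hb := H A u f Q ρ hρ hA hell h00 hcarl hws hd he htr hf
  set M : ℝ≥0∞ := avgI (ball Q (12 * ρ)) (fun x' => ntMax 2 a u x' ^ (2 : ℝ)) with hM
  have hp0 : 0 < p := by linarith
  have hB : ∀ x' ∈ ball Q ρ, ntMax 2 a u x' ≤
      ENNReal.ofReal (C ^ (1 / (2 : ℝ))) * M ^ (1 / (2 : ℝ)) := fun x' hx' => by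
    rw [← ENNReal.ofReal_rpow_of_pos hC, ← ENNReal.mul_rpow_of_nonneg _ _ (by norm_num), one_div]
    exact (ENNReal.le_rpow_inv_iff (by norm_num : (0 : ℝ) < 2)).2 (hb x' hx')
  set B : ℝ≥0∞ := ENNReal.ofReal (C ^ (1 / (2 : ℝ))) * M ^ (1 / (2 : ℝ)) with hBdef
  rw [one_div]
  refine (ENNReal.rpow_inv_le_iff hp0).2 ?_
  unfold avgI
  have h1 : ∫⁻ y in ball Q ρ, ntMax 2 a u y ^ p ≤ B ^ p * volume (ball Q ρ) := by
    rw [← setLIntegral_const]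
    exact setLIntegral_mono' measurableSet_ball fun y hy => ENNReal.rpow_le_rpow (hB y hy) hp0.le
  calc _ ≤ (volume (ball Q ρ))⁻¹ * (B ^ p * volume (ball Q ρ)) := mul_le_mul' le_rfl h1
    _ = B ^ p := by
      rw [mul_comm (B ^ p), ← mul_assoc, ENNReal.inv_mul_cancel (measure_ball_pos _ _ hρ).ne'
        measure_ball_lt_top.ne, one_mul]

end DP
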